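/- arXiv:math/0605642 — 5 statements merged into one kernel-verified Lean document; each statement's English description precedes it below -/
import Mathlib

section
/- Let (X_n, Y_n), n ≥ 1, be pairs of random vectors with X_n ∈ ℝ^q and Y_n ∈ ℝ^r (q, r ≥ 1) such that each X_n is stochastically monotone with respect to Y_n. Suppose there exist real numbers a_n > 0, c_n > 0 and vectors b_n ∈ ℝ^q, d_n ∈ ℝ^r such that (a_n^{-1}(X_n − b_n), c_n^{-1}(Y_n − d_n)) converges in distribution to a pair of random vectors (X, Y). Let y_n ∈ ℝ^r be a sequence with c_n^{-1}(y_n − d_n) → ξ for some ξ ∈ ℝ^r, and let X̃_n be a random vector whose distribution equals ℒ(X_n | Y_n = y_n), computed using the stochastically monotone version of the conditional distribution. Assume that ξ is an interior point of the support of the distribution of Y and that there exists a version of y ↦ ℒ(X | Y = y) that is continuous at y = ξ as a map from ℝ^r into the space of probability measures on ℝ^q with the topology of weak convergence. Then a_n^{-1}(X̃_n − b_n) converges in distribution to ℒ(X | Y = ξ), the value at ξ of this continuous version. -/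
open MeasureTheory ProbabilityTheory Filter Topology

noncomputable section

/-- Convergence in distribution (weak convergence of laws): integrals of every bounded
continuous function converge. -/
def TendstoInDistribution {E : Type*} [MeasurableSpace E] [TopologicalSpace E]
    (μs : ℕ → Measure E) (μ : Measure E) : Prop :=
  ∀ f : BoundedContinuousFunction E ℝ,
    Tendsto (fun n => ∫ x, f x ∂(μs n)) atTop (𝓝 (∫ x, f x ∂μ))

/-- `κ` is a version of the conditional distribution of the first coordinate given the
second coordinate, for the joint law `μ`: it is a Markov kernel which disintegrates `μ`. -/
def IsCondLaw {E F : Type*} [MeasurableSpace E] [MeasurableSpace F]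
    (μ : Measure (E × F)) (κ : Kernel F E) : Prop :=
  IsMarkovKernel κ ∧
  ∀ s : Set E, ∀ t : Set F, MeasurableSet s → MeasurableSet t →
    μ (s ×ˢ t) = ∫⁻ z in t, κ z s ∂(μ.map Prod.snd)

/-- A family of measures `κ z` (conditional distributions) is stochastically increasing:
`P(X ≤ x | Y = z)` is weakly decreasing in `z`. -/
def StochIncrFam {E F : Type*} [MeasurableSpace E] [Preorder E] [Preorder F]
    (κ : F → Measure E) : Prop :=
  ∀ z₁ z₂ : F, z₁ ≤ z₂ → ∀ x : E, κ z₂ {w | w ≤ x} ≤ κ z₁ {w | w ≤ x}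

/-- A family of measures `κ z` is stochastically decreasing: `P(X ≥ x | Y = z)` is weakly
decreasing in `z` (equivalently, `-X` is stochastically increasing). -/
def StochDecrFam {E F : Type*} [MeasurableSpace E] [Preorder E] [Preorder F]
    (κ : F → Measure E) : Prop :=
  ∀ z₁ z₂ : F, z₁ ≤ z₂ → ∀ x : E, κ z₂ {w | x ≤ w} ≤ κ z₁ {w | x ≤ w}

/-- Covariance of two real functionals under a measure. -/
def covFn {E : Type*} [MeasurableSpace E] (μ : Measure E) (f g : E → ℝ) : ℝ :=
  ∫ x, f x * g x ∂μ - (∫ x, f x ∂μ) * (∫ x, g x ∂μ)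

/-- A measure on a real normed space is Gaussian (jointly normal, possibly degenerate) if
every continuous linear functional pushes it forward to a one-dimensional Gaussian law. -/
def IsGaussianMeasure {E : Type*} [NormedAddCommGroup E] [NormedSpace ℝ E]
    [MeasurableSpace E] (μ : Measure E) : Prop :=
  ∀ L : E →L[ℝ] ℝ, ∃ m : ℝ, ∃ v : NNReal, μ.map (fun x => L x) = gaussianReal m v

/-- The (closed) support of a measure on a topological space. -/
def measureSupport {E : Type*} [TopologicalSpace E] [MeasurableSpace E] (μ : Measure E) :
    Set E :=
  {x | ∀ U : Set E, IsOpen U → x ∈ U → 0 < μ U}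

lemma condLaw_eq {E F : Type*} [MeasurableSpace E] [MeasurableSpace F]
    {μ : Measure (E × F)} [IsProbabilityMeasure μ] {κ : Kernel F E} (h : IsCondLaw μ κ) :
    μ = ((μ.map Prod.snd) ⊗ₘ κ).map Prod.swap := by
  have := h.1
  have : IsProbabilityMeasure (μ.map Prod.snd) :=
    Measure.isProbabilityMeasure_map measurable_snd.aemeasurable
  apply Measure.ext_prod
  intro s t hs ht
  rw [h.2 s t hs ht, Measure.map_apply measurable_swap (hs.prod ht), Set.preimage_swap_prod,
    Measure.compProd_apply_prod ht hs]

lemma integral_condLaw {E F : Type*} [MeasurableSpace E] [MeasurableSpace F]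
    {μ : Measure (E × F)} [IsProbabilityMeasure μ] {κ : Kernel F E} (h : IsCondLaw μ κ)
    (φ : E × F → ℝ) (hφ : Integrable φ μ) :
    Integrable (fun z => ∫ w, φ (w, z) ∂(κ z)) (μ.map Prod.snd) ∧
    ∫ p, φ p ∂μ = ∫ z, ∫ w, φ (w, z) ∂(κ z) ∂(μ.map Prod.snd) := by
  have := h.1
  have : IsProbabilityMeasure (μ.map Prod.snd) :=
    Measure.isProbabilityMeasure_map measurable_snd.aemeasurable
  have e := condLaw_eq h
  have hi : Integrable (φ ∘ Prod.swap) ((μ.map Prod.snd) ⊗ₘ κ) := by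
    rw [e] at hφ
    exact (integrable_map_measure hφ.aestronglyMeasurable measurable_swap.aemeasurable).1 hφ
  refine ⟨Integrable.integral_compProd hi, ?_⟩
  have h2 := Measure.integral_compProd hi
  rw [e] at hφ
  conv_lhs => rw [e]
  rw [integral_map measurable_swap.aemeasurable hφ.aestronglyMeasurable]
  exact h2

lemma IsCondLaw.transform {E F E' F' : Type*} [MeasurableSpace E] [MeasurableSpace F]
    [MeasurableSpace E'] [MeasurableSpace F']
    {μ : Measure (E × F)} {κ : Kernel F E} (h : IsCondLaw μ κ)
    (φ : E → E') (hφ : Measurable φ) (ψ : F ≃ᵐ F') :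
    IsCondLaw (μ.map (fun p => (φ p.1, ψ p.2))) ((κ.comap ψ.symm ψ.symm.measurable).map φ) := by
  have := h.1
  refine ⟨Kernel.IsMarkovKernel.map _ hφ, ?_⟩
  intro s t hs ht
  have hm : Measurable (fun p : E × F => (φ p.1, ψ p.2)) := by fun_prop
  rw [Measure.map_apply hm (hs.prod ht), Measure.map_map measurable_snd hm]
  have e1 : (fun p : E × F => (φ p.1, ψ p.2)) ⁻¹' (s ×ˢ t) = (φ ⁻¹' s) ×ˢ (ψ ⁻¹' t) := by
    ext p; simp
  have e2 : Measure.map (Prod.snd ∘ fun p : E × F => (φ p.1, ψ p.2)) μ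
      = (μ.map Prod.snd).map ψ := by
    rw [Measure.map_map ψ.measurable measurable_snd]; rfl
  rw [e1, e2, h.2 _ _ (hφ hs) (ψ.measurable ht),
    setLIntegral_map ht (Kernel.measurable_coe _ hs) ψ.measurable]
  refine lintegral_congr fun z => ?_
  rw [Kernel.map_apply' _ hφ _ hs, Kernel.comap_apply]
  simp

lemma core_bound {E F ι : Type*} [MeasurableSpace E] [TopologicalSpace E] [OpensMeasurableSpace E]
    [MetricSpace F] [MeasurableSpace F] [BorelSpace F] [OpensMeasurableSpace (E × F)]
    {l : Filter ι}
    {m : ι → Measure (E × F)} [∀ i, IsProbabilityMeasure (m i)] {κ : ι → Kernel F E}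
    (hκ : ∀ i, IsCondLaw (m i) (κ i))
    {ν : Measure (E × F)} [IsProbabilityMeasure ν] {κlim : Kernel F E} (hκlim : IsCondLaw ν κlim)
    (hconv : ∀ f : BoundedContinuousFunction (E × F) ℝ,
      Tendsto (fun i => ∫ p, f p ∂(m i)) l (𝓝 (∫ p, f p ∂ν)))
    {zs : ι → F} {A : Set E} (hA : MeasurableSet A) (f : BoundedContinuousFunction E ℝ)
    (hf0 : ∀ w, 0 ≤ f w) (hf : ∀ w ∈ A, 1 ≤ f w) {c₀ : F} {δ : ℝ} (hδ : 0 < δ)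
    (hpos : 0 < ν.map Prod.snd (Metric.ball c₀ δ))
    (hle : ∀ᶠ i in l, ∀ z ∈ Metric.ball c₀ δ, κ i (zs i) A ≤ κ i z A)
    {C C' : ℝ} (hC : ∀ z ∈ Metric.ball c₀ δ, ∫ w, f w ∂(κlim z) ≤ C) (hCC : C < C') :
    ∀ᶠ i in l, (κ i (zs i)).real A ≤ C' := by
  have := hκlim.1
  have : IsProbabilityMeasure (ν.map Prod.snd) :=
    Measure.isProbabilityMeasure_map measurable_snd.aemeasurable
  let g₀ : F → ℝ := fun z => max 0 (δ - dist z c₀)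
  have g₀c : Continuous g₀ := by fun_prop
  have g₀0 : ∀ z, 0 ≤ g₀ z := fun z => le_max_left _ _
  have g₀le : ∀ z, g₀ z ≤ δ := fun z => max_le hδ.le (by linarith [dist_nonneg (x := z) (y := c₀)])
  have g₀out : ∀ z, z ∉ Metric.ball c₀ δ → g₀ z = 0 := by
    intro z hz
    simp only [Metric.mem_ball, not_lt] at hz
    exact max_eq_left (by linarith)
  let g : BoundedContinuousFunction F ℝ := BoundedContinuousFunction.ofNormedAddCommGroup g₀ g₀c δ
    (fun z => by rw [Real.norm_of_nonneg (g₀0 z)]; exact g₀le z)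
  have gg : ∀ z, g z = g₀ z := fun z => rfl
  let G : BoundedContinuousFunction (E × F) ℝ := g.compContinuous ⟨Prod.snd, continuous_snd⟩
  let H : BoundedContinuousFunction (E × F) ℝ :=
    (f.compContinuous ⟨Prod.fst, continuous_fst⟩) * G
  have hG : ∀ p, G p = g₀ p.2 := fun p => rfl
  have hH : ∀ p, H p = f p.1 * g₀ p.2 := fun p => rfl
  have tG := hconv G
  have tH := hconv H
  -- the limit
  have eG : ∫ p, G p ∂ν = ∫ z, g₀ z ∂(ν.map Prod.snd) := by
    rw [integral_map measurable_snd.aemeasurable g₀c.aestronglyMeasurable]; rfl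
  have ig : Integrable g₀ (ν.map Prod.snd) := g.integrable _
  have hGpos : 0 < ∫ p, G p ∂ν := by
    rw [eG, integral_pos_iff_support_of_nonneg g₀0 ig]
    refine hpos.trans_le (measure_mono fun z hz => ?_)
    simp only [Metric.mem_ball] at hz
    have : 0 < g₀ z := lt_max_of_lt_right (by linarith)
    exact this.ne'
  have hHle : ∫ p, H p ∂ν ≤ C * ∫ p, G p ∂ν := by
    obtain ⟨h1, h2⟩ := integral_condLaw hκlim H (H.integrable _)
    rw [h2, eG, ← integral_const_mul]
    refine integral_mono h1 (ig.const_mul C) fun z => ?_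
    simp only [hH, integral_mul_const]
    by_cases hz : z ∈ Metric.ball c₀ δ
    · exact mul_le_mul_of_nonneg_right (hC z hz) (g₀0 z)
    · simp [g₀out z hz]
  have t : Tendsto (fun i => C' * ∫ p, G p ∂(m i) - ∫ p, H p ∂(m i)) l
      (𝓝 (C' * ∫ p, G p ∂ν - ∫ p, H p ∂ν)) := (tG.const_mul C').sub tH
  have hlim : 0 < C' * ∫ p, G p ∂ν - ∫ p, H p ∂ν := by nlinarith
  filter_upwards [hle, t.eventually (lt_mem_nhds hlim), tG.eventually (lt_mem_nhds hGpos)]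
    with i h1 h2 h3
  have := (hκ i).1
  have : IsProbabilityMeasure ((m i).map Prod.snd) :=
    Measure.isProbabilityMeasure_map measurable_snd.aemeasurable
  have key : (κ i (zs i)).real A * ∫ p, G p ∂(m i) ≤ ∫ p, H p ∂(m i) := by
    have eGi : ∫ p, G p ∂(m i) = ∫ z, g₀ z ∂((m i).map Prod.snd) := by
      rw [integral_map measurable_snd.aemeasurable g₀c.aestronglyMeasurable]; rfl
    have igi : Integrable g₀ ((m i).map Prod.snd) := g.integrable _
    obtain ⟨k1, k2⟩ := integral_condLaw (hκ i) H (H.integrable _)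
    rw [k2, eGi, ← integral_const_mul]
    refine integral_mono (igi.const_mul _) k1 fun z => ?_
    simp only [hH, integral_mul_const]
    by_cases hz : z ∈ Metric.ball c₀ δ
    · refine mul_le_mul_of_nonneg_right ?_ (g₀0 z)
      calc (κ i (zs i)).real A ≤ (κ i z).real A :=
            ENNReal.toReal_mono (measure_ne_top _ _) (h1 z hz)
        _ = ∫ w, A.indicator (fun _ => (1:ℝ)) w ∂(κ i z) := by
            rw [integral_indicator hA]; simp
        _ ≤ ∫ w, f w ∂(κ i z) := by
            refine integral_mono ((integrable_const _).indicator hA) (f.integrable _) fun w => ?_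
            by_cases hw : w ∈ A
            · simpa [hw] using hf w hw
            · simpa [hw] using hf0 w
    · simp [g₀out z hz]
  by_contra hcon
  push Not at hcon
  nlinarith

lemma closed_bound {E F ι : Type*} [MeasurableSpace E] [PseudoEMetricSpace E]
    [OpensMeasurableSpace E] [NormedAddCommGroup F] [NormedSpace ℝ F]
    [MeasurableSpace F] [BorelSpace F] [OpensMeasurableSpace (E × F)]
    {l : Filter ι}
    {m : ι → Measure (E × F)} [∀ i, IsProbabilityMeasure (m i)] {κ : ι → Kernel F E}
    (hκ : ∀ i, IsCondLaw (m i) (κ i))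
    {ν : Measure (E × F)} [IsProbabilityMeasure ν] {κlim : Kernel F E} (hκlim : IsCondLaw ν κlim)
    (hconv : ∀ f : BoundedContinuousFunction (E × F) ℝ,
      Tendsto (fun i => ∫ p, f p ∂(m i)) l (𝓝 (∫ p, f p ∂ν)))
    {zs : ι → F} {ξ : F}
    (hcont : ∀ f : BoundedContinuousFunction E ℝ,
      ContinuousAt (fun z => ∫ x, f x ∂(κlim z)) ξ)
    (hsupp : ξ ∈ interior (measureSupport (ν.map Prod.snd)))
    {A C : Set E} (hA : MeasurableSet A) (hC : IsClosed C) (hAC : A ⊆ C) (e : F) (he : ‖e‖ ≤ 1)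
    (hle : ∀ δ > 0, ∀ᶠ i in l, ∀ z ∈ Metric.ball (ξ + δ • e) (δ / 2), κ i (zs i) A ≤ κ i z A)
    {ε : ℝ} (hε : 0 < ε) :
    ∀ᶠ i in l, (κ i (zs i)).real A ≤ (κlim ξ).real C + ε := by
  have := hκlim.1
  have δpos : ∀ n : ℕ, 0 < 1 / ((n:ℝ) + 1) := fun n => Nat.one_div_pos_of_nat
  have t := tendsto_integral_thickenedIndicator_of_isClosed (κlim ξ) hC δpos
    tendsto_one_div_add_atTop_nhds_zero_nat
  obtain ⟨n, hn⟩ := (t.eventually (gt_mem_nhds (show (κlim ξ).real C < (κlim ξ).real C + ε / 4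
    by linarith))).exists
  let f₀ := thickenedIndicator (δpos n) C
  let f : BoundedContinuousFunction E ℝ :=
    BoundedContinuousFunction.ofNormedAddCommGroup (fun w => (f₀ w : ℝ)) (by fun_prop) 1
      (fun w => by
        rw [Real.norm_of_nonneg (NNReal.coe_nonneg _)]
        exact NNReal.coe_le_coe.2 (thickenedIndicator_le_one (δpos n) C w))
  have hfi : ∫ w, f w ∂(κlim ξ) < (κlim ξ).real C + ε / 4 := hn
  have hc := (hcont f).eventually (gt_mem_nhds (show ∫ w, f w ∂(κlim ξ) < (κlim ξ).real C + ε / 2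
    by linarith))
  obtain ⟨η, η0, hη⟩ := Metric.mem_nhds_iff.1 (inter_mem hc (mem_interior_iff_mem_nhds.1 hsupp))
  have hδ : 0 < η / 2 := by linarith
  have hsub : Metric.ball (ξ + (η / 2) • e) (η / 2 / 2) ⊆ Metric.ball ξ η := by
    intro z hz
    rw [Metric.mem_ball] at hz ⊢
    have h1 : dist (ξ + (η / 2) • e) ξ ≤ η / 2 := by
      rw [dist_eq_norm, add_sub_cancel_left, norm_smul, Real.norm_of_nonneg hδ.le]
      nlinarith
    linarith [dist_triangle z (ξ + (η / 2) • e) ξ]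
  have hδ2 : 0 < η / 2 / 2 := by linarith
  refine core_bound hκ hκlim hconv hA f (fun w => NNReal.coe_nonneg _) (fun w hw => ?_)
    hδ2 ?_ (hle (η / 2) hδ) (C := (κlim ξ).real C + ε / 2) (fun z hz => ?_) (by linarith)
  · have : (1 : NNReal) ≤ f₀ w := one_le_thickenedIndicator_apply E (δpos n) (hAC hw)
    exact_mod_cast this
  · exact (hη (hsub (Metric.mem_ball_self hδ2))).2 _ Metric.isOpen_ball (Metric.mem_ball_self hδ2)
  · exact (hη (hsub hz)).1.le

lemma tendsto_of_cdf {q : ℕ} {ι : Type*} {l : Filter ι} [l.IsCountablyGenerated]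
    (ρs : ι → Measure (Fin q → ℝ)) [∀ i, IsProbabilityMeasure (ρs i)]
    (ρ : Measure (Fin q → ℝ)) [IsProbabilityMeasure ρ]
    (h : ∀ x : Fin q → ℝ, (∀ i, ρ {w | w i = x i} = 0) →
      Tendsto (fun n => (ρs n).real {w | w ≤ x}) l (𝓝 (ρ.real {w | w ≤ x})))
    (f : BoundedContinuousFunction (Fin q → ℝ) ℝ) :
    Tendsto (fun n => ∫ x, f x ∂(ρs n)) l (𝓝 (∫ x, f x ∂ρ)) := by
  classical
  let D : Fin q → Set ℝ := fun i => {t | ρ {w | w i = t} = 0}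
  have hD : ∀ i, Dense (D i) := by
    intro i
    have hc : Set.Countable {t : ℝ | 0 < ρ {w | w i = t}} :=
      Measure.countable_meas_level_set_pos (measurable_pi_apply i)
    have : D i = {t : ℝ | 0 < ρ {w | w i = t}}ᶜ := by
      ext t; simp [D]
    rw [this]
    exact hc.dense_compl ℝ
  -- lower orthants
  let S₀ : Set (Set (Fin q → ℝ)) := {s | ∃ x : Fin q → ℝ, (∀ i, x i ∈ D i) ∧ s = {w | w ≤ x}}
  have hS₀ : IsPiSystem S₀ := by
    rintro _ ⟨x, hx, rfl⟩ _ ⟨x', hx', rfl⟩ -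
    refine ⟨x ⊓ x', fun i => ?_, ?_⟩
    · rcases le_total (x i) (x' i) with h | h
      · simpa [Pi.inf_apply, h] using hx i
      · simpa [Pi.inf_apply, h] using hx' i
    · ext w; simp
  have hm₀ : ∀ s ∈ S₀, MeasurableSet s := by
    rintro _ ⟨x, hx, rfl⟩
    exact measurableSet_Iic
  have ht₀ : ∀ s ∈ S₀, Tendsto (fun n => (ρs n).real s) l (𝓝 (ρ.real s)) := by
    rintro _ ⟨x, hx, rfl⟩
    exact h x hx
  -- boxes
  let S : Set (Set (Fin q → ℝ)) := {s | ∃ a b : Fin q → ℝ, (∀ i, a i ∈ D i) ∧ (∀ i, b i ∈ D i) ∧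
    s = {w | ∀ i, a i < w i ∧ w i ≤ b i}}
  have hS : IsPiSystem S := by
    rintro _ ⟨a, b, ha, hb, rfl⟩ _ ⟨a', b', ha', hb', rfl⟩ -
    refine ⟨a ⊔ a', b ⊓ b', fun i => ?_, fun i => ?_, ?_⟩
    · rcases le_total (a i) (a' i) with h | h
      · simpa [Pi.sup_apply, h] using ha' i
      · simpa [Pi.sup_apply, h] using ha i
    · rcases le_total (b i) (b' i) with h | h
      · simpa [Pi.inf_apply, h] using hb i
      · simpa [Pi.inf_apply, h] using hb' i
    · ext w
      simp only [Set.mem_inter_iff, Set.mem_ofPred_eq, Pi.sup_apply, Pi.inf_apply, sup_lt_iff,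
        le_inf_iff]
      grind
  have hm : ∀ s ∈ S, MeasurableSet s := by
    rintro _ ⟨a, b, ha, hb, rfl⟩
    simp only [Set.ofPred_forall]
    refine MeasurableSet.iInter fun i => ?_
    exact (measurableSet_lt measurable_const (measurable_pi_apply i)).inter
      (measurableSet_le (measurable_pi_apply i) measurable_const)
  have hnhds : ∀ u : Set (Fin q → ℝ), IsOpen u → ∀ x ∈ u, ∃ s ∈ S, s ∈ 𝓝 x ∧ s ⊆ u := by
    intro u hu x hx
    obtain ⟨ε, ε0, hε⟩ := Metric.isOpen_iff.1 hu x hx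
    have h1 : ∀ i, ∃ t ∈ D i, t ∈ Set.Ioo (x i - ε / 2) (x i) := fun i =>
      (hD i).exists_between (by linarith)
    have h2 : ∀ i, ∃ t ∈ D i, t ∈ Set.Ioo (x i) (x i + ε / 2) := fun i =>
      (hD i).exists_between (by linarith)
    choose a ha ha' using h1
    choose b hb hb' using h2
    refine ⟨_, ⟨a, b, ha, hb, rfl⟩, ?_, ?_⟩
    · have : ∀ i, ∀ᶠ w in 𝓝 x, a i < w i ∧ w i ≤ b i := by
        intro i
        have hc : Tendsto (fun w : Fin q → ℝ => w i) (𝓝 x) (𝓝 (x i)) :=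
          (continuous_apply i).continuousAt
        filter_upwards [hc.eventually (lt_mem_nhds (ha' i).2),
          hc.eventually (gt_mem_nhds (hb' i).1)] with w h1 h2 using ⟨h1, h2.le⟩
      exact eventually_all.2 this
    · intro w hw
      apply hε
      rw [Metric.mem_ball]
      refine lt_of_le_of_lt ((dist_pi_le_iff (by linarith : (0:ℝ) ≤ ε / 2)).2 fun i => ?_)
        (by linarith : ε / 2 < ε)
      rw [Real.dist_eq, abs_le]
      have := hw i
      have := ha' i
      have := hb' i
      simp only [Set.mem_Ioo] at *
      constructor <;> linarith
  have htS : ∀ s ∈ S, Tendsto (fun n => (ρs n).real s) l (𝓝 (ρ.real s)) := by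
    rintro _ ⟨a, b, ha, hb, rfl⟩
    by_cases hab : ∀ i, a i ≤ b i
    swap
    · push Not at hab
      obtain ⟨i, hi⟩ := hab
      have : {w : Fin q → ℝ | ∀ i, a i < w i ∧ w i ≤ b i} = ∅ := by
        ext w
        simp only [Set.mem_ofPred_eq, Set.mem_empty_iff_false, iff_false]
        intro hw
        linarith [(hw i).1, (hw i).2]
      simpa [this] using tendsto_const_nhds
    let T : Finset (Set (Fin q → ℝ)) :=
      Finset.univ.image fun i => {w : Fin q → ℝ | w ≤ Function.update b i (a i)}
    have hT : ∀ s ∈ T, s ∈ S₀ := by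
      intro s hs
      obtain ⟨i, -, rfl⟩ := Finset.mem_image.1 hs
      refine ⟨_, fun j => ?_, rfl⟩
      by_cases hj : j = i
      · subst hj; simpa using ha j
      · simpa [hj] using hb j
    have hTt := hS₀.tendsto_measureReal_biUnion (μ := ρs) (ν := ρ) (l := l) hT hm₀ ht₀
    have hTm : MeasurableSet (⋃ s ∈ T, s) :=
      T.measurableSet_biUnion fun s hs => hm₀ s (hT s hs)
    have hsub : (⋃ s ∈ T, s) ⊆ {w | w ≤ b} := by
      intro w hw
      simp only [T, Finset.mem_image, Finset.mem_univ, true_and, Set.mem_iUnion, exists_prop] at hw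
      obtain ⟨_, ⟨i, rfl⟩, hw⟩ := hw
      exact le_trans (show w ≤ _ from hw) (update_le_iff.2 ⟨hab i, fun _ _ => le_rfl⟩)
    have heq : {w : Fin q → ℝ | ∀ i, a i < w i ∧ w i ≤ b i} = {w | w ≤ b} \ (⋃ s ∈ T, s) := by
      ext w
      simp only [T, Finset.mem_image, Finset.mem_univ, true_and, Set.mem_iUnion, exists_prop,
        Set.mem_sdiff, Set.mem_ofPred_eq, exists_exists_eq_and, not_exists, le_update_iff, not_and]
      constructor
      · intro hw
        exact ⟨fun i => (hw i).2, fun i h1 => absurd h1 (not_le.2 (hw i).1)⟩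
      · rintro ⟨h1, h2⟩ i
        refine ⟨?_, h1 i⟩
        by_contra hcon
        exact h2 i (not_lt.1 hcon) fun j _ => h1 j
    rw [heq]
    have e1 : ∀ (M : Measure (Fin q → ℝ)) [IsProbabilityMeasure M],
        M.real ({w | w ≤ b} \ (⋃ s ∈ T, s)) = M.real {w | w ≤ b} - M.real (⋃ s ∈ T, s) :=
      fun M _ => measureReal_sdiff hsub hTm
    simp only [e1]
    exact (h b hb).sub hTt
  let P : ι → ProbabilityMeasure (Fin q → ℝ) := fun i => ⟨ρs i, inferInstance⟩
  let Q : ProbabilityMeasure (Fin q → ℝ) := ⟨ρ, inferInstance⟩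
  have hfin : Tendsto P l (𝓝 Q) := by
    refine hS.tendsto_probabilityMeasure_of_tendsto_of_mem hm hnhds fun s hs => ?_
    rw [← NNReal.tendsto_coe]
    exact htS s hs
  exact (ProbabilityMeasure.tendsto_iff_forall_integral_tendsto.1 hfin) f

lemma incr_limit {q r : ℕ} {l : Filter ℕ} [l.IsCountablyGenerated]
    {m : ℕ → Measure ((Fin q → ℝ) × (Fin r → ℝ))} [∀ i, IsProbabilityMeasure (m i)]
    {κ : ℕ → Kernel (Fin r → ℝ) (Fin q → ℝ)}
    (hκ : ∀ i, IsCondLaw (m i) (κ i))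
    (hmono : ∀ᶠ n in l, StochIncrFam (fun z => κ n z))
    {ν : Measure ((Fin q → ℝ) × (Fin r → ℝ))} [IsProbabilityMeasure ν]
    {κlim : Kernel (Fin r → ℝ) (Fin q → ℝ)} (hκlim : IsCondLaw ν κlim)
    (hconv : ∀ f : BoundedContinuousFunction ((Fin q → ℝ) × (Fin r → ℝ)) ℝ,
      Tendsto (fun i => ∫ p, f p ∂(m i)) l (𝓝 (∫ p, f p ∂ν)))
    {zs : ℕ → Fin r → ℝ} {ξ : Fin r → ℝ} (hz : Tendsto zs l (𝓝 ξ))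
    (hcont : ∀ f : BoundedContinuousFunction (Fin q → ℝ) ℝ,
      ContinuousAt (fun z => ∫ x, f x ∂(κlim z)) ξ)
    (hsupp : ξ ∈ interior (measureSupport (ν.map Prod.snd)))
    (f : BoundedContinuousFunction (Fin q → ℝ) ℝ) :
    Tendsto (fun n => ∫ x, f x ∂(κ n (zs n))) l (𝓝 (∫ x, f x ∂(κlim ξ))) := by
  have := hκlim.1
  have := fun i => (hκ i).1
  refine tendsto_of_cdf _ _ (fun x hx => ?_) f
  have hmeas : MeasurableSet {w : Fin q → ℝ | w ≤ x} := measurableSet_Iic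
  have hball : ∀ δ > 0, ∀ᶠ n in l, ∀ i, |zs n i - ξ i| < δ / 2 := by
    intro δ hδ
    filter_upwards [Metric.tendsto_nhds.1 hz (δ / 2) (by linarith)] with n hn i
    rw [← Real.dist_eq]
    exact (dist_le_pi_dist _ _ i).trans_lt hn
  have up : ∀ ε > 0, ∀ᶠ n in l,
      (κ n (zs n)).real {w | w ≤ x} ≤ (κlim ξ).real {w | w ≤ x} + ε := by
    intro ε hε
    refine closed_bound hκ hκlim hconv hcont hsupp hmeas isClosed_Iic subset_rfl
      (fun _ => -1) ((pi_norm_le_iff_of_nonneg zero_le_one).2 fun i => by simp) ?_ hε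
    intro δ hδ
    filter_upwards [hmono, hball δ hδ] with n hn hb z hz
    refine hn _ _ (fun i => ?_) x
    have h1 := (dist_le_pi_dist _ _ i).trans_lt (Metric.mem_ball.1 hz)
    rw [Real.dist_eq, abs_lt] at h1
    have h2 := abs_lt.1 (hb i)
    simp only [Pi.add_apply, Pi.smul_apply, smul_eq_mul] at h1
    linarith [h1.2, h2.1]
  have hCc : IsClosed (⋃ i, {w : Fin q → ℝ | x i ≤ w i}) :=
    isClosed_iUnion_of_finite fun i => isClosed_le continuous_const (continuous_apply i)
  have hCsub : {w : Fin q → ℝ | w ≤ x}ᶜ ⊆ ⋃ i, {w : Fin q → ℝ | x i ≤ w i} := by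
    intro w hw
    simp only [Set.mem_compl_iff, Set.mem_ofPred_eq, Pi.le_def, not_forall, not_le] at hw
    obtain ⟨i, hi⟩ := hw
    exact Set.mem_iUnion.2 ⟨i, hi.le⟩
  have hCle : (κlim ξ).real (⋃ i, {w : Fin q → ℝ | x i ≤ w i}) ≤
      (κlim ξ).real {w : Fin q → ℝ | w ≤ x}ᶜ := by
    refine ENNReal.toReal_mono (measure_ne_top _ _) ?_
    calc _ ≤ κlim ξ ({w : Fin q → ℝ | w ≤ x}ᶜ ∪ ⋃ i, {w | w i = x i}) := by
          refine measure_mono fun w hw => ?_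
          obtain ⟨i, hi⟩ := Set.mem_iUnion.1 hw
          rcases (show x i ≤ w i from hi).eq_or_lt with h | h
          · exact Or.inr (Set.mem_iUnion.2 ⟨i, h.symm⟩)
          · exact Or.inl fun hc => absurd (hc i) (not_le.2 h)
      _ ≤ _ := measure_union_le _ _
      _ = _ := by rw [measure_iUnion_null hx, add_zero]
  have lo : ∀ ε > 0, ∀ᶠ n in l,
      (κ n (zs n)).real {w | w ≤ x}ᶜ ≤
        (κlim ξ).real (⋃ i, {w : Fin q → ℝ | x i ≤ w i}) + ε := by
    intro ε hε
    refine closed_bound hκ hκlim hconv hcont hsupp hmeas.compl hCc hCsub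
      (fun _ => 1) ((pi_norm_le_iff_of_nonneg zero_le_one).2 fun i => by simp) ?_ hε
    intro δ hδ
    filter_upwards [hmono, hball δ hδ] with n hn hb z hz
    rw [prob_compl_eq_one_sub hmeas, prob_compl_eq_one_sub hmeas]
    refine tsub_le_tsub_left (hn _ _ (fun i => ?_) x) _
    have h1 := (dist_le_pi_dist _ _ i).trans_lt (Metric.mem_ball.1 hz)
    rw [Real.dist_eq, abs_lt] at h1
    have h2 := abs_lt.1 (hb i)
    simp only [Pi.add_apply, Pi.smul_apply, smul_eq_mul] at h1
    linarith [h1.1, h2.2]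
  rw [Metric.tendsto_nhds]
  intro ε hε
  filter_upwards [up (ε / 2) (by linarith), lo (ε / 2) (by linarith)] with n h1 h2
  rw [probReal_compl_eq_one_sub hmeas] at h2 hCle
  rw [Real.dist_eq, abs_lt]
  constructor <;> linarith

lemma decr_limit {q r : ℕ} {l : Filter ℕ} [l.IsCountablyGenerated]
    {m : ℕ → Measure ((Fin q → ℝ) × (Fin r → ℝ))} [∀ i, IsProbabilityMeasure (m i)]
    {κ : ℕ → Kernel (Fin r → ℝ) (Fin q → ℝ)}
    (hκ : ∀ i, IsCondLaw (m i) (κ i))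
    (hmono : ∀ᶠ n in l, StochDecrFam (fun z => κ n z))
    {ν : Measure ((Fin q → ℝ) × (Fin r → ℝ))} [IsProbabilityMeasure ν]
    {κlim : Kernel (Fin r → ℝ) (Fin q → ℝ)} (hκlim : IsCondLaw ν κlim)
    (hconv : ∀ f : BoundedContinuousFunction ((Fin q → ℝ) × (Fin r → ℝ)) ℝ,
      Tendsto (fun i => ∫ p, f p ∂(m i)) l (𝓝 (∫ p, f p ∂ν)))
    {zs : ℕ → Fin r → ℝ} {ξ : Fin r → ℝ} (hz : Tendsto zs l (𝓝 ξ))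
    (hcont : ∀ f : BoundedContinuousFunction (Fin q → ℝ) ℝ,
      ContinuousAt (fun z => ∫ x, f x ∂(κlim z)) ξ)
    (hsupp : ξ ∈ interior (measureSupport (ν.map Prod.snd)))
    (f : BoundedContinuousFunction (Fin q → ℝ) ℝ) :
    Tendsto (fun n => ∫ x, f x ∂(κ n (zs n))) l (𝓝 (∫ x, f x ∂(κlim ξ))) := by
  let N : (Fin q → ℝ) → (Fin q → ℝ) := fun x => -x
  have hNc : Continuous N := continuous_neg
  have hN : Measurable N := hNc.measurable
  let I := MeasurableEquiv.refl (Fin r → ℝ)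
  let Φ : (Fin q → ℝ) × (Fin r → ℝ) → (Fin q → ℝ) × (Fin r → ℝ) := fun p => (N p.1, I p.2)
  have hΦc : Continuous Φ := (hNc.comp continuous_fst).prodMk continuous_snd
  have hΦ : Measurable Φ := hΦc.measurable
  have kint : ∀ (k : Kernel (Fin r → ℝ) (Fin q → ℝ)) (z : Fin r → ℝ)
      (g : BoundedContinuousFunction (Fin q → ℝ) ℝ),
      ∫ x, g x ∂(((k.comap I.symm I.symm.measurable).map N) z)
        = ∫ x, g.compContinuous ⟨N, hNc⟩ x ∂(k z) := by
    intro k z g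
    rw [Kernel.map_apply _ hN, integral_map hN.aemeasurable
      g.continuous.aestronglyMeasurable]
    rfl
  have := fun i => Measure.isProbabilityMeasure_map (μ := m i) hΦ.aemeasurable
  have := Measure.isProbabilityMeasure_map (μ := ν) hΦ.aemeasurable
  have key := incr_limit (l := l) (fun i => (hκ i).transform N hN I) (ν := ν.map Φ) (zs := zs)
    (ξ := ξ) ?_ (hκlim.transform N hN I) ?_ hz ?_ ?_ (f.compContinuous ⟨N, hNc⟩)
  · simp only [kint] at key
    convert key using 4 <;> simp [N]
  · filter_upwards [hmono] with n hn z₁ z₂ hzz x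
    have e : N ⁻¹' {w | w ≤ x} = {w | -x ≤ w} := by
      ext w; simp [N, neg_le]
    have hm : MeasurableSet {w : Fin q → ℝ | w ≤ x} := measurableSet_Iic
    simp only [Kernel.map_apply' _ hN _ hm, e]
    exact hn z₁ z₂ hzz (-x)
  · intro g
    have := hconv (g.compContinuous ⟨Φ, hΦc⟩)
    have e : ∀ M : Measure ((Fin q → ℝ) × (Fin r → ℝ)),
        ∫ p, g p ∂(M.map Φ) = ∫ p, g.compContinuous ⟨Φ, hΦc⟩ p ∂M := fun M => by
      rw [integral_map hΦ.aemeasurable g.continuous.aestronglyMeasurable]; rfl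
    rw [← e] at this
    refine this.congr fun i => ?_
    rw [← e]
  · intro g
    simp only [kint]
    exact hcont _
  · rw [Measure.map_map measurable_snd hΦ]
    exact hsupp

/-- Nerman's theorem (Theorem 2.2): conditional limit theorem under stochastic
monotonicity. -/
theorem nerman_conditional_limit
    (q r : ℕ) (hq : 0 < q) (hr : 0 < r)
    (μ : ℕ → Measure ((Fin q → ℝ) × (Fin r → ℝ)))
    (hμ : ∀ n, IsProbabilityMeasure (μ n))
    (κ : ℕ → Kernel (Fin r → ℝ) (Fin q → ℝ))
    (hκ : ∀ n, IsCondLaw (μ n) (κ n))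
    (hmono : ∀ n, StochIncrFam (fun z => κ n z) ∨ StochDecrFam (fun z => κ n z))
    (a c : ℕ → ℝ) (b : ℕ → Fin q → ℝ) (d : ℕ → Fin r → ℝ)
    (ha : ∀ n, 0 < a n) (hc : ∀ n, 0 < c n)
    (ν : Measure ((Fin q → ℝ) × (Fin r → ℝ))) (hν : IsProbabilityMeasure ν)
    (hconv : TendstoInDistribution
      (fun n => (μ n).map (fun p => ((a n)⁻¹ • (p.1 - b n), (c n)⁻¹ • (p.2 - d n)))) ν)
    (y : ℕ → Fin r → ℝ) (ξ : Fin r → ℝ)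
    (hy : Tendsto (fun n => (c n)⁻¹ • (y n - d n)) atTop (𝓝 ξ))
    (κlim : Kernel (Fin r → ℝ) (Fin q → ℝ))
    (hκlim : IsCondLaw ν κlim)
    (hcont : ∀ f : BoundedContinuousFunction (Fin q → ℝ) ℝ,
      ContinuousAt (fun z => ∫ x, f x ∂(κlim z)) ξ)
    (hsupp : ξ ∈ interior (measureSupport (ν.map Prod.snd))) :
    TendstoInDistribution (fun n => (κ n (y n)).map (fun x => (a n)⁻¹ • (x - b n)))
      (κlim ξ) := by
  let φ : ℕ → (Fin q → ℝ) → (Fin q → ℝ) := fun n x => (a n)⁻¹ • (x - b n)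
  have hφ : ∀ n, Measurable (φ n) := fun n => by fun_prop
  let ψ : ∀ n, (Fin r → ℝ) ≃ᵐ (Fin r → ℝ) := fun n =>
    { toFun := fun z => (c n)⁻¹ • (z - d n)
      invFun := fun z => c n • z + d n
      left_inv := fun z => by
        simp [smul_smul, mul_inv_cancel₀ (hc n).ne']
      right_inv := fun z => by
        simp [smul_smul, inv_mul_cancel₀ (hc n).ne']
      measurable_toFun := (by fun_prop : Measurable fun z : Fin r → ℝ => (c n)⁻¹ • (z - d n))
      measurable_invFun := (by fun_prop : Measurable fun z : Fin r → ℝ => c n • z + d n) }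
  have hψ : ∀ n z, (ψ n) z = (c n)⁻¹ • (z - d n) := fun n z => rfl
  have hψs : ∀ n z, (ψ n).symm z = c n • z + d n := fun n z => rfl
  let m : ℕ → Measure ((Fin q → ℝ) × (Fin r → ℝ)) := fun n =>
    (μ n).map (fun p => (φ n p.1, ψ n p.2))
  have hm : ∀ n, IsProbabilityMeasure (m n) := fun n =>
    Measure.isProbabilityMeasure_map
      (((hφ n).comp measurable_fst).prodMk ((ψ n).measurable.comp measurable_snd)).aemeasurable
  let k : ℕ → Kernel (Fin r → ℝ) (Fin q → ℝ) := fun n =>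
    ((κ n).comap (ψ n).symm (ψ n).symm.measurable).map (φ n)
  have hk : ∀ n, IsCondLaw (m n) (k n) := fun n => (hκ n).transform (φ n) (hφ n) (ψ n)
  have hkap : ∀ n z, k n z = (κ n ((ψ n).symm z)).map (φ n) := fun n z => by
    simp only [k]
    rw [Kernel.map_apply _ (hφ n), Kernel.comap_apply]
  have hψmono : ∀ n (z₁ z₂ : Fin r → ℝ), z₁ ≤ z₂ → (ψ n).symm z₁ ≤ (ψ n).symm z₂ := by
    intro n z₁ z₂ h
    rw [hψs, hψs]
    exact add_le_add_left (smul_le_smul_of_nonneg_left h (hc n).le) _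
  have hinc : ∀ n, StochIncrFam (fun z => κ n z) → StochIncrFam (fun z => k n z) := by
    intro n hn z₁ z₂ hz x
    have e : φ n ⁻¹' {w | w ≤ x} = {w | w ≤ a n • x + b n} := by
      ext w
      simp only [Set.mem_preimage, Set.mem_ofPred_eq, φ, Pi.le_def, Pi.smul_apply, Pi.sub_apply,
        Pi.add_apply, smul_eq_mul]
      refine forall_congr' fun i => ?_
      rw [inv_mul_le_iff₀ (ha n), sub_le_iff_le_add]
    have hm : MeasurableSet {w : Fin q → ℝ | w ≤ x} := measurableSet_Iic
    simp only [hkap, Measure.map_apply (hφ n) hm, e]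
    exact hn _ _ (hψmono n _ _ hz) _
  have hdec : ∀ n, StochDecrFam (fun z => κ n z) → StochDecrFam (fun z => k n z) := by
    intro n hn z₁ z₂ hz x
    have e : φ n ⁻¹' {w | x ≤ w} = {w | a n • x + b n ≤ w} := by
      ext w
      simp only [Set.mem_preimage, Set.mem_ofPred_eq, φ, Pi.le_def, Pi.smul_apply, Pi.sub_apply,
        Pi.add_apply, smul_eq_mul]
      refine forall_congr' fun i => ?_
      rw [le_inv_mul_iff₀ (ha n), le_sub_iff_add_le]
    have hm : MeasurableSet {w : Fin q → ℝ | x ≤ w} := measurableSet_Ici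
    simp only [hkap, Measure.map_apply (hφ n) hm, e]
    exact hn _ _ (hψmono n _ _ hz) _
  intro f
  have hgoal : ∀ n, (κ n (y n)).map (fun x => (a n)⁻¹ • (x - b n)) = k n (ψ n (y n)) := by
    intro n
    rw [hkap, MeasurableEquiv.symm_apply_apply]
  simp only [hgoal]
  let A : Set ℕ := {n | StochIncrFam (fun z => k n z)}
  have hl : (atTop : Filter ℕ) = (atTop ⊓ 𝓟 A) ⊔ (atTop ⊓ 𝓟 Aᶜ) := by
    rw [← inf_sup_left]; simp
  rw [hl, tendsto_sup]
  constructor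
  · exact incr_limit (l := atTop ⊓ 𝓟 A) hk (eventually_inf_principal.2 (Eventually.of_forall
      fun n hn => hn)) hκlim (fun g => (hconv g).mono_left inf_le_left) (hy.mono_left inf_le_left)
      hcont hsupp f
  · exact decr_limit (l := atTop ⊓ 𝓟 Aᶜ) hk (eventually_inf_principal.2 (Eventually.of_forall
      fun n hn => hdec n ((hmono n).resolve_left fun h => hn (hinc n h)))) hκlim
      (fun g => (hconv g).mono_left inf_le_left) (hy.mono_left inf_le_left) hcont hsupp f
end
end

section
/- Let (X_n, Y_n), n ≥ 1, be pairs with X_n = (X_n^{(1)},…,X_n^{(q)}) a random vector in ℝ^q and Y_n a real random variable, such that each X_n is stochastically monotone with respect to Y_n. Suppose there exist real numbers a_n > 0, c_n > 0, vectors b_n ∈ ℝ^q and reals d_n such that (a_n^{-1}(X_n − b_n), c_n^{-1}(Y_n − d_n)) converges in distribution to a random vector (X, Y) = (X^{(1)},…,X^{(q)}, Y) whose distribution is Gaussian on ℝ^{q+1} with Var(Y) > 0. Let y_n be a real sequence with c_n^{-1}(y_n − d_n) → ξ for some ξ ∈ ℝ, and let X̃_n be a random vector whose distribution equals ℒ(X_n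 | Y_n = y_n). Set γ = (γ^{(1)},…,γ^{(q)}) with γ^{(i)} = Cov(X^{(i)}, Y)/Var(Y). Then a_n^{-1}(X̃_n − b_n) converges in distribution to X̃ := X + (ξ − Y)γ; moreover X̃ is Gaussian with E[X̃] = E[X] + (ξ − E[Y])γ and Cov(X̃^{(i)}, X̃^{(j)}) = Cov(X^{(i)}, X^{(j)}) − Cov(X^{(i)}, Y)Cov(X^{(j)}, Y)/Var(Y). -/
open MeasureTheory ProbabilityTheory Filter Topology

noncomputable section

lemma aux_tendsto_of_cdf {q : ℕ} {ι : Type*} (G : Set ℝ) (hG : Dense G)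
    (μ : ι → ProbabilityMeasure (Fin q → ℝ)) (ν : ProbabilityMeasure (Fin q → ℝ))
    (l : Filter ι) [l.IsCountablyGenerated]
    (h : ∀ x : Fin q → ℝ, (∀ i, x i ∈ G) →
      Tendsto (fun n => (μ n : Measure (Fin q → ℝ)).real (Set.Iic x)) l
        (𝓝 ((ν : Measure (Fin q → ℝ)).real (Set.Iic x)))) :
    Tendsto μ l (𝓝 ν) := by
  classical
  have minG : ∀ {s t : ℝ}, s ∈ G → t ∈ G → min s t ∈ G := by
    intro s t hs ht; rcases min_choice s t with h | h <;> rw [h] <;> assumption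
  have maxG : ∀ {s t : ℝ}, s ∈ G → t ∈ G → max s t ∈ G := by
    intro s t hs ht; rcases max_choice s t with h | h <;> rw [h] <;> assumption
  let T : Set (Set (Fin q → ℝ)) := {s | ∃ x : Fin q → ℝ, (∀ i, x i ∈ G) ∧ s = Set.Iic x}
  have hT : IsPiSystem T := by
    rintro _ ⟨x, hx, rfl⟩ _ ⟨z, hz, rfl⟩ -
    exact ⟨x ⊓ z, fun i => minG (hx i) (hz i), Set.Iic_inter_Iic⟩
  have hTm : ∀ s ∈ T, MeasurableSet s := by
    rintro _ ⟨x, hx, rfl⟩; exact measurableSet_Iic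
  let S : Set (Set (Fin q → ℝ)) := {s | ∃ a b : Fin q → ℝ, (∀ i, a i ∈ G) ∧ (∀ i, b i ∈ G) ∧
    s = Set.pi Set.univ (fun i => Set.Ioc (a i) (b i))}
  have hS : IsPiSystem S := by
    rintro _ ⟨a, b, ha, hb, rfl⟩ _ ⟨a', b', ha', hb', rfl⟩ -
    refine ⟨a ⊔ a', b ⊓ b', fun i => maxG (ha i) (ha' i), fun i => minG (hb i) (hb' i), ?_⟩
    rw [← Set.pi_inter_distrib]
    simp [Set.Ioc_inter_Ioc]
  refine hS.tendsto_probabilityMeasure_of_tendsto_of_mem ?_ ?_ ?_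
  · rintro _ ⟨a, b, ha, hb, rfl⟩
    exact MeasurableSet.univ_pi fun i => measurableSet_Ioc
  · intro u hu x hx
    obtain ⟨ε, hε, hball⟩ := Metric.isOpen_iff.1 hu x hx
    have h1 : ∀ i, ∃ s ∈ G, s ∈ Set.Ioo (x i - ε / 2) (x i) := fun i => by
      obtain ⟨s, hs, hs'⟩ := hG.exists_between (show x i - ε / 2 < x i by linarith)
      exact ⟨s, hs, hs'⟩
    have h2 : ∀ i, ∃ s ∈ G, s ∈ Set.Ioo (x i) (x i + ε / 2) := fun i => by
      obtain ⟨s, hs, hs'⟩ := hG.exists_between (show x i < x i + ε / 2 by linarith)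
      exact ⟨s, hs, hs'⟩
    choose a haG ha using h1
    choose b hbG hb using h2
    refine ⟨_, ⟨a, b, haG, hbG, rfl⟩, ?_, ?_⟩
    · exact set_pi_mem_nhds Set.finite_univ fun i _ => Ioc_mem_nhds (ha i).2 (hb i).1
    · intro w hw
      apply hball
      rw [Metric.mem_ball, dist_pi_lt_iff hε]
      intro i
      have := hw i (Set.mem_univ i)
      have h3 := ha i
      have h4 := hb i
      simp only [Set.mem_Ioc, Set.mem_Ioo] at this h3 h4
      rw [Real.dist_eq, abs_lt]
      constructor <;> linarith
  · rintro _ ⟨a, b, ha, hb, rfl⟩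
    let z : Fin q → Fin q → ℝ := fun i => Function.update b i (min (b i) (a i))
    have hz : ∀ i j, z i j ∈ G := by
      intro i j
      by_cases hij : j = i
      · subst hij; simpa [z] using minG (hb j) (ha j)
      · simp [z, hij, hb j]
    let t : Finset (Set (Fin q → ℝ)) := Finset.univ.image fun i => Set.Iic (z i)
    have ht : ∀ s ∈ t, s ∈ T := by
      intro s hs
      obtain ⟨i, -, rfl⟩ := Finset.mem_image.1 hs
      exact ⟨z i, hz i, rfl⟩
    have hmem : ∀ i w, w ∈ Set.Iic (z i) ↔ w ∈ Set.Iic b ∧ w i ≤ a i := by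
      intro i w
      simp only [Set.mem_Iic, z]
      rw [le_update_iff]
      simp only [Pi.le_def]
      constructor
      · rintro ⟨h1, h2⟩
        refine ⟨fun j => ?_, h1.trans (min_le_right _ _)⟩
        by_cases hij : j = i
        · subst hij; exact h1.trans (min_le_left _ _)
        · exact h2 j hij
      · rintro ⟨h1, h2⟩
        exact ⟨le_min (h1 i) h2, fun j _ => h1 j⟩
    have hU : MeasurableSet (⋃ s ∈ t, s) :=
      Finset.measurableSet_biUnion _ fun s hs => hTm s (ht s hs)
    have hUs : (⋃ s ∈ t, s) ⊆ Set.Iic b := by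
      intro w hw
      simp only [Set.mem_iUnion] at hw
      obtain ⟨s, hs, hw⟩ := hw
      obtain ⟨i, -, rfl⟩ := Finset.mem_image.1 hs
      exact ((hmem i w).1 hw).1
    have heq : Set.pi Set.univ (fun i => Set.Ioc (a i) (b i)) = Set.Iic b \ ⋃ s ∈ t, s := by
      ext w
      simp only [t, Finset.mem_image, Finset.mem_univ, true_and, Set.iUnion_exists,
        Set.iUnion_iUnion_eq', Set.mem_sdiff, Set.mem_iUnion, hmem, not_exists, not_and, not_le,
        Set.mem_pi, Set.mem_univ, true_imp_iff, Set.mem_Ioc]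
      constructor
      · intro h
        exact ⟨fun i => (h i).2, fun i _ => (h i).1⟩
      · rintro ⟨h1, h2⟩ i
        exact ⟨h2 i h1, h1 i⟩
    have key : Tendsto (fun n => (μ n : Measure (Fin q → ℝ)).real
        (Set.pi Set.univ (fun i => Set.Ioc (a i) (b i)))) l
        (𝓝 ((ν : Measure (Fin q → ℝ)).real (Set.pi Set.univ (fun i => Set.Ioc (a i) (b i))))) := by
      rw [heq]
      have hd : ∀ m : ProbabilityMeasure (Fin q → ℝ),
          (m : Measure (Fin q → ℝ)).real (Set.Iic b \ ⋃ s ∈ t, s) =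
          (m : Measure (Fin q → ℝ)).real (Set.Iic b) -
            (m : Measure (Fin q → ℝ)).real (⋃ s ∈ t, s) := fun m => measureReal_sdiff hUs hU
      simp_rw [hd]
      refine (h b hb).sub (hT.tendsto_measureReal_biUnion ht hTm ?_)
      rintro _ ⟨x, hx, rfl⟩
      exact h x hx
    simpa using key

lemma aux_frontier {q : ℕ} (ν : Measure ((Fin q → ℝ) × ℝ)) (x : Fin q → ℝ) (a b : ℝ)
    (hx : ∀ i, ν {p | p.1 i = x i} = 0) (hat : ∀ t, ν {p | p.2 = t} = 0) :
    ν (frontier (Set.Iic x ×ˢ Set.Icc a b)) = 0 := by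
  have hsub : frontier (Set.Iic x ×ˢ Set.Icc a b) ⊆
      (⋃ i, {p | p.1 i = x i}) ∪ ({p | p.2 = a} ∪ {p | p.2 = b}) := by
    intro p hp
    rw [(isClosed_Iic.prod isClosed_Icc).frontier_eq] at hp
    by_contra hcon
    simp only [Set.mem_union, Set.mem_iUnion, Set.mem_ofPred_eq, not_or, not_exists] at hcon
    obtain ⟨h1, h2, h3⟩ := hcon
    apply hp.2
    rw [mem_interior]
    refine ⟨(Set.pi Set.univ fun i => Set.Iio (x i)) ×ˢ Set.Ioo a b, ?_, ?_, ?_, ?_⟩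
    · rintro w ⟨hw1, hw2⟩
      exact ⟨fun i => (hw1 i (Set.mem_univ i)).le, Set.Ioo_subset_Icc_self hw2⟩
    · exact (isOpen_set_pi Set.finite_univ fun i _ => isOpen_Iio).prod isOpen_Ioo
    · intro i _
      exact lt_of_le_of_ne (hp.1.1 i) (h1 i)
    · exact ⟨lt_of_le_of_ne hp.1.2.1 (Ne.symm h2), lt_of_le_of_ne hp.1.2.2 h3⟩
  refine measure_mono_null hsub ?_
  rw [measure_union_null_iff, measure_union_null_iff, measure_iUnion_null_iff]
  exact ⟨hx, hat a, hat b⟩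

lemma aux_left {q : ℕ} (ρ : Measure (Fin q → ℝ)) [IsProbabilityMeasure ρ] (x : Fin q → ℝ)
    (hx : ∀ i, ρ {p | p i = x i} = 0) (r : ℝ) (hr : r < ρ.real (Set.Iic x)) :
    ∃ δ > 0, r < ρ.real (Set.Iic (fun i => x i - δ)) := by
  let δ : ℕ → ℝ := fun n => 1 / ((n : ℝ) + 1)
  have hδ0 : Tendsto δ atTop (𝓝 0) := tendsto_one_div_add_atTop_nhds_zero_nat
  have hδa : Antitone δ := fun m n hmn => by
    simp only [δ]; gcongr
  have hm : Monotone (fun n => Set.Iic (fun i => x i - δ n)) := by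
    intro m n hmn
    apply Set.Iic_subset_Iic.2
    intro i
    have := hδa hmn
    simp only; linarith
  have h1 := tendsto_measure_iUnion_atTop (μ := ρ) hm
  have h2 : ρ (⋃ n, Set.Iic (fun i => x i - δ n)) = ρ (Set.Iic x) := by
    apply le_antisymm
    · apply measure_mono
      apply Set.iUnion_subset
      intro n
      apply Set.Iic_subset_Iic.2
      intro i
      have : 0 < δ n := by simp only [δ]; positivity
      simp only; linarith
    · have hsub : Set.Iic x ⊆ (⋃ n, Set.Iic (fun i => x i - δ n)) ∪ ⋃ i, {p | p i = x i} := by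
        intro w hw
        by_cases hc : ∃ i, w i = x i
        · right; simpa using hc
        · left
          push Not at hc
          have : ∀ᶠ n in atTop, ∀ i, w i ≤ x i - δ n := by
            rw [eventually_all]
            intro i
            have hlt : 0 < x i - w i := sub_pos.2 (lt_of_le_of_ne (hw i) (hc i))
            filter_upwards [hδ0.eventually (gt_mem_nhds hlt)] with n hn
            linarith
          obtain ⟨n, hn⟩ := this.exists
          exact Set.mem_iUnion.2 ⟨n, hn⟩
      refine (measure_mono hsub).trans ((measure_union_le _ _).trans ?_)
      rw [measure_iUnion_null_iff.2 hx, add_zero]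
  rw [h2] at h1
  have h3 : Tendsto (fun n => ρ.real (Set.Iic (fun i => x i - δ n))) atTop
      (𝓝 (ρ.real (Set.Iic x))) :=
    (ENNReal.tendsto_toReal (measure_ne_top _ _)).comp h1
  obtain ⟨n, hn⟩ := (h3.eventually (lt_mem_nhds hr)).exists
  exact ⟨δ n, by simp only [δ]; positivity, hn⟩

lemma aux_right {q : ℕ} (ρ : Measure (Fin q → ℝ)) [IsProbabilityMeasure ρ] (x : Fin q → ℝ)
    (r : ℝ) (hr : ρ.real (Set.Iic x) < r) :
    ∃ δ > 0, ρ.real (Set.Iic (fun i => x i + δ)) < r := by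
  let δ : ℕ → ℝ := fun n => 1 / ((n : ℝ) + 1)
  have hδ0 : Tendsto δ atTop (𝓝 0) := tendsto_one_div_add_atTop_nhds_zero_nat
  have hδa : Antitone δ := fun m n hmn => by
    simp only [δ]; gcongr
  have hm : Antitone (fun n => Set.Iic (fun i => x i + δ n)) := by
    intro m n hmn
    apply Set.Iic_subset_Iic.2
    intro i
    have := hδa hmn
    simp only; linarith
  have h1 := tendsto_measure_iInter_atTop (μ := ρ)
    (fun n => (measurableSet_Iic (a := fun i => x i + δ n)).nullMeasurableSet) hm
    ⟨0, measure_ne_top _ _⟩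
  have h2 : (⋂ n, Set.Iic (fun i => x i + δ n)) = Set.Iic x := by
    ext w
    simp only [Set.mem_iInter, Set.mem_Iic, Pi.le_def]
    constructor
    · intro h i
      have h4 : Tendsto (fun n => x i + δ n) atTop (𝓝 (x i + 0)) := tendsto_const_nhds.add hδ0
      rw [add_zero] at h4
      exact ge_of_tendsto' h4 fun n => h n i
    · intro h n i
      have : 0 < δ n := by simp only [δ]; positivity
      have := h i
      linarith
  rw [h2] at h1
  have h3 : Tendsto (fun n => ρ.real (Set.Iic (fun i => x i + δ n))) atTop
      (𝓝 (ρ.real (Set.Iic x))) :=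
    (ENNReal.tendsto_toReal (measure_ne_top _ _)).comp h1
  obtain ⟨n, hn⟩ := (h3.eventually (gt_mem_nhds hr)).exists
  exact ⟨δ n, by simp only [δ]; positivity, hn⟩

lemma aux_condlaw_le {E : Type*} [MeasurableSpace E] {μ : Measure (E × ℝ)} [IsProbabilityMeasure μ]
    {κ : Kernel ℝ E} (hκ : IsCondLaw μ κ) (A : Set E) (hA : MeasurableSet A) (I : Set ℝ)
    (hI : MeasurableSet I) (t : ℝ) (h : ∀ z ∈ I, κ z A ≤ κ t A) :
    μ.real (A ×ˢ I) ≤ (κ t).real A * μ.real (Set.univ ×ˢ I) := by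
  have := hκ.1
  have h1 : μ (A ×ˢ I) ≤ κ t A * μ (Set.univ ×ˢ I) := by
    rw [hκ.2 A I hA hI]
    refine (setLIntegral_mono measurable_const h).trans ?_
    rw [setLIntegral_const, Measure.map_apply measurable_snd hI, Set.univ_prod]
  rw [measureReal_def, measureReal_def, measureReal_def, ← ENNReal.toReal_mul]
  exact ENNReal.toReal_mono (ENNReal.mul_ne_top (measure_ne_top _ _) (measure_ne_top _ _)) h1

lemma aux_condlaw_ge {E : Type*} [MeasurableSpace E] {μ : Measure (E × ℝ)} [IsProbabilityMeasure μ]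
    {κ : Kernel ℝ E} (hκ : IsCondLaw μ κ) (A : Set E) (hA : MeasurableSet A) (I : Set ℝ)
    (hI : MeasurableSet I) (t : ℝ) (h : ∀ z ∈ I, κ t A ≤ κ z A) :
    (κ t).real A * μ.real (Set.univ ×ˢ I) ≤ μ.real (A ×ˢ I) := by
  have := hκ.1
  have h1 : κ t A * μ (Set.univ ×ˢ I) ≤ μ (A ×ˢ I) := by
    rw [hκ.2 A I hA hI]
    refine le_trans ?_ (setLIntegral_mono (κ.measurable_coe hA) h)
    rw [setLIntegral_const, Measure.map_apply measurable_snd hI, Set.univ_prod]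
  rw [measureReal_def, measureReal_def, measureReal_def, ← ENNReal.toReal_mul]
  exact ENNReal.toReal_mono (measure_ne_top _ _) h1

lemma aux_portm {q : ℕ} {L : Filter ℕ} {π : ℕ → ProbabilityMeasure ((Fin q → ℝ) × ℝ)}
    {ν : ProbabilityMeasure ((Fin q → ℝ) × ℝ)} (hconv : Tendsto π L (𝓝 ν))
    {s : Set ((Fin q → ℝ) × ℝ)}
    (hs : (ν : Measure ((Fin q → ℝ) × ℝ)) (frontier s) = 0) :
    Tendsto (fun n => (π n : Measure ((Fin q → ℝ) × ℝ)).real s) L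
      (𝓝 ((ν : Measure ((Fin q → ℝ) × ℝ)).real s)) :=
  (ENNReal.tendsto_toReal (measure_ne_top _ _)).comp
    (ProbabilityMeasure.tendsto_measure_of_null_frontier_of_tendsto' hconv hs)

lemma aux_core {q : ℕ} (L : Filter ℕ) [L.IsCountablyGenerated]
    (π : ℕ → ProbabilityMeasure ((Fin q → ℝ) × ℝ)) (κ : ℕ → Kernel ℝ (Fin q → ℝ))
    (hκ : ∀ n, IsCondLaw (π n : Measure ((Fin q → ℝ) × ℝ)) (κ n))
    (hinc : ∀ᶠ n in L, StochIncrFam (fun z => κ n z))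
    (ν : ProbabilityMeasure ((Fin q → ℝ) × ℝ)) (hconv : Tendsto π L (𝓝 ν))
    (γ : Fin q → ℝ)
    (hind : IndepFun (fun p : (Fin q → ℝ) × ℝ => p.1 - p.2 • γ) (fun p => p.2)
      (ν : Measure ((Fin q → ℝ) × ℝ)))
    (hat : ∀ t : ℝ, (ν : Measure ((Fin q → ℝ) × ℝ)) {p | p.2 = t} = 0)
    (hpos : ∀ a b : ℝ, a < b → 0 < (ν : Measure ((Fin q → ℝ) × ℝ)).real (Set.univ ×ˢ Set.Icc a b))
    (t : ℕ → ℝ) (ξ : ℝ) (ht : Tendsto t L (𝓝 ξ))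
    (ρ : ProbabilityMeasure (Fin q → ℝ))
    (hρ : (ρ : Measure (Fin q → ℝ)) =
      (ν : Measure ((Fin q → ℝ) × ℝ)).map (fun p => p.1 + (ξ - p.2) • γ))
    (P : ℕ → ProbabilityMeasure (Fin q → ℝ))
    (hP : ∀ n, (P n : Measure (Fin q → ℝ)) = κ n (t n)) :
    Tendsto P L (𝓝 ρ) := by
  let B : Set ℝ := (⋃ i : Fin q, {s | 0 < (ρ : Measure (Fin q → ℝ)) {w | w i = s}}) ∪
    ⋃ i : Fin q, {s | 0 < (ν : Measure ((Fin q → ℝ) × ℝ)) {p | p.1 i = s}}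
  have hB : B.Countable := by
    refine Set.Countable.union (Set.countable_iUnion fun i => ?_) (Set.countable_iUnion fun i => ?_)
    · exact Measure.countable_meas_level_set_pos (measurable_pi_apply i)
    · exact Measure.countable_meas_level_set_pos ((measurable_pi_apply i).comp measurable_fst)
  have hBd : Dense Bᶜ := hB.dense_compl ℝ
  -- independence formula
  have hprod : ∀ (x : Fin q → ℝ) (a b : ℝ), (ν : Measure ((Fin q → ℝ) × ℝ)).real
      ({p | p.1 + (ξ - p.2) • γ ≤ x} ∩ (Set.univ ×ˢ Set.Icc a b)) =
      (ρ : Measure (Fin q → ℝ)).real (Set.Iic x) *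
        (ν : Measure ((Fin q → ℝ) × ℝ)).real (Set.univ ×ˢ Set.Icc a b) := by
    intro x a b
    have h1 := hind.measure_inter_preimage_eq_mul (Set.Iic (x - ξ • γ)) (Set.Icc a b)
      measurableSet_Iic measurableSet_Icc
    have h2 : (fun p : (Fin q → ℝ) × ℝ => p.1 - p.2 • γ) ⁻¹' Set.Iic (x - ξ • γ) =
        {p | p.1 + (ξ - p.2) • γ ≤ x} := by
      ext p
      simp only [Set.mem_preimage, Set.mem_Iic, Set.mem_ofPred_eq, le_sub_iff_add_le]
      rw [sub_smul, sub_add_eq_add_sub, add_sub_assoc]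
    have h3 : (fun p : (Fin q → ℝ) × ℝ => p.2) ⁻¹' Set.Icc a b = Set.univ ×ˢ Set.Icc a b := by
      rw [Set.univ_prod]
    rw [h2, h3] at h1
    have h4 : (ρ : Measure (Fin q → ℝ)) (Set.Iic x) =
        (ν : Measure ((Fin q → ℝ) × ℝ)) {p | p.1 + (ξ - p.2) • γ ≤ x} := by
      rw [hρ, Measure.map_apply (by fun_prop) measurableSet_Iic]
      rfl
    rw [measureReal_def, measureReal_def, measureReal_def, h1, h4, ENNReal.toReal_mul]
  refine aux_tendsto_of_cdf Bᶜ hBd P ρ L ?_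
  intro x hx
  have hxρ : ∀ i, (ρ : Measure (Fin q → ℝ)) {w | w i = x i} = 0 := by
    intro i
    by_contra hne
    exact hx i (Or.inl (Set.mem_iUnion.2 ⟨i, pos_iff_ne_zero.2 hne⟩))
  have hxν : ∀ i, (ν : Measure ((Fin q → ℝ) × ℝ)) {p | p.1 i = x i} = 0 := by
    intro i
    by_contra hne
    exact hx i (Or.inr (Set.mem_iUnion.2 ⟨i, pos_iff_ne_zero.2 hne⟩))
  have hA : ∀ a b, Tendsto (fun n => (π n : Measure ((Fin q → ℝ) × ℝ)).real
      (Set.Iic x ×ˢ Set.Icc a b)) L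
      (𝓝 ((ν : Measure ((Fin q → ℝ) × ℝ)).real (Set.Iic x ×ˢ Set.Icc a b))) :=
    fun a b => aux_portm hconv (aux_frontier _ x a b hxν hat)
  have hI : ∀ a b, Tendsto (fun n => (π n : Measure ((Fin q → ℝ) × ℝ)).real
      (Set.univ ×ˢ Set.Icc a b)) L
      (𝓝 ((ν : Measure ((Fin q → ℝ) × ℝ)).real (Set.univ ×ˢ Set.Icc a b))) := by
    intro a b
    refine aux_portm hconv ?_
    rw [frontier_univ_prod_eq]
    refine measure_mono_null (t := {p | p.2 = a} ∪ {p | p.2 = b}) ?_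
      (measure_union_null (hat a) (hat b))
    rintro p ⟨-, hp⟩
    have hp' : p.2 ∈ ({a, b} : Set ℝ) := by
      by_cases hab : a ≤ b
      · rwa [frontier_Icc hab] at hp
      · rw [Set.Icc_eq_empty hab, frontier_empty] at hp; exact hp.elim
    simpa using hp'
  -- choice of ε
  have hε : ∀ δ > 0, ∃ ε > 0, ∀ i, 2 * ε * |γ i| ≤ δ := by
    intro δ hδ
    refine ⟨δ / (2 * (‖γ‖ + 1)), by positivity, fun i => ?_⟩
    have h1 : |γ i| ≤ ‖γ‖ := norm_le_pi_norm γ i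
    have h0 : 0 ≤ ‖γ‖ := norm_nonneg γ
    have : 2 * (δ / (2 * (‖γ‖ + 1))) * |γ i| = δ * (|γ i| / (‖γ‖ + 1)) := by
      field_simp
    rw [this]
    have h2 : |γ i| / (‖γ‖ + 1) ≤ 1 := by
      rw [div_le_one (by positivity)]; linarith
    nlinarith
  have hbd : ∀ ε δ s : ℝ, (∀ i, 2 * ε * |γ i| ≤ δ) → |ξ - s| ≤ 2 * ε → ∀ i,
      |(ξ - s) * γ i| ≤ δ := by
    intro ε δ s h1 h2 i
    rw [abs_mul]
    exact (mul_le_mul_of_nonneg_right h2 (abs_nonneg _)).trans (h1 i)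
  rw [tendsto_order]
  constructor
  · intro r hr
    obtain ⟨δ, hδ, hrδ⟩ := aux_left _ x hxρ r hr
    obtain ⟨ε, hε0, hεδ⟩ := hε δ hδ
    set J := Set.Icc (ξ + ε) (ξ + 2 * ε) with hJ
    have hJpos := hpos (ξ + ε) (ξ + 2 * ε) (by linarith)
    have hlow : (ρ : Measure (Fin q → ℝ)).real (Set.Iic (fun i => x i - δ)) *
        (ν : Measure ((Fin q → ℝ) × ℝ)).real (Set.univ ×ˢ J) ≤
        (ν : Measure ((Fin q → ℝ) × ℝ)).real (Set.Iic x ×ˢ J) := by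
      rw [← hprod]
      refine measureReal_mono ?_ (measure_ne_top _ _)
      rintro p ⟨hp1, -, hp2⟩
      refine ⟨fun i => ?_, hp2⟩
      have h1 := hp1 i
      have h2 := hbd ε δ p.2 hεδ (by rw [abs_le]; constructor <;> linarith [hp2.1, hp2.2]) i
      simp only [Pi.add_apply, Pi.smul_apply, smul_eq_mul] at h1
      have := abs_le.1 h2
      linarith
    have hlt : r * (ν : Measure ((Fin q → ℝ) × ℝ)).real (Set.univ ×ˢ J) <
        (ν : Measure ((Fin q → ℝ) × ℝ)).real (Set.Iic x ×ˢ J) :=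
      (mul_lt_mul_of_pos_right hrδ hJpos).trans_le hlow
    have hev := ((hI (ξ + ε) (ξ + 2 * ε)).const_mul r).eventually_lt (hA _ _) hlt
    filter_upwards [hev, hinc, ht.eventually (gt_mem_nhds (show ξ < ξ + ε by linarith))]
      with n hn hmon htn
    rw [hP n]
    have h1 := aux_condlaw_le (hκ n) (Set.Iic x) measurableSet_Iic J measurableSet_Icc (t n)
      (fun z hz => hmon (t n) z (htn.le.trans hz.1) x)
    exact lt_of_mul_lt_mul_right (hn.trans_le h1) measureReal_nonneg
  · intro r hr
    obtain ⟨δ, hδ, hrδ⟩ := aux_right _ x r hr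
    obtain ⟨ε, hε0, hεδ⟩ := hε δ hδ
    set J := Set.Icc (ξ - 2 * ε) (ξ - ε) with hJ
    have hJpos := hpos (ξ - 2 * ε) (ξ - ε) (by linarith)
    have hup : (ν : Measure ((Fin q → ℝ) × ℝ)).real (Set.Iic x ×ˢ J) ≤
        (ρ : Measure (Fin q → ℝ)).real (Set.Iic (fun i => x i + δ)) *
        (ν : Measure ((Fin q → ℝ) × ℝ)).real (Set.univ ×ˢ J) := by
      rw [← hprod]
      refine measureReal_mono ?_ (measure_ne_top _ _)
      rintro p ⟨hp1, hp2⟩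
      refine ⟨fun i => ?_, Set.mem_univ _, hp2⟩
      have h1 : p.1 i ≤ x i := hp1 i
      have h2 := hbd ε δ p.2 hεδ (by rw [abs_le]; constructor <;> linarith [hp2.1, hp2.2]) i
      simp only [Pi.add_apply, Pi.smul_apply, smul_eq_mul]
      have := abs_le.1 h2
      linarith
    have hlt : (ν : Measure ((Fin q → ℝ) × ℝ)).real (Set.Iic x ×ˢ J) <
        r * (ν : Measure ((Fin q → ℝ) × ℝ)).real (Set.univ ×ˢ J) :=
      hup.trans_lt (mul_lt_mul_of_pos_right hrδ hJpos)
    have hev := (hA _ _).eventually_lt ((hI (ξ - 2 * ε) (ξ - ε)).const_mul r) hlt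
    filter_upwards [hev, hinc, ht.eventually (lt_mem_nhds (show ξ - ε < ξ by linarith))]
      with n hn hmon htn
    rw [hP n]
    have h1 := aux_condlaw_ge (hκ n) (Set.Iic x) measurableSet_Iic J measurableSet_Icc (t n)
      (fun z hz => hmon z (t n) (hz.2.trans htn.le) x)
    exact lt_of_mul_lt_mul_right (h1.trans_lt hn) measureReal_nonneg

lemma aux_condlaw_map {E E' : Type*} [MeasurableSpace E] [MeasurableSpace E']
    {μ : Measure (E × ℝ)} {κ : Kernel ℝ E} (hκ : IsCondLaw μ κ) (f : E → E') (hf : Measurable f)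
    (g g' : ℝ → ℝ) (hg : Measurable g) (hg' : Measurable g') (hgg : ∀ z, g' (g z) = z) :
    IsCondLaw (μ.map (fun p => (f p.1, g p.2))) ((κ.comap g' hg').map f) := by
  have := hκ.1
  refine ⟨Kernel.IsMarkovKernel.map _ hf, fun s t hs ht => ?_⟩
  have hfg : Measurable (fun p : E × ℝ => (f p.1, g p.2)) := by fun_prop
  rw [Measure.map_apply hfg (hs.prod ht)]
  have h1 : (fun p : E × ℝ => (f p.1, g p.2)) ⁻¹' s ×ˢ t = (f ⁻¹' s) ×ˢ (g ⁻¹' t) := rfl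
  rw [h1, hκ.2 _ _ (hf hs) (hg ht), Measure.map_map measurable_snd hfg]
  have h2 : (Prod.snd ∘ fun p : E × ℝ => (f p.1, g p.2)) = g ∘ Prod.snd := rfl
  rw [h2, ← Measure.map_map hg measurable_snd,
    setLIntegral_map ht (Kernel.measurable_coe _ hs) hg]
  congr 1
  ext z
  rw [Kernel.map_apply' _ hf _ hs, Kernel.comap_apply, hgg]

lemma aux_core2 {q : ℕ}
    (π : ℕ → ProbabilityMeasure ((Fin q → ℝ) × ℝ)) (κ : ℕ → Kernel ℝ (Fin q → ℝ))
    (hκ : ∀ n, IsCondLaw (π n : Measure ((Fin q → ℝ) × ℝ)) (κ n))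
    (hmono : ∀ n, StochIncrFam (fun z => κ n z) ∨ StochDecrFam (fun z => κ n z))
    (ν : ProbabilityMeasure ((Fin q → ℝ) × ℝ)) (hconv : Tendsto π atTop (𝓝 ν))
    (γ : Fin q → ℝ)
    (hind : IndepFun (fun p : (Fin q → ℝ) × ℝ => p.1 - p.2 • γ) (fun p => p.2)
      (ν : Measure ((Fin q → ℝ) × ℝ)))
    (hat : ∀ t : ℝ, (ν : Measure ((Fin q → ℝ) × ℝ)) {p | p.2 = t} = 0)
    (hpos : ∀ a b : ℝ, a < b → 0 < (ν : Measure ((Fin q → ℝ) × ℝ)).real (Set.univ ×ˢ Set.Icc a b))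
    (t : ℕ → ℝ) (ξ : ℝ) (ht : Tendsto t atTop (𝓝 ξ))
    (ρ : ProbabilityMeasure (Fin q → ℝ))
    (hρ : (ρ : Measure (Fin q → ℝ)) =
      (ν : Measure ((Fin q → ℝ) × ℝ)).map (fun p => p.1 + (ξ - p.2) • γ))
    (P : ℕ → ProbabilityMeasure (Fin q → ℝ))
    (hP : ∀ n, (P n : Measure (Fin q → ℝ)) = κ n (t n)) :
    Tendsto P atTop (𝓝 ρ) := by
  let S : Set ℕ := {n | StochIncrFam (fun z => κ n z)}
  have hS : (atTop : Filter ℕ) = (atTop ⊓ 𝓟 S) ⊔ (atTop ⊓ 𝓟 Sᶜ) := by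
    rw [← inf_sup_left, sup_principal, Set.union_compl_self, principal_univ, inf_top_eq]
  rw [hS, tendsto_sup]
  constructor
  · exact aux_core (atTop ⊓ 𝓟 S) π κ hκ (mem_inf_of_right (mem_principal_self S)) ν
      (hconv.mono_left inf_le_left) γ hind hat hpos t ξ (ht.mono_left inf_le_left) ρ hρ P hP
  · -- the decreasing case, by negation
    let N : (Fin q → ℝ) × ℝ → (Fin q → ℝ) × ℝ := fun p => (-p.1, p.2)
    have hN : Continuous N := by fun_prop
    have hNm : Measurable N := hN.measurable
    let nE : (Fin q → ℝ) → (Fin q → ℝ) := fun w => -w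
    have hn : Continuous nE := by fun_prop
    have hnm : Measurable nE := hn.measurable
    have hPn : Tendsto (fun n => (P n).map hnm.aemeasurable) (atTop ⊓ 𝓟 Sᶜ)
        (𝓝 (ρ.map hnm.aemeasurable)) := by
      refine aux_core (atTop ⊓ 𝓟 Sᶜ) (fun n => (π n).map hNm.aemeasurable)
        (fun n => ((κ n).comap id measurable_id).map nE) (fun n => ?_) ?_
        (ν.map hNm.aemeasurable) ?_ (-γ) ?_ ?_ ?_ t ξ (ht.mono_left inf_le_left) _ ?_ _ ?_
      · exact aux_condlaw_map (hκ n) nE hnm id id measurable_id measurable_id (fun _ => rfl)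
      · refine mem_of_superset (mem_inf_of_right (mem_principal_self Sᶜ)) ?_
        intro n hnS z₁ z₂ hz x
        have hdec := (hmono n).resolve_left hnS
        have h1 := hdec z₁ z₂ hz (-x)
        have hset : nE ⁻¹' {w | w ≤ x} = {w | -x ≤ w} := by
          ext w; exact neg_le (a := w) (b := x)
        simp only
        have hms : MeasurableSet {w : Fin q → ℝ | w ≤ x} := measurableSet_Iic
        rw [Kernel.map_apply' _ hnm _ hms, Kernel.map_apply' _ hnm _ hms, hset, Kernel.comap_apply, Kernel.comap_apply]
        exact h1
      · exact ProbabilityMeasure.tendsto_map_of_tendsto_of_continuous _ _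
          (hconv.mono_left inf_le_left) hN
      · have h1 := hind.comp (φ := nE) (ψ := id) hnm measurable_id
        have h4 : nE ∘ (fun p : (Fin q → ℝ) × ℝ => p.1 - p.2 • γ) =
            (fun p => p.1 - p.2 • (-γ)) ∘ N := by
          ext p i
          simp [N, nE]
          ring
        rw [h4, indepFun_iff_measure_inter_preimage_eq_mul] at h1
        rw [ProbabilityMeasure.toMeasure_map, indepFun_iff_measure_inter_preimage_eq_mul]
        intro s u hs hu
        have hm1 : Measurable (fun p : (Fin q → ℝ) × ℝ => p.1 - p.2 • (-γ)) := by fun_prop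
        have hm2 : Measurable (fun p : (Fin q → ℝ) × ℝ => p.2) := measurable_snd
        rw [Measure.map_apply hNm ((hm1 hs).inter (hm2 hu)), Measure.map_apply hNm (hm1 hs),
          Measure.map_apply hNm (hm2 hu)]
        exact h1 s u hs hu
      · intro s
        have hms : MeasurableSet {p : (Fin q → ℝ) × ℝ | p.2 = s} :=
          measurable_snd (measurableSet_singleton s)
        rw [ProbabilityMeasure.toMeasure_map, Measure.map_apply hNm hms]
        exact hat s
      · intro a b hab
        rw [ProbabilityMeasure.toMeasure_map, map_measureReal_apply hNm
          (MeasurableSet.univ.prod measurableSet_Icc)]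
        exact hpos a b hab
      · rw [ProbabilityMeasure.toMeasure_map, ProbabilityMeasure.toMeasure_map, hρ,
          Measure.map_map hnm (by fun_prop), Measure.map_map (by fun_prop) hNm]
        congr 1
        ext p i
        simp [N, nE]
        ring
      · intro n
        rw [ProbabilityMeasure.toMeasure_map, hP, Kernel.map_apply _ hnm, Kernel.comap_apply]
        rfl
    have h2 := ProbabilityMeasure.tendsto_map_of_tendsto_of_continuous _ _ hPn hn
    have h3 : ∀ m : ProbabilityMeasure (Fin q → ℝ),
        (m.map hnm.aemeasurable).map hn.measurable.aemeasurable = m := by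
      intro m
      apply Subtype.ext
      change Measure.map nE (Measure.map nE (m : Measure (Fin q → ℝ))) = m
      rw [Measure.map_map hnm hnm]
      have : nE ∘ nE = id := by ext w; simp [nE]
      rw [this, Measure.map_id]
    simpa only [h3] using h2

lemma aux_memLp {q : ℕ} (ν : Measure ((Fin q → ℝ) × ℝ)) [IsGaussian ν] :
    (∀ i, MemLp (fun p : (Fin q → ℝ) × ℝ => p.1 i) 2 ν) ∧
      MemLp (fun p : (Fin q → ℝ) × ℝ => p.2) 2 ν := by
  constructor
  · intro i
    exact IsGaussian.memLp_dual ν ((ContinuousLinearMap.proj (R := ℝ) (φ := fun _ : Fin q => ℝ) i).comp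
      (ContinuousLinearMap.fst ℝ (Fin q → ℝ) ℝ)) 2 (by simp)
  · exact IsGaussian.memLp_dual ν (ContinuousLinearMap.snd ℝ (Fin q → ℝ) ℝ) 2 (by simp)

lemma aux_covFn {E : Type*} [MeasurableSpace E] (μ : Measure E) [IsProbabilityMeasure μ]
    (f g : E → ℝ) (hf : MemLp f 2 μ) (hg : MemLp g 2 μ) : covFn μ f g = cov[f, g; μ] := by
  rw [covariance_eq_sub hf hg]; rfl

lemma aux_indep {q : ℕ} (ν : Measure ((Fin q → ℝ) × ℝ)) [IsGaussian ν] (γ : Fin q → ℝ)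
    (h : ∀ i, cov[fun p : (Fin q → ℝ) × ℝ => p.1 i, fun p => p.2; ν] =
      γ i * Var[fun p : (Fin q → ℝ) × ℝ => p.2; ν]) :
    IndepFun (fun p : (Fin q → ℝ) × ℝ => p.1 - p.2 • γ) (fun p => p.2) ν := by
  obtain ⟨h1, h2⟩ := aux_memLp ν
  have hcov : ∀ i, cov[fun p : (Fin q → ℝ) × ℝ => p.1 i - p.2 * γ i, fun p => p.2; ν] = 0 := by
    intro i
    rw [covariance_fun_sub_left (h1 i) (h2.mul_const _) h2, covariance_mul_const_left,
      covariance_self (by fun_prop), h i]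
    ring
  let T : ((Fin q → ℝ) × ℝ) →L[ℝ] (Fin q → ℝ) × (Unit → ℝ) :=
    ((ContinuousLinearMap.fst ℝ (Fin q → ℝ) ℝ) -
      (ContinuousLinearMap.snd ℝ (Fin q → ℝ) ℝ).smulRight γ).prod
      (ContinuousLinearMap.pi fun _ => ContinuousLinearMap.snd ℝ (Fin q → ℝ) ℝ)
  have hT : HasGaussianLaw (fun p : (Fin q → ℝ) × ℝ =>
      ((fun i => p.1 i - p.2 * γ i : Fin q → ℝ), (fun _ => p.2 : Unit → ℝ))) ν :=
    ⟨(isGaussian_map T : IsGaussian (ν.map T))⟩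
  have h3 := HasGaussianLaw.indepFun_of_covariance_eval (κ := Unit)
    (X := fun i (p : (Fin q → ℝ) × ℝ) => p.1 i - p.2 * γ i) (Y := fun _ p => p.2) hT
    (fun i _ => hcov i)
  exact h3.comp (φ := id) (ψ := fun w => w ()) measurable_id 
    (measurable_pi_apply (X := fun _ : Unit => ℝ) ())

/-- Nerman's theorem in the Gaussian case (Theorem 2.3): conditional CLT for a
stochastically monotone vector conditioned on a real variable. -/
theorem nerman_gaussian_conditional_clt
    (q : ℕ) (hq : 0 < q)
    (μ : ℕ → Measure ((Fin q → ℝ) × ℝ)) (hμ : ∀ n, IsProbabilityMeasure (μ n))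
    (κ : ℕ → Kernel ℝ (Fin q → ℝ)) (hκ : ∀ n, IsCondLaw (μ n) (κ n))
    (hmono : ∀ n, StochIncrFam (fun z => κ n z) ∨ StochDecrFam (fun z => κ n z))
    (a c : ℕ → ℝ) (b : ℕ → Fin q → ℝ) (d : ℕ → ℝ)
    (ha : ∀ n, 0 < a n) (hc : ∀ n, 0 < c n)
    (ν : Measure ((Fin q → ℝ) × ℝ)) (hν : IsProbabilityMeasure ν)
    (hGauss : IsGaussianMeasure ν)
    (hVar : 0 < covFn ν (fun p => p.2) (fun p => p.2))
    (hconv : TendstoInDistribution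
      (fun n => (μ n).map (fun p => ((a n)⁻¹ • (p.1 - b n), (c n)⁻¹ * (p.2 - d n)))) ν)
    (y : ℕ → ℝ) (ξ : ℝ)
    (hy : Tendsto (fun n => (c n)⁻¹ * (y n - d n)) atTop (𝓝 ξ))
    (γ : Fin q → ℝ)
    (hγ : ∀ i, γ i = covFn ν (fun p => p.1 i) (fun p => p.2) /
        covFn ν (fun p => p.2) (fun p => p.2)) :
    TendstoInDistribution
      (fun n => (κ n (y n)).map (fun x => (a n)⁻¹ • (x - b n)))
      (ν.map (fun p => p.1 + (ξ - p.2) • γ)) ∧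
    IsGaussianMeasure (ν.map (fun p => p.1 + (ξ - p.2) • γ)) ∧
    (∀ i, (∫ x, x i ∂(ν.map (fun p => p.1 + (ξ - p.2) • γ))) =
        (∫ p, p.1 i ∂ν) + (ξ - ∫ p, p.2 ∂ν) * γ i) ∧
    (∀ i j, covFn (ν.map (fun p => p.1 + (ξ - p.2) • γ)) (fun x => x i) (fun x => x j) =
        covFn ν (fun p => p.1 i) (fun p => p.1 j) -
          covFn ν (fun p => p.1 i) (fun p => p.2) * covFn ν (fun p => p.1 j) (fun p => p.2) /
            covFn ν (fun p => p.2) (fun p => p.2)) := by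
  have hG : IsGaussian ν := isGaussian_of_map_eq_gaussianReal hGauss
  obtain ⟨hL1, hL2⟩ := aux_memLp ν
  have hcY : ∀ i, covFn ν (fun p => p.1 i) (fun p => p.2) =
      cov[fun p : (Fin q → ℝ) × ℝ => p.1 i, fun p => p.2; ν] :=
    fun i => aux_covFn ν _ _ (hL1 i) hL2
  have hvY : covFn ν (fun p => p.2) (fun p => p.2) = Var[fun p : (Fin q → ℝ) × ℝ => p.2; ν] := by
    rw [aux_covFn ν _ _ hL2 hL2, covariance_self (by fun_prop)]
  have hV : 0 < Var[fun p : (Fin q → ℝ) × ℝ => p.2; ν] := hvY ▸ hVar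
  have hcov : ∀ i, cov[fun p : (Fin q → ℝ) × ℝ => p.1 i, fun p => p.2; ν] =
      γ i * Var[fun p : (Fin q → ℝ) × ℝ => p.2; ν] := by
    intro i
    rw [hγ i, hcY, hvY]
    field_simp
  have hind := aux_indep ν γ hcov
  have hTm : Measurable (fun p : (Fin q → ℝ) × ℝ => p.1 + (ξ - p.2) • γ) := by fun_prop
  -- law of Y
  obtain ⟨m, v, hv0, hYlaw⟩ : ∃ (m : ℝ) (v : NNReal), v ≠ 0 ∧
      ν.map (fun p => p.2) = gaussianReal m v :=
    ⟨_, _, by simpa using hV, hG.map_eq_gaussianReal (ContinuousLinearMap.snd ℝ (Fin q → ℝ) ℝ)⟩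
  have hat : ∀ t : ℝ, ν {p | p.2 = t} = 0 := by
    intro t
    have h1 : ν {p | p.2 = t} = ν.map (fun p => p.2) {t} := by
      rw [Measure.map_apply measurable_snd (measurableSet_singleton t)]; rfl
    rw [h1, hYlaw]
    exact gaussianReal_absolutelyContinuous _ hv0 (by simp)
  have hpos : ∀ a b : ℝ, a < b → 0 < ν.real (Set.univ ×ˢ Set.Icc a b) := by
    intro a b hab
    have h1 : ν (Set.univ ×ˢ Set.Icc a b) = ν.map (fun p => p.2) (Set.Icc a b) := by
      rw [Measure.map_apply measurable_snd measurableSet_Icc, Set.univ_prod]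
    refine ENNReal.toReal_pos ?_ (measure_ne_top _ _)
    rw [h1, hYlaw]
    intro h0
    have h2 := gaussianReal_absolutelyContinuous' m hv0 h0
    rw [Real.volume_Icc, ENNReal.ofReal_eq_zero] at h2
    linarith
  have hev : ∀ k, AEStronglyMeasurable (fun x : Fin q → ℝ => x k)
      (ν.map (fun p => p.1 + (ξ - p.2) • γ)) :=
    fun k => (measurable_pi_apply k).aestronglyMeasurable
  refine ⟨?_, ?_, ?_, ?_⟩
  · -- weak convergence
    have hfm : ∀ n, Measurable (fun x : Fin q → ℝ => (a n)⁻¹ • (x - b n)) := fun n => by fun_prop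
    have hgm : ∀ n, Measurable (fun z : ℝ => (c n)⁻¹ * (z - d n)) := fun n => by fun_prop
    have hgm' : ∀ n, Measurable (fun z : ℝ => c n * z + d n) := fun n => by fun_prop
    have hgg : ∀ n z, c n * ((c n)⁻¹ * (z - d n)) + d n = z := fun n z => by
      rw [mul_inv_cancel_left₀ (hc n).ne']; ring
    have hΦ : ∀ n, Measurable (fun p : (Fin q → ℝ) × ℝ =>
      ((a n)⁻¹ • (p.1 - b n), (c n)⁻¹ * (p.2 - d n))) := fun n => by fun_prop
    let π : ℕ → ProbabilityMeasure ((Fin q → ℝ) × ℝ) := fun n =>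
      ⟨(μ n).map (fun p => ((a n)⁻¹ • (p.1 - b n), (c n)⁻¹ * (p.2 - d n))),
        Measure.isProbabilityMeasure_map (hΦ n).aemeasurable⟩
    have hmk : ∀ n, IsMarkovKernel (κ n) := fun n => (hκ n).1
    let P : ℕ → ProbabilityMeasure (Fin q → ℝ) := fun n =>
      ⟨(κ n (y n)).map (fun x => (a n)⁻¹ • (x - b n)),
        Measure.isProbabilityMeasure_map (hfm n).aemeasurable⟩
    let ρ : ProbabilityMeasure (Fin q → ℝ) :=
      ⟨ν.map (fun p => p.1 + (ξ - p.2) • γ), Measure.isProbabilityMeasure_map hTm.aemeasurable⟩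
    let ν' : ProbabilityMeasure ((Fin q → ℝ) × ℝ) := ⟨ν, hν⟩
    have hconv' : Tendsto π atTop (𝓝 ν') :=
      ProbabilityMeasure.tendsto_iff_forall_integral_tendsto.2 hconv
    have hmain : Tendsto P atTop (𝓝 ρ) := by
      refine aux_core2 π
        (fun n => ((κ n).comap (fun z => c n * z + d n) (hgm' n)).map
          (fun x => (a n)⁻¹ • (x - b n))) (fun n => ?_) (fun n => ?_) ν' hconv' γ hind hat hpos
        (fun n => (c n)⁻¹ * (y n - d n)) ξ hy ρ rfl P (fun n => ?_)
      · exact aux_condlaw_map (hκ n) _ (hfm n) (fun z => (c n)⁻¹ * (z - d n)) _ (hgm n) (hgm' n)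
          (hgg n)
      · have hmz : ∀ z₁ z₂ : ℝ, z₁ ≤ z₂ → c n * z₁ + d n ≤ c n * z₂ + d n := fun z₁ z₂ h => by
          have := mul_le_mul_of_nonneg_left h (hc n).le
          linarith
        have hpt : ∀ w x : ℝ, (a n)⁻¹ * w ≤ x ↔ w ≤ a n * x := fun w x =>
          inv_mul_le_iff₀ (ha n)
        have hpt' : ∀ w x : ℝ, x ≤ (a n)⁻¹ * w ↔ a n * x ≤ w := fun w x =>
          le_inv_mul_iff₀ (ha n)
        refine (hmono n).imp (fun h z₁ z₂ hz x => ?_) (fun h z₁ z₂ hz x => ?_)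
        · have h1 := h _ _ (hmz z₁ z₂ hz) (a n • x + b n)
          have hms : MeasurableSet {w : Fin q → ℝ | w ≤ x} := measurableSet_Iic
          have hset : (fun x : Fin q → ℝ => (a n)⁻¹ • (x - b n)) ⁻¹' {w | w ≤ x} =
              {w | w ≤ a n • x + b n} := by
            ext w
            simp [Pi.le_def, hpt]
          simp only
          rw [Kernel.map_apply' _ (hfm n) _ hms, Kernel.map_apply' _ (hfm n) _ hms, hset,
            Kernel.comap_apply, Kernel.comap_apply]
          exact h1
        · have h1 := h _ _ (hmz z₁ z₂ hz) (a n • x + b n)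
          have hms : MeasurableSet {w : Fin q → ℝ | x ≤ w} := measurableSet_Ici
          have hset : (fun x : Fin q → ℝ => (a n)⁻¹ • (x - b n)) ⁻¹' {w | x ≤ w} =
              {w | a n • x + b n ≤ w} := by
            ext w
            simp [Pi.le_def, hpt', le_sub_iff_add_le]
          simp only
          rw [Kernel.map_apply' _ (hfm n) _ hms, Kernel.map_apply' _ (hfm n) _ hms, hset,
            Kernel.comap_apply, Kernel.comap_apply]
          exact h1
      · rw [Kernel.map_apply _ (hfm n), Kernel.comap_apply, hgg n]
        rfl
    exact ProbabilityMeasure.tendsto_iff_forall_integral_tendsto.1 hmain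
  · -- Gaussian limit
    intro L
    let M : ((Fin q → ℝ) × ℝ) →L[ℝ] ℝ := L.comp ((ContinuousLinearMap.fst ℝ (Fin q → ℝ) ℝ) -
      (ContinuousLinearMap.snd ℝ (Fin q → ℝ) ℝ).smulRight γ)
    obtain ⟨m, v, hmv⟩ := hGauss M
    refine ⟨m + ξ * L γ, v, ?_⟩
    rw [← gaussianReal_map_add_const, ← hmv, Measure.map_map (by fun_prop) hTm,
      Measure.map_map (by fun_prop) (by fun_prop)]
    congr 1
    ext p
    simp [M]
    ring
  · intro i
    rw [integral_map hTm.aemeasurable (hev i)]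
    have hi1 : Integrable (fun p : (Fin q → ℝ) × ℝ => p.1 i) ν := (hL1 i).integrable one_le_two
    have hi2 : Integrable (fun p : (Fin q → ℝ) × ℝ => p.2) ν := hL2.integrable one_le_two
    have hi3 : Integrable (fun p : (Fin q → ℝ) × ℝ => (ξ - p.2) * γ i) ν :=
      ((integrable_const ξ).sub hi2).mul_const _
    simp only [Pi.add_apply, Pi.smul_apply, smul_eq_mul]
    rw [integral_add hi1 hi3, integral_mul_const,
      integral_sub (integrable_const ξ) hi2]
    simp
  · intro i j
    have hZ : ∀ i, MemLp (fun p : (Fin q → ℝ) × ℝ => p.1 i - p.2 * γ i) 2 ν :=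
      fun i => (hL1 i).sub (hL2.mul_const _)
    have hF : ∀ i, MemLp (fun p : (Fin q → ℝ) × ℝ => (p.1 i - p.2 * γ i) + ξ * γ i) 2 ν :=
      fun i => (hZ i).add (memLp_const _)
    have h1 : covFn (ν.map (fun p => p.1 + (ξ - p.2) • γ)) (fun x => x i) (fun x => x j) =
        covFn ν (fun p => (p.1 i - p.2 * γ i) + ξ * γ i)
          (fun p => (p.1 j - p.2 * γ j) + ξ * γ j) := by
      unfold covFn
      have hij : AEStronglyMeasurable (fun x : Fin q → ℝ => x i * x j)
        (ν.map (fun p => p.1 + (ξ - p.2) • γ)) := (hev i).mul (hev j)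
      simp only
      rw [integral_map hTm.aemeasurable hij,
        integral_map hTm.aemeasurable (hev i), integral_map hTm.aemeasurable (hev j)]
      have h2 : ∀ (p : (Fin q → ℝ) × ℝ) k, (p.1 + (ξ - p.2) • γ) k =
          (p.1 k - p.2 * γ k) + ξ * γ k := by
        intro p k
        simp only [Pi.add_apply, Pi.smul_apply, smul_eq_mul]
        ring
      simp only [h2]
    rw [h1, aux_covFn ν _ _ (hF i) (hF j), aux_covFn ν _ _ (hL1 i) (hL1 j), hcY, hcY, hvY,
      covariance_add_const_left ((hZ i).integrable one_le_two),
      covariance_add_const_right ((hZ j).integrable one_le_two),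
      covariance_fun_sub_fun_sub (hL1 i) (hL2.mul_const _) (hL1 j) (hL2.mul_const _),
      covariance_mul_const_left, covariance_mul_const_right, covariance_mul_const_left,
      covariance_mul_const_right, covariance_comm (fun p : (Fin q → ℝ) × ℝ => p.2), hcov i, hcov j,
      covariance_self (by fun_prop)]
    field_simp
    ring
end
end

section
/- Let (X_n, Y_n), n ≥ 1, be pairs of real random variables such that each X_n is stochastically monotone with respect to Y_n. Suppose there exist real numbers a_n > 0, c_n > 0, b_n, d_n such that (a_n^{-1}(X_n − b_n), c_n^{-1}(Y_n − d_n)) converges in distribution to a bivariate Gaussian random vector (X, Y) with Var(Y) > 0. Let y_n be a real sequence with c_n^{-1}(y_n − d_n) → ξ for some ξ ∈ ℝ, and let X̃_n have distribution ℒ(X_n | Y_n = y_n). Set σ_X² := Var(X), σ_Y² := Var(Y), σ_{XY} := Cov(X, Y) and γ := σ_{XY}/σ_Y². Then a_n^{-1}(X̃_n − b_n) converges in distribution to the normal distribution N(E[X] + γ(ξ − E[Y]), σ_X² − σ_{XY}²/σ_Y²). If, further, σ_X² > 0, then this asymptotic variance equals (1 − ρ²)σ_X², where ρ := σ_{XY}/(σ_X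 σ_Y). -/
open MeasureTheory ProbabilityTheory Filter Topology

noncomputable section

open scoped BoundedContinuousFunction

theorem aux_upper (S : Set ℝ) (hS : IsClosed S) (hu : IsUpperSet S) :
    S = ∅ ∨ S = Set.univ ∨ ∃ x, S = Set.Ici x := by
  rcases S.eq_empty_or_nonempty with h | h
  · exact Or.inl h
  right
  by_cases hb : BddBelow S
  · right
    refine ⟨sInf S, ?_⟩
    ext z
    exact ⟨fun hz => csInf_le hb hz, fun hz => hu hz (hS.csInf_mem h hb)⟩
  · left
    ext z
    simp only [Set.mem_univ, iff_true]
    rw [not_bddBelow_iff] at hb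
    obtain ⟨w, hw, hwz⟩ := hb z
    exact hu hwz.le hw

theorem aux_int {P : Measure ℝ} [IsProbabilityMeasure P] (h : ℝ →ᵇ ℝ) : Integrable h P :=
  h.integrable P

theorem aux_order1 (P Q : Measure ℝ) [IsProbabilityMeasure P] [IsProbabilityMeasure Q]
    (hPQ : ∀ x : ℝ, Q {w | x ≤ w} ≤ P {w | x ≤ w}) (h : ℝ →ᵇ ℝ) (hm : Monotone h) :
    ∫ x, h x ∂Q ≤ ∫ x, h x ∂P := by
  have key : ∫ x, (h x + ‖h‖) ∂Q ≤ ∫ x, (h x + ‖h‖) ∂P := by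
    have h0 : ∀ x, 0 ≤ h x + ‖h‖ := fun x => by
      have := h.norm_coe_le_norm x
      rw [Real.norm_eq_abs, abs_le] at this
      linarith [this.1]
    have hc : Continuous (fun x => h x + ‖h‖) := by fun_prop
    rw [integral_eq_lintegral_of_nonneg_ae (ae_of_all _ h0) hc.aestronglyMeasurable,
      integral_eq_lintegral_of_nonneg_ae (ae_of_all _ h0) hc.aestronglyMeasurable]
    apply ENNReal.toReal_mono
    · have : Integrable (fun x => h x + ‖h‖) P := (h.integrable P).add (integrable_const _)
      rw [← ofReal_integral_eq_lintegral_ofReal this (ae_of_all _ h0)]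
      exact ENNReal.ofReal_ne_top
    rw [lintegral_eq_lintegral_meas_le _ (ae_of_all _ h0) hc.aemeasurable,
      lintegral_eq_lintegral_meas_le _ (ae_of_all _ h0) hc.aemeasurable]
    apply lintegral_mono
    intro t
    rcases aux_upper {a | t ≤ h a + ‖h‖} (isClosed_le continuous_const hc)
      (fun x y hxy hx => by
        have := hm hxy
        simp only [Set.mem_ofPred_eq] at hx ⊢
        linarith) with e | e | ⟨x, e⟩
    · simp [e]
    · simp [e]
    · simp only [e]; exact hPQ x
  rw [integral_add (h.integrable Q) (integrable_const _),
    integral_add (h.integrable P) (integrable_const _)] at key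
  simpa using key

theorem aux_order2 (P Q : Measure ℝ) [IsProbabilityMeasure P] [IsProbabilityMeasure Q]
    (hPQ : ∀ x : ℝ, Q {w | w ≤ x} ≤ P {w | w ≤ x}) (h : ℝ →ᵇ ℝ) (hm : Monotone h) :
    ∫ x, h x ∂P ≤ ∫ x, h x ∂Q := by
  have i1 : IsProbabilityMeasure (P.map (fun x => -x)) :=
    Measure.isProbabilityMeasure_map (by fun_prop)
  have i2 : IsProbabilityMeasure (Q.map (fun x => -x)) :=
    Measure.isProbabilityMeasure_map (by fun_prop)
  let h' : ℝ →ᵇ ℝ := - (h.compContinuous ⟨fun x => -x, by fun_prop⟩)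
  have := aux_order1 (P.map (fun x => -x)) (Q.map (fun x => -x)) (fun x => by
    rw [Measure.map_apply (by fun_prop) (measurableSet_le (by fun_prop) (by fun_prop)),
      Measure.map_apply (by fun_prop) (measurableSet_le (by fun_prop) (by fun_prop))]
    convert hPQ (-x) using 2 <;> (ext w; simp [le_neg])) h' (fun x y hxy => by
      simp only [h', BoundedContinuousFunction.coe_neg, Pi.neg_apply, BoundedContinuousFunction.compContinuous_apply, ContinuousMap.coe_mk]
      exact neg_le_neg (hm (neg_le_neg hxy)))
  rw [integral_map (by fun_prop) h'.continuous.aestronglyMeasurable,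
    integral_map (by fun_prop) h'.continuous.aestronglyMeasurable] at this
  simp only [h', BoundedContinuousFunction.coe_neg, Pi.neg_apply, BoundedContinuousFunction.compContinuous_apply, ContinuousMap.coe_mk, neg_neg, integral_neg] at this
  linarith

theorem aux_disint (μ : Measure (ℝ × ℝ)) [IsProbabilityMeasure μ] (κ : Kernel ℝ ℝ)
    [IsMarkovKernel κ]
    (hκ : IsCondLaw μ κ) (h g : ℝ →ᵇ ℝ) :
    Integrable (fun z => g z * ∫ x, h x ∂(κ z)) (μ.map Prod.snd) ∧
    ∫ p, h p.1 * g p.2 ∂μ = ∫ z, g z * (∫ x, h x ∂(κ z)) ∂(μ.map Prod.snd) := by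
  have ip : IsProbabilityMeasure (μ.map Prod.snd) :=
    Measure.isProbabilityMeasure_map (by fun_prop)
  have e : μ = ((μ.map Prod.snd) ⊗ₘ κ).map Prod.swap := by
    refine Measure.ext_prod (fun {s t} hs ht => ?_)
    rw [hκ.2 s t hs ht, Measure.map_apply measurable_swap (hs.prod ht), Set.preimage_swap_prod,
      Measure.compProd_apply_prod ht hs]
  have hi : Integrable (fun q : ℝ × ℝ => h q.2 * g q.1) ((μ.map Prod.snd) ⊗ₘ κ) := by
    have := ((h.compContinuous ⟨Prod.snd, continuous_snd⟩ :
      (ℝ × ℝ) →ᵇ ℝ) * (g.compContinuous ⟨Prod.fst, continuous_fst⟩)).integrable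
        ((μ.map Prod.snd) ⊗ₘ κ)
    exact this
  constructor
  · rw [Measure.compProd] at hi
    have := hi.integral_compProd
    simp only [integral_mul_const, Kernel.const_apply, Kernel.prodMkLeft_apply] at this
    simpa [mul_comm] using this
  · conv_lhs => rw [e]
    rw [integral_map (by fun_prop) (Continuous.aestronglyMeasurable (by fun_prop))]
    simp only [Prod.fst_swap, Prod.snd_swap]
    rw [Measure.integral_compProd hi]
    simp only [integral_mul_const]
    simp [mul_comm]

theorem aux_gauss (ν : Measure (ℝ × ℝ)) (hν : IsProbabilityMeasure ν)
    (hGauss : IsGaussianMeasure ν)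
    (σX2 σY2 σXY γ : ℝ)
    (hσX2 : σX2 = covFn ν (fun p => p.1) (fun p => p.1))
    (hσY2 : σY2 = covFn ν (fun p => p.2) (fun p => p.2))
    (hσXY : σXY = covFn ν (fun p => p.1) (fun p => p.2))
    (hγ : γ = σXY / σY2) (hVar : 0 < σY2) :
    ∃ W : Measure ℝ, IsProbabilityMeasure W ∧
      (∀ t, W.map (fun w => w + γ * t) = gaussianReal ((∫ p, p.1 ∂ν) + γ * (t - ∫ p, p.2 ∂ν))
        (Real.toNNReal (σX2 - σXY ^ 2 / σY2))) ∧
      (∀ h g : ℝ →ᵇ ℝ, ∫ p, h p.1 * g p.2 ∂ν =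
        ∫ z, g z * (∫ w, h (w + γ * z) ∂W) ∂(ν.map Prod.snd)) ∧
      volume ≪ ν.map Prod.snd := by
  have hG : IsGaussian ν := isGaussian_of_map_eq_gaussianReal hGauss
  have hid : HasGaussianLaw (fun p : ℝ × ℝ => (p.1, p.2)) ν := IsGaussian.hasGaussianLaw_id
  have hX := hid.fst
  have hY := hid.snd
  have mX := hX.memLp_two
  have mY := hY.memLp_two
  have cXY : cov[fun p : ℝ × ℝ => p.1, fun p => p.2; ν] = σXY := by
    rw [covariance_eq_sub mX mY, hσXY]; rfl
  have cXX : Var[fun p : ℝ × ℝ => p.1; ν] = σX2 := by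
    rw [← covariance_self hX.aemeasurable, covariance_eq_sub mX mX, hσX2]; rfl
  have cYY : Var[fun p : ℝ × ℝ => p.2; ν] = σY2 := by
    rw [← covariance_self hY.aemeasurable, covariance_eq_sub mY mY, hσY2]; rfl
  let L : (ℝ × ℝ) →L[ℝ] (ℝ × ℝ) :=
    (ContinuousLinearMap.fst ℝ ℝ ℝ - γ • ContinuousLinearMap.snd ℝ ℝ ℝ).prod
      (ContinuousLinearMap.snd ℝ ℝ ℝ)
  have hWY : HasGaussianLaw (fun p : ℝ × ℝ => (p.1 - γ * p.2, p.2)) ν := hid.map_fun L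
  have mγY : MemLp (fun p : ℝ × ℝ => γ * p.2) 2 ν := mY.const_mul γ
  have hW := hWY.fst
  have hne : σY2 ≠ 0 := hVar.ne'
  have c0 : cov[fun p : ℝ × ℝ => p.1 - γ * p.2, fun p => p.2; ν] = 0 := by
    rw [covariance_fun_sub_left mX mγY mY, covariance_const_mul_left, cXY,
      covariance_self hY.aemeasurable, cYY, hγ]
    field_simp
    ring
  have hind := hWY.indepFun_of_covariance_eq_zero c0
  have vW : Var[fun p : ℝ × ℝ => p.1 - γ * p.2; ν] = σX2 - σXY ^ 2 / σY2 := by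
    rw [variance_fun_sub mX mγY, variance_const_mul, covariance_const_mul_right, cXX, cXY, cYY, hγ]
    field_simp
    ring
  have eW : ν[fun p : ℝ × ℝ => p.1 - γ * p.2] = (∫ p, p.1 ∂ν) - γ * ∫ p, p.2 ∂ν := by
    rw [integral_sub hX.integrable (hY.integrable.const_mul γ), integral_const_mul]
  have lW := hW.map_eq_gaussianReal
  rw [vW, eW] at lW
  have lY := hY.map_eq_gaussianReal
  rw [cYY] at lY
  refine ⟨ν.map (fun p => p.1 - γ * p.2), Measure.isProbabilityMeasure_map hW.aemeasurable,
    ?_, ?_, ?_⟩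
  · intro t
    rw [lW, gaussianReal_map_add_const]
    congr 1
    ring
  · intro h g
    have ip : IsProbabilityMeasure (ν.map (fun p : ℝ × ℝ => p.1 - γ * p.2)) :=
      Measure.isProbabilityMeasure_map hW.aemeasurable
    have ip : IsProbabilityMeasure (ν.map (fun p : ℝ × ℝ => p.2)) :=
      Measure.isProbabilityMeasure_map hY.aemeasurable
    have hp := (indepFun_iff_map_prod_eq_prod_map_map hW.aemeasurable hY.aemeasurable).1 hind
    have e1 : ∫ p, h p.1 * g p.2 ∂ν = ∫ q : ℝ × ℝ, h (q.1 + γ * q.2) * g q.2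
        ∂(ν.map (fun p : ℝ × ℝ => (p.1 - γ * p.2, p.2))) := by
      rw [integral_map hWY.aemeasurable (Continuous.aestronglyMeasurable (by fun_prop))]
      simp
    rw [e1, hp, integral_prod_symm]
    · simp only [integral_mul_const]
      simp only [mul_comm]
    · exact ((h.compContinuous ⟨fun q : ℝ × ℝ => q.1 + γ * q.2, by fun_prop⟩ :
        (ℝ × ℝ) →ᵇ ℝ) * (g.compContinuous ⟨Prod.snd, continuous_snd⟩)).integrable _
  · change volume ≪ ν.map (fun p : ℝ × ℝ => p.2)
    rw [lY]
    exact gaussianReal_absolutelyContinuous' _ (by simpa using hVar)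

theorem aux_conv (Ps : ℕ → Measure ℝ) (P : Measure ℝ) (hPs : ∀ n, IsProbabilityMeasure (Ps n))
    (hP : IsProbabilityMeasure P)
    (H : ∀ h : ℝ →ᵇ ℝ, Monotone h →
      Tendsto (fun n => ∫ x, h x ∂(Ps n)) atTop (𝓝 (∫ x, h x ∂P))) :
    _root_.TendstoInDistribution Ps P := by
  -- clamped Lipschitz functions
  have H1 : ∀ f : ℝ →ᵇ ℝ, ∀ K : NNReal, LipschitzWith K f → ∀ M : ℝ, 0 ≤ M →
      Tendsto (fun n => ∫ x, f (max (-M) (min x M)) ∂(Ps n)) atTop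
        (𝓝 (∫ x, f (max (-M) (min x M)) ∂P)) := by
    intro f K hf M hM
    have hcl : Monotone (fun x : ℝ => max (-M) (min x M)) := fun x y hxy => by
      simp only; gcongr
    let cl : ℝ →ᵇ ℝ := BoundedContinuousFunction.ofNormedAddCommGroup
      (fun x : ℝ => K * max (-M) (min x M)) (by fun_prop) (K * M) (fun x => by
        rw [norm_mul, Real.norm_eq_abs, Real.norm_eq_abs, abs_of_nonneg K.coe_nonneg]
        refine mul_le_mul_of_nonneg_left ?_ K.2
        rw [abs_le]
        exact ⟨le_max_left _ _, max_le (by linarith) (min_le_right _ _)⟩)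
    let fc : ℝ →ᵇ ℝ := f.compContinuous ⟨fun x : ℝ => max (-M) (min x M), by fun_prop⟩
    have m1 : Monotone cl := fun x y hxy => mul_le_mul_of_nonneg_left (hcl hxy) K.2
    have m2 : Monotone (fc + cl) := fun x y hxy => by
      have h1 := hcl hxy
      have h2 := hf.dist_le_mul (max (-M) (min x M)) (max (-M) (min y M))
      rw [Real.dist_eq, Real.dist_eq, abs_sub_comm (max (-M) (min x M)),
        abs_of_nonneg (sub_nonneg.2 h1)] at h2
      have h3 := (abs_le.1 h2).2
      change f (max (-M) (min x M)) + K * max (-M) (min x M) ≤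
        f (max (-M) (min y M)) + K * max (-M) (min y M)
      linarith
    have t := (H _ m2).sub (H _ m1)
    have e : ∀ Q : Measure ℝ, IsProbabilityMeasure Q →
        ∫ x, (fc + cl) x ∂Q - ∫ x, cl x ∂Q = ∫ x, f (max (-M) (min x M)) ∂Q := by
      intro Q hQ
      rw [← integral_sub ((fc + cl).integrable Q) (cl.integrable Q)]
      simp [fc]
    rw [e P hP] at t
    exact t.congr (fun n => e _ (hPs n))
  have H2 : ∀ f : ℝ →ᵇ ℝ, ∀ K : NNReal, LipschitzWith K f →
      Tendsto (fun n => ∫ x, f x ∂(Ps n)) atTop (𝓝 (∫ x, f x ∂P)) := by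
    intro f K hf
    -- the tail function
    let r : ℝ → (ℝ →ᵇ ℝ) := fun M => BoundedContinuousFunction.ofNormedAddCommGroup
      (fun x : ℝ => min 1 (max 0 (|x| - M))) (by fun_prop) 1 (fun x => by
        rw [Real.norm_eq_abs, abs_le]
        exact ⟨by linarith [le_min zero_le_one (le_max_left 0 (|x| - M))], min_le_left _ _⟩)
    have hr0 : ∀ M x, 0 ≤ r M x := fun M x => le_min zero_le_one (le_max_left _ _)
    have hr1 : ∀ M x, r M x ≤ 1 := fun M x => min_le_left _ _
    have hrl : ∀ M, LipschitzWith 1 (r M) := fun M => by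
      have h1 : LipschitzWith 1 (fun x : ℝ => |x| - M) := by
        refine LipschitzWith.of_dist_le_mul (fun x y => ?_)
        rw [Real.dist_eq, Real.dist_eq]
        have := abs_abs_sub_abs_le_abs_sub x y
        simpa using this
      exact (h1.const_max 0).const_min 1
    have hrc : ∀ M, 0 ≤ M → ∀ x, r M (max (-(M+1)) (min x (M+1))) = r M x := by
      intro M hM x
      change min 1 (max 0 (|max (-(M+1)) (min x (M+1))| - M)) = min 1 (max 0 (|x| - M))
      rcases le_or_gt x (M+1) with h | h
      · rw [min_eq_left h]
        rcases le_or_gt (-(M+1)) x with h' | h'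
        · rw [max_eq_right h']
        · rw [max_eq_left h'.le, abs_neg, abs_of_nonneg (by linarith),
            abs_of_neg (by linarith : x < 0)]
          rw [max_eq_right (by linarith), max_eq_right (by linarith),
            min_eq_left (by linarith), min_eq_left (by linarith)]
      · rw [min_eq_right h.le, max_eq_right (by linarith : -(M+1) ≤ M+1),
            abs_of_nonneg (by linarith : 0 ≤ M+1), abs_of_pos (by linarith : 0 < x)]
        rw [max_eq_right (by linarith), max_eq_right (by linarith),
            min_eq_left (by linarith), min_eq_left (by linarith)]
    have hrt : ∀ M, 0 ≤ M → Tendsto (fun n => ∫ x, r M x ∂(Ps n)) atTop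
        (𝓝 (∫ x, r M x ∂P)) := by
      intro M hM
      have := H1 (r M) 1 (hrl M) (M+1) (by linarith)
      simpa only [hrc M hM] using this
    -- tails vanish
    have hrz : Tendsto (fun M : ℕ => ∫ x, r M x ∂P) atTop (𝓝 0) := by
      have : Tendsto (fun M : ℕ => ∫ x, r M x ∂P) atTop (𝓝 (∫ x, (0:ℝ) ∂P)) := by
        refine tendsto_integral_of_dominated_convergence (fun _ => (1:ℝ))
          (fun M => (r M).continuous.aestronglyMeasurable) (integrable_const _) ?_ ?_
        · intro M
          refine ae_of_all _ (fun x => ?_)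
          rw [Real.norm_eq_abs, abs_of_nonneg (hr0 _ _)]
          exact hr1 _ _
        · refine ae_of_all _ (fun x => ?_)
          refine tendsto_const_nhds.congr' ?_
          obtain ⟨N, hN⟩ := exists_nat_ge |x|
          filter_upwards [eventually_ge_atTop N] with M hM
          change (0:ℝ) = min 1 (max 0 (|x| - M))
          have : (N:ℝ) ≤ M := by exact_mod_cast hM
          rw [max_eq_left (by linarith), min_eq_right zero_le_one]
      simpa using this
    have hdiff : ∀ Q : Measure ℝ, IsProbabilityMeasure Q → ∀ M : ℝ, 0 ≤ M →
        |∫ x, f x ∂Q - ∫ x, f (max (-(M+1)) (min x (M+1))) ∂Q| ≤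
          2 * ‖f‖ * ∫ x, r M x ∂Q := by
      intro Q hQ M hM
      let fc : ℝ →ᵇ ℝ := f.compContinuous ⟨fun x : ℝ => max (-(M+1)) (min x (M+1)), by fun_prop⟩
      change |∫ x, f x ∂Q - ∫ x, fc x ∂Q| ≤ _
      rw [← integral_sub (f.integrable Q) (fc.integrable Q), ← integral_const_mul]
      rw [← Real.norm_eq_abs]
      refine norm_integral_le_of_norm_le (((r M).integrable Q).const_mul _) (ae_of_all _ fun x => ?_)
      change |f x - f (max (-(M+1)) (min x (M+1)))| ≤ 2 * ‖f‖ * min 1 (max 0 (|x| - M))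
      by_cases hx : |x| ≤ M + 1
      · obtain ⟨h1, h2⟩ := abs_le.1 hx
        rw [min_eq_left h2, max_eq_right h1]
        have := hr0 M x
        change 0 ≤ min 1 (max 0 (|x| - M)) at this
        simp only [sub_self, abs_zero]
        positivity
      · push Not at hx
        rw [max_eq_right (by linarith : 0 ≤ |x| - M), min_eq_left (by linarith : 1 ≤ |x| - M),
          mul_one]
        have h1 := f.norm_coe_le_norm x
        have h2 := f.norm_coe_le_norm (max (-(M+1)) (min x (M+1)))
        have h3 := norm_sub_le (f x) (f (max (-(M+1)) (min x (M+1))))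
        rw [← Real.norm_eq_abs]
        linarith
    rw [Metric.tendsto_nhds]
    intro ε hε
    have hC : 0 ≤ ‖f‖ := norm_nonneg f
    obtain ⟨M, hM⟩ := ((hrz.const_mul (2 * ‖f‖)).eventually
      (gt_mem_nhds (show 2 * ‖f‖ * 0 < ε / 4 by linarith))).exists
    have hM0 : (0:ℝ) ≤ M := Nat.cast_nonneg M
    have E1 := ((hrt M hM0).const_mul (2 * ‖f‖)).eventually (gt_mem_nhds hM)
    have E2 := (Metric.tendsto_nhds.1 (H1 f K hf (M+1) (by linarith))) (ε/4) (by linarith)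
    filter_upwards [E1, E2] with n h1 h2
    have h3 := hdiff P hP M hM0
    have h4 := hdiff (Ps n) (hPs n) M hM0
    rw [Real.dist_eq] at h2 ⊢
    rw [abs_lt] at h2 ⊢
    rw [abs_le] at h3 h4
    constructor <;> linarith [h2.1, h2.2, h3.1, h3.2, h4.1, h4.2]
  let Qs : ℕ → ProbabilityMeasure ℝ := fun n => ⟨Ps n, hPs n⟩
  let Q : ProbabilityMeasure ℝ := ⟨P, hP⟩
  have T : Tendsto Qs atTop (𝓝 Q) := by
    rw [tendsto_iff_forall_lipschitz_integral_tendsto]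
    rintro f ⟨C, hC⟩ ⟨K, hK⟩
    exact H2 (BoundedContinuousFunction.mkOfBound ⟨f, hK.continuous⟩ C hC) K hK
  rw [ProbabilityMeasure.tendsto_iff_forall_integral_tendsto] at T
  exact T

/-- Corollary 2.4: the one-dimensional Gaussian conditional limit theorem. -/
theorem nerman_gaussian_conditional_clt_one_dim
    (μ : ℕ → Measure (ℝ × ℝ)) (hμ : ∀ n, IsProbabilityMeasure (μ n))
    (κ : ℕ → Kernel ℝ ℝ) (hκ : ∀ n, IsCondLaw (μ n) (κ n))
    (hmono : ∀ n, StochIncrFam (fun z => κ n z) ∨ StochDecrFam (fun z => κ n z))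
    (a c b d : ℕ → ℝ) (ha : ∀ n, 0 < a n) (hc : ∀ n, 0 < c n)
    (ν : Measure (ℝ × ℝ)) (hν : IsProbabilityMeasure ν)
    (hGauss : IsGaussianMeasure ν)
    (σX2 σY2 σXY γ ρ : ℝ)
    (hσX2 : σX2 = covFn ν (fun p => p.1) (fun p => p.1))
    (hσY2 : σY2 = covFn ν (fun p => p.2) (fun p => p.2))
    (hσXY : σXY = covFn ν (fun p => p.1) (fun p => p.2))
    (hγ : γ = σXY / σY2)
    (hρ : ρ = σXY / (Real.sqrt σX2 * Real.sqrt σY2))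
    (hVar : 0 < σY2)
    (hconv : TendstoInDistribution
      (fun n => (μ n).map (fun p => ((a n)⁻¹ * (p.1 - b n), (c n)⁻¹ * (p.2 - d n)))) ν)
    (y : ℕ → ℝ) (ξ : ℝ)
    (hy : Tendsto (fun n => (c n)⁻¹ * (y n - d n)) atTop (𝓝 ξ)) :
    TendstoInDistribution
      (fun n => (κ n (y n)).map (fun x => (a n)⁻¹ * (x - b n)))
      (gaussianReal ((∫ p, p.1 ∂ν) + γ * (ξ - ∫ p, p.2 ∂ν))
        (Real.toNNReal (σX2 - σXY ^ 2 / σY2))) ∧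
    (0 < σX2 → σX2 - σXY ^ 2 / σY2 = (1 - ρ ^ 2) * σX2) := by
  have hkM : ∀ n, IsMarkovKernel (κ n) := fun n => (hκ n).1
  constructor
  swap
  · intro hX
    rw [hρ, div_pow, mul_pow, Real.sq_sqrt hX.le, Real.sq_sqrt hVar.le]
    field_simp
  obtain ⟨W, hW, hWt, hWd, hac⟩ := aux_gauss ν hν hGauss σX2 σY2 σXY γ hσX2 hσY2 hσXY hγ hVar
  have hms : ∀ n, Measurable (fun x : ℝ => (a n)⁻¹ * (x - b n)) := fun n => by fun_prop
  refine aux_conv _ _ (fun n => Measure.isProbabilityMeasure_map (hms n).aemeasurable)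
    inferInstance (fun h hm => ?_)
  rw [← hWt ξ]
  rw [integral_map (by fun_prop) h.continuous.aestronglyMeasurable]
  simp only [integral_map (hms _).aemeasurable h.continuous.aestronglyMeasurable]
  have ipY : IsProbabilityMeasure (ν.map Prod.snd) :=
    Measure.isProbabilityMeasure_map (by fun_prop)
  have ipn : ∀ n, IsProbabilityMeasure ((μ n).map Prod.snd) := fun n =>
    Measure.isProbabilityMeasure_map (by fun_prop)
  -- the limit function
  let Hl : ℝ → ℝ := fun z => ∫ w, h (w + γ * z) ∂W
  have hHl : Continuous Hl := by
    refine continuous_of_dominated (bound := fun _ => ‖h‖) ?_ ?_ (integrable_const _) ?_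
    · intro z; exact Continuous.aestronglyMeasurable (by fun_prop)
    · intro z; exact ae_of_all _ (fun w => h.norm_coe_le_norm _)
    · exact ae_of_all _ (fun w => by fun_prop)
  have hHlb : ∀ z, ‖Hl z‖ ≤ ‖h‖ := fun z => by
    have := norm_integral_le_of_norm_le_const (μ := W) (f := fun w => h (w + γ * z)) (C := ‖h‖)
      (ae_of_all _ (fun w => h.norm_coe_le_norm _))
    simpa using this
  let hn : ℕ → (ℝ →ᵇ ℝ) := fun n =>
    h.compContinuous ⟨fun x : ℝ => (a n)⁻¹ * (x - b n), by fun_prop⟩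
  have hnm : ∀ n, Monotone (hn n) := fun n x x' hxx => by
    refine hm ?_
    have := (ha n).le
    change (a n)⁻¹ * (x - b n) ≤ (a n)⁻¹ * (x' - b n)
    gcongr
  let Hn : ℕ → ℝ → ℝ := fun n z => ∫ x, hn n x ∂(κ n z)
  have hHn : ∀ n, Monotone (Hn n) ∨ Antitone (Hn n) := fun n => by
    rcases hmono n with h1 | h1
    · exact Or.inl fun z z' hz => aux_order2 _ _ (h1 z z' hz) (hn n) (hnm n)
    · exact Or.inr fun z z' hz => aux_order1 _ _ (h1 z z' hz) (hn n) (hnm n)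
  let gn : (ℝ →ᵇ ℝ) → ℕ → (ℝ →ᵇ ℝ) := fun g n =>
    g.compContinuous ⟨fun x : ℝ => (c n)⁻¹ * (x - d n), by fun_prop⟩
  have hmap : ∀ n, Measurable (fun p : ℝ × ℝ => ((a n)⁻¹ * (p.1 - b n), (c n)⁻¹ * (p.2 - d n))) :=
    fun n => by fun_prop
  have hJ : ∀ g : ℝ →ᵇ ℝ, Tendsto (fun n => ∫ z, gn g n z * Hn n z ∂((μ n).map Prod.snd)) atTop
      (𝓝 (∫ z, g z * Hl z ∂(ν.map Prod.snd))) := by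
    intro g
    have t := hconv ((h.compContinuous ⟨Prod.fst, continuous_fst⟩ :
      (ℝ × ℝ) →ᵇ ℝ) * (g.compContinuous ⟨Prod.snd, continuous_snd⟩))
    simp only [BoundedContinuousFunction.coe_mul, Pi.mul_apply,
      BoundedContinuousFunction.compContinuous_apply, ContinuousMap.coe_mk] at t
    rw [hWd h g] at t
    refine t.congr (fun n => ?_)
    rw [integral_map (hmap n).aemeasurable (Continuous.aestronglyMeasurable (by fun_prop))]
    exact (aux_disint (μ n) (κ n) (hκ n) (hn n) (gn g n)).2
  have hI : ∀ g : ℝ →ᵇ ℝ, Tendsto (fun n => ∫ z, gn g n z ∂((μ n).map Prod.snd)) atTop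
      (𝓝 (∫ z, g z ∂(ν.map Prod.snd))) := by
    intro g
    have t := hconv (g.compContinuous ⟨Prod.snd, continuous_snd⟩ : (ℝ × ℝ) →ᵇ ℝ)
    simp only [BoundedContinuousFunction.compContinuous_apply, ContinuousMap.coe_mk] at t
    rw [integral_map (by fun_prop) g.continuous.aestronglyMeasurable]
    refine t.congr (fun n => ?_)
    rw [integral_map (hmap n).aemeasurable (Continuous.aestronglyMeasurable (by fun_prop)),
      integral_map (by fun_prop) (gn g n).continuous.aestronglyMeasurable]
    rfl
  change Tendsto (fun n => Hn n (y n)) atTop (𝓝 (Hl ξ))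
  rw [Metric.tendsto_nhds]
  intro ε' hε'
  obtain ⟨ε, hε, hεε⟩ : ∃ ε : ℝ, 0 < ε ∧ 2 * ε = ε' := ⟨ε' / 2, by linarith, by ring⟩
  obtain ⟨δ, hδ, hHδ⟩ := Metric.continuous_iff.1 hHl ξ ε hε
  let tent : ℝ → (ℝ →ᵇ ℝ) := fun c0 => BoundedContinuousFunction.ofNormedAddCommGroup
      (fun x : ℝ => max 0 (δ / 4 - |x - c0|)) (by fun_prop) (δ / 4) (fun x => by
        rw [Real.norm_eq_abs, abs_of_nonneg (le_max_left _ _)]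
        exact max_le (by linarith) (by linarith [abs_nonneg (x - c0)]))
  have tent0 : ∀ c0 x, 0 ≤ tent c0 x := fun c0 x => le_max_left _ _
  have tents : ∀ c0 x, tent c0 x ≠ 0 → |x - c0| < δ / 4 := fun c0 x hx => by
    by_contra hcon
    push Not at hcon
    exact hx (max_eq_left (by linarith))
  have key : ∀ c0, |c0 - ξ| = δ / 2 → ∀ᶠ n in atTop,
      0 < ∫ z, gn (tent c0) n z ∂((μ n).map Prod.snd) ∧
      (Hl ξ - 2 * ε) * ∫ z, gn (tent c0) n z ∂((μ n).map Prod.snd) <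
        ∫ z, gn (tent c0) n z * Hn n z ∂((μ n).map Prod.snd) ∧
      ∫ z, gn (tent c0) n z * Hn n z ∂((μ n).map Prod.snd) <
        (Hl ξ + 2 * ε) * ∫ z, gn (tent c0) n z ∂((μ n).map Prod.snd) := by
    intro c0 hc0
    have pos : 0 < ∫ z, tent c0 z ∂(ν.map Prod.snd) := by
      rw [integral_pos_iff_support_of_nonneg (tent0 c0) ((tent c0).integrable _)]
      have hsub : Metric.ball c0 (δ / 4) ⊆ Function.support (tent c0) := fun x hx => by
        rw [Metric.mem_ball, Real.dist_eq] at hx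
        have : 0 < δ / 4 - |x - c0| := by linarith
        exact (lt_max_of_lt_right this).ne'
      refine lt_of_lt_of_le ?_ (measure_mono hsub)
      rw [pos_iff_ne_zero]
      intro h0
      exact (Metric.measure_ball_pos volume c0 (by linarith : 0 < δ / 4)).ne' (hac h0)
    have i1 : Integrable (fun z => tent c0 z * Hl z) (ν.map Prod.snd) := by
      refine ((tent c0).integrable _).mul_bdd (c := ‖h‖) hHl.aestronglyMeasurable
        (ae_of_all _ hHlb)
    have hloc : ∀ z, tent c0 z ≠ 0 → |Hl z - Hl ξ| < ε := fun z hz => by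
      have h1 := tents c0 z hz
      refine hHδ z ?_
      rw [Real.dist_eq]
      calc |z - ξ| = |(z - c0) + (c0 - ξ)| := by ring_nf
        _ ≤ |z - c0| + |c0 - ξ| := abs_add_le _ _
        _ < δ := by linarith
    have up : ∫ z, tent c0 z * Hl z ∂(ν.map Prod.snd) ≤
        (Hl ξ + ε) * ∫ z, tent c0 z ∂(ν.map Prod.snd) := by
      rw [← integral_const_mul]
      refine integral_mono i1 (((tent c0).integrable _).const_mul _) (fun z => ?_)
      by_cases hz : tent c0 z = 0
      · simp [hz]
      · have := (abs_lt.1 (hloc z hz)).2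
        nlinarith [tent0 c0 z]
    have lo : (Hl ξ - ε) * ∫ z, tent c0 z ∂(ν.map Prod.snd) ≤
        ∫ z, tent c0 z * Hl z ∂(ν.map Prod.snd) := by
      rw [← integral_const_mul]
      refine integral_mono (((tent c0).integrable _).const_mul _) i1 (fun z => ?_)
      by_cases hz : tent c0 z = 0
      · simp [hz]
      · have := (abs_lt.1 (hloc z hz)).1
        nlinarith [tent0 c0 z]
    have tI := hI (tent c0)
    have tJ := hJ (tent c0)
    refine (tI.eventually (lt_mem_nhds pos)).and (Eventually.and ?_ ?_)
    · exact (tI.const_mul (Hl ξ - 2 * ε)).eventually_lt tJ (by nlinarith)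
    · exact tJ.eventually_lt (tI.const_mul (Hl ξ + 2 * ε)) (by nlinarith)
  have kp := key (ξ + δ / 2) (by rw [add_sub_cancel_left, abs_of_pos (by linarith)])
  have km := key (ξ - δ / 2) (by rw [sub_sub_cancel_left, abs_neg, abs_of_pos (by linarith)])
  have hyδ := Metric.tendsto_nhds.1 hy (δ / 4) (by linarith)
  filter_upwards [kp, km, hyδ] with n hp hq hyn
  rw [Real.dist_eq, abs_lt] at hyn
  have hcn := inv_pos.2 (hc n)
  -- location of supports
  have sp : ∀ z, gn (tent (ξ + δ / 2)) n z ≠ 0 → y n ≤ z := fun z hz => by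
    have h1 := abs_lt.1 (tents _ _ hz)
    have h2 := h1.1
    change -(δ / 4) < (c n)⁻¹ * (z - d n) - (ξ + δ / 2) at h2
    have h3 : (c n)⁻¹ * (y n - d n) < (c n)⁻¹ * (z - d n) := by linarith [hyn.2]
    have h4 := lt_of_mul_lt_mul_left h3 hcn.le
    linarith
  have sm : ∀ z, gn (tent (ξ - δ / 2)) n z ≠ 0 → z ≤ y n := fun z hz => by
    have h1 := abs_lt.1 (tents _ _ hz)
    have h2 := h1.2
    change (c n)⁻¹ * (z - d n) - (ξ - δ / 2) < (δ / 4) at h2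
    have h3 : (c n)⁻¹ * (z - d n) < (c n)⁻¹ * (y n - d n) := by linarith [hyn.1]
    have h4 := lt_of_mul_lt_mul_left h3 hcn.le
    linarith
  have gi : ∀ g : ℝ →ᵇ ℝ, Integrable (fun z => gn g n z * Hn n z) ((μ n).map Prod.snd) :=
    fun g => (aux_disint (μ n) (κ n) (hκ n) (hn n) (gn g n)).1
  have gle : ∀ c0, (∀ z, gn (tent c0) n z ≠ 0 → Hn n z ≤ Hn n (y n)) →
      ∫ z, gn (tent c0) n z * Hn n z ∂((μ n).map Prod.snd) ≤
        Hn n (y n) * ∫ z, gn (tent c0) n z ∂((μ n).map Prod.snd) := by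
    intro c0 hz
    rw [← integral_const_mul]
    refine integral_mono (gi _) (((gn (tent c0) n).integrable _).const_mul _) (fun z => ?_)
    by_cases h0 : gn (tent c0) n z = 0
    · simp [h0]
    · have h1 := hz z h0
      have h2 : 0 ≤ gn (tent c0) n z := tent0 _ _
      change gn (tent c0) n z * Hn n z ≤ Hn n (y n) * gn (tent c0) n z
      nlinarith
  have gge : ∀ c0, (∀ z, gn (tent c0) n z ≠ 0 → Hn n (y n) ≤ Hn n z) →
      Hn n (y n) * ∫ z, gn (tent c0) n z ∂((μ n).map Prod.snd) ≤
      ∫ z, gn (tent c0) n z * Hn n z ∂((μ n).map Prod.snd) := by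
    intro c0 hz
    rw [← integral_const_mul]
    refine integral_mono (((gn (tent c0) n).integrable _).const_mul _) (gi _) (fun z => ?_)
    by_cases h0 : gn (tent c0) n z = 0
    · simp [h0]
    · have h1 := hz z h0
      have h2 : 0 ≤ gn (tent c0) n z := tent0 _ _
      change Hn n (y n) * gn (tent c0) n z ≤ gn (tent c0) n z * Hn n z
      nlinarith
  obtain ⟨p0, p1, p2⟩ := hp
  obtain ⟨q0, q1, q2⟩ := hq
  rw [Real.dist_eq, abs_lt, ← hεε]
  rcases hHn n with hmn | hmn
  · have u1 := gge _ (fun z hz => hmn (sp z hz))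
    have u2 := gle _ (fun z hz => hmn (sm z hz))
    have v1 := lt_of_mul_lt_mul_right (u1.trans_lt p2) p0.le
    have v2 := lt_of_mul_lt_mul_right (q1.trans_le u2) q0.le
    constructor <;> linarith
  · have u1 := gle _ (fun z hz => hmn (sp z hz))
    have u2 := gge _ (fun z hz => hmn (sm z hz))
    have v1 := lt_of_mul_lt_mul_right (p1.trans_le u1) p0.le
    have v2 := lt_of_mul_lt_mul_right (u2.trans_lt q2) q0.le
    constructor <;> linarith
end
end

section
/- Let (X_n, Y_n), n ≥ 1, be pairs with X_n a random vector in ℝ^q and Y_n a real random variable, and suppose there exists a fixed invertible linear operator T on ℝ^q such that T X_n is stochastically monotone with respect to Y_n for every n. Suppose there exist real numbers a_n > 0, c_n > 0, vectors b_n ∈ ℝ^q and reals d_n such that (a_n^{-1}(X_n − b_n), c_n^{-1}(Y_n − d_n)) converges in distribution to a random vector (X, Y) whose distribution is Gaussian on ℝ^{q+1} with Var(Y) > 0. Let y_n be a real sequence with c_n^{-1}(y_n − d_n) → ξ for some ξ ∈ ℝ, and let X̃_n have distribution ℒ(X_n | Y_n = y_n). Set γ = (γ^{(1)},…,γ^{(q)})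 with γ^{(i)} = Cov(X^{(i)}, Y)/Var(Y). Then a_n^{-1}(X̃_n − b_n) converges in distribution to X̃ := X + (ξ − Y)γ. -/
open MeasureTheory ProbabilityTheory Filter Topology

noncomputable section

/-- Convergence of orthant probabilities at continuity points implies weak convergence. -/
lemma tendsto_of_orthants {q : ℕ} (Q : ℕ → ProbabilityMeasure (Fin q → ℝ))
    (ρ : ProbabilityMeasure (Fin q → ℝ))
    (h : ∀ w : Fin q → ℝ, (∀ i, (ρ : Measure (Fin q → ℝ)) {x | x i = w i} = 0) →
      Tendsto (fun n => (Q n : Measure (Fin q → ℝ)).real (Set.Iic w)) atTop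
        (𝓝 ((ρ : Measure (Fin q → ℝ)).real (Set.Iic w)))) :
    Tendsto Q atTop (𝓝 ρ) := by
  classical
  set G : (Fin q → ℝ) → Prop := fun w => ∀ i, (ρ : Measure (Fin q → ℝ)) {x | x i = w i} = 0
    with hG
  let B : Finset (Fin q) → (Fin q → ℝ) → (Fin q → ℝ) → Set (Fin q → ℝ) :=
    fun s l u => {x | (∀ i, x i ≤ u i) ∧ ∀ i ∈ s, l i < x i}
  have hBm : ∀ s l u, MeasurableSet (B s l u) := by
    intro s l u
    have : B s l u = (⋂ i, {x | x i ≤ u i}) ∩ ⋂ i ∈ s, {x | l i < x i} := by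
      ext x; simp [B]
    rw [this]
    refine MeasurableSet.inter (MeasurableSet.iInter fun i => ?_)
      (Finset.measurableSet_biInter _ fun i _ => ?_)
    · exact measurableSet_le (measurable_pi_apply i) measurable_const
    · exact measurableSet_lt measurable_const (measurable_pi_apply i)
  have hB : ∀ s : Finset (Fin q), ∀ l u, G l → G u → (∀ i, l i ≤ u i) →
      Tendsto (fun n => (Q n : Measure (Fin q → ℝ)).real (B s l u)) atTop
        (𝓝 ((ρ : Measure (Fin q → ℝ)).real (B s l u))) := by
    intro s
    induction s using Finset.induction_on with
    | empty =>
      intro l u hl hu hlu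
      have : B ∅ l u = Set.Iic u := by ext x; simp [B, Pi.le_def]
      rw [this]
      exact h u hu
    | insert j s hj ih =>
      intro l u hl hu hlu
      have hsub : B s l (Function.update u j (l j)) ⊆ B s l u := by
        rintro x ⟨h1, h2⟩
        refine ⟨fun i => ?_, h2⟩
        have := h1 i
        by_cases hij : i = j
        · subst hij; simp at this; exact this.trans (hlu i)
        · simpa [hij] using this
      have heq : B (insert j s) l u = B s l u \ B s l (Function.update u j (l j)) := by
        ext x
        constructor
        · rintro ⟨h1, h2⟩
          refine ⟨⟨h1, fun i hi => h2 i (Finset.mem_insert_of_mem hi)⟩, ?_⟩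
          rintro ⟨h3, -⟩
          have h4 := h3 j
          have h5 := h2 j (Finset.mem_insert_self _ _)
          simp at h4
          linarith
        · rintro ⟨⟨h1, h2⟩, h3⟩
          refine ⟨h1, fun i hi => ?_⟩
          rcases Finset.mem_insert.1 hi with rfl | hi
          · by_contra hc
            apply h3
            refine ⟨fun k => ?_, h2⟩
            by_cases hk : k = i
            · subst hk; simpa using hc
            · simpa [hk] using h1 k
          · exact h2 i hi
      have hG' : G (Function.update u j (l j)) := by
        intro i
        by_cases hij : i = j
        · subst hij; simpa using hl i
        · simpa [hij] using hu i
      have hl' : ∀ i, l i ≤ Function.update u j (l j) i := by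
        intro i
        by_cases hij : i = j
        · subst hij; simp
        · simpa [hij] using hlu i
      rw [heq]
      have hd : ∀ M : ProbabilityMeasure (Fin q → ℝ),
          (M : Measure (Fin q → ℝ)).real (B s l u \ B s l (Function.update u j (l j))) =
          (M : Measure (Fin q → ℝ)).real (B s l u) -
          (M : Measure (Fin q → ℝ)).real (B s l (Function.update u j (l j))) :=
        fun M => measureReal_sdiff hsub (hBm _ _ _)
      simp_rw [hd]
      exact (ih l u hl hu hlu).sub (ih l _ hl hG' hl')
  have hdense : ∀ (i : Fin q) (a b : ℝ), a < b →
      ∃ c, a < c ∧ c < b ∧ (ρ : Measure (Fin q → ℝ)) {x | x i = c} = 0 := by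
    intro i a b hab
    have hc : Set.Countable {t : ℝ | 0 < (ρ : Measure (Fin q → ℝ)) {x | x i = t}} :=
      Measure.countable_meas_level_set_pos (measurable_pi_apply i)
    obtain ⟨c, hc1, hc2⟩ := (hc.dense_compl ℝ).exists_between hab
    exact ⟨c, hc2.1, hc2.2, by simpa using hc1⟩
  let S : Set (Set (Fin q → ℝ)) :=
    {s | ∃ l u, G l ∧ G u ∧ (∀ i, l i ≤ u i) ∧ s = B Finset.univ l u}
  have hS : IsPiSystem S := by
    rintro _ ⟨l, u, hl, hu, hlu, rfl⟩ _ ⟨l', u', hl', hu', hlu', rfl⟩ ⟨x, hx, hx'⟩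
    refine ⟨fun i => max (l i) (l' i), fun i => min (u i) (u' i), ?_, ?_, ?_, ?_⟩
    · intro i
      rcases max_choice (l i) (l' i) with h | h
      · simpa [h] using hl i
      · simpa [h] using hl' i
    · intro i
      rcases min_choice (u i) (u' i) with h | h
      · simpa [h] using hu i
      · simpa [h] using hu' i
    · intro i
      have h1 := hx.1 i
      have h2 := hx.2 i (Finset.mem_univ _)
      have h3 := hx'.1 i
      have h4 := hx'.2 i (Finset.mem_univ _)
      exact (max_lt h2 h4).le.trans (le_min h1 h3)
    · ext z
      simp only [B, Set.mem_inter_iff, Set.mem_ofPred_eq, Finset.mem_univ, true_implies, le_min_iff,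
        max_lt_iff, forall_and]
      tauto
  refine hS.tendsto_probabilityMeasure_of_tendsto_of_mem ?_ ?_ ?_
  · rintro _ ⟨l, u, -, -, -, rfl⟩
    exact hBm _ _ _
  · intro U hU x hx
    obtain ⟨ε, hε, hball⟩ := Metric.isOpen_iff.1 hU x hx
    choose l hl1 hl2 hl3 using fun i => hdense i (x i - ε / 2) (x i) (by linarith)
    choose u hu1 hu2 hu3 using fun i => hdense i (x i) (x i + ε / 2) (by linarith)
    refine ⟨_, ⟨l, u, hl3, hu3, fun i => ((hl2 i).trans (hu1 i)).le, rfl⟩, ?_, ?_⟩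
    · have : Set.pi Set.univ (fun i => Set.Ioo (l i) (u i)) ∈ 𝓝 x :=
        set_pi_mem_nhds Set.finite_univ fun i _ => Ioo_mem_nhds (hl2 i) (hu1 i)
      refine mem_of_superset this fun z hz => ?_
      exact ⟨fun i => (hz i trivial).2.le, fun i _ => (hz i trivial).1⟩
    · rintro z ⟨hz1, hz2⟩
      apply hball
      rw [Metric.mem_ball]
      refine lt_of_le_of_lt ((dist_pi_le_iff (by positivity : (0 : ℝ) ≤ ε / 2)).2 fun i => ?_)
        (half_lt_self hε)
      have h1 := hz1 i
      have h2 := hz2 i (Finset.mem_univ _)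
      have h3 := hl1 i
      have h4 := hu2 i
      rw [Real.dist_eq, abs_le]
      constructor <;> linarith
  · rintro _ ⟨l, u, hl, hu, hlu, rfl⟩
    have := hB Finset.univ l u hl hu hlu
    rw [← NNReal.tendsto_coe]
    exact this

lemma orthant_core {q : ℕ} (P : ℕ → ProbabilityMeasure ((Fin q → ℝ) × ℝ))
    (ν : ProbabilityMeasure ((Fin q → ℝ) × ℝ)) (hP : Tendsto P atTop (𝓝 ν))
    (Q : ℕ → ProbabilityMeasure (Fin q → ℝ)) (ρ : ProbabilityMeasure (Fin q → ℝ))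
    (g : Fin q → ℝ) (ξ : ℝ) (u : ℕ → ℝ) (hu : Tendsto u atTop (𝓝 ξ))
    (hind : ∀ A : Set (Fin q → ℝ), ∀ t : Set ℝ, MeasurableSet A → MeasurableSet t →
      (ν : Measure ((Fin q → ℝ) × ℝ)) {p | p.1 + (ξ - p.2) • g ∈ A ∧ p.2 ∈ t} =
        (ρ : Measure (Fin q → ℝ)) A * (ν : Measure ((Fin q → ℝ) × ℝ)) (Set.univ ×ˢ t))
    (hatom : ∀ c : ℝ, (ν : Measure ((Fin q → ℝ) × ℝ)) (Set.univ ×ˢ {c}) = 0)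
    (hpos : ∀ a b : ℝ, a < b → (ν : Measure ((Fin q → ℝ) × ℝ)) (Set.univ ×ˢ Set.Ioo a b) ≠ 0)
    (h1 : ∀ n w t, MeasurableSet t → (∀ v ∈ t, v ≤ u n) →
      (Q n : Measure (Fin q → ℝ)) (Set.Iic w) * (P n : Measure ((Fin q → ℝ) × ℝ)) (Set.univ ×ˢ t)
        ≤ (P n : Measure ((Fin q → ℝ) × ℝ)) (Set.Iic w ×ˢ t))
    (h2 : ∀ n w t, MeasurableSet t → (∀ v ∈ t, u n ≤ v) →
      (P n : Measure ((Fin q → ℝ) × ℝ)) (Set.Iic w ×ˢ t) ≤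
      (Q n : Measure (Fin q → ℝ)) (Set.Iic w) * (P n : Measure ((Fin q → ℝ) × ℝ)) (Set.univ ×ˢ t))
    (w : Fin q → ℝ) (hw : ∀ i, (ρ : Measure (Fin q → ℝ)) {x | x i = w i} = 0) :
    Tendsto (fun n => (Q n : Measure (Fin q → ℝ)) (Set.Iic w)) atTop
        (𝓝 ((ρ : Measure (Fin q → ℝ)) (Set.Iic w))) := by
  have hδ0 : Tendsto (fun k : ℕ => 2 * (1 / ((k : ℝ) + 1))) atTop (𝓝 0) := by
    simpa using (tendsto_one_div_add_atTop_nhds_zero_nat (𝕜 := ℝ)).const_mul 2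
  have hδpos : ∀ k : ℕ, 0 < 1 / ((k : ℝ) + 1) := fun k => Nat.one_div_pos_of_nat
  have hδanti : ∀ k l : ℕ, k ≤ l → 1 / ((l : ℝ) + 1) ≤ 1 / ((k : ℝ) + 1) :=
    fun k l hkl => Nat.one_div_le_one_div hkl
  have hpair : ∀ a b : ℝ, (ν : Measure ((Fin q → ℝ) × ℝ)) (Set.univ ×ˢ {a, b}) = 0 := by
    intro a b
    rw [Set.insert_eq, Set.prod_union]
    exact measure_union_null (hatom a) (hatom b)
  rw [tendsto_order]
  constructor
  · -- lower bound
    intro r hr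
    let s : ℕ → Set (Fin q → ℝ) := fun k => {x | ∀ i, x i < w i - 2 * (1 / ((k : ℝ) + 1)) * |g i|}
    have hsopen : ∀ k, IsOpen (s k) := by
      intro k
      have : s k = ⋂ i, {x | x i < w i - 2 * (1 / ((k : ℝ) + 1)) * |g i|} := by ext; simp [s]
      rw [this]
      exact isOpen_iInter_of_finite fun i => isOpen_lt (continuous_apply i) continuous_const
    have hmono : Monotone s := by
      intro k l hkl x hx i
      refine (hx i).trans_le ?_
      have := mul_le_mul_of_nonneg_right (hδanti k l hkl) (abs_nonneg (g i))
      linarith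
    have hUn : (⋃ k, s k) = {x | ∀ i, x i < w i} := by
      ext x
      simp only [Set.mem_iUnion, Set.mem_ofPred_eq]
      constructor
      · rintro ⟨k, hk⟩ i
        refine (hk i).trans_le ?_
        have := mul_nonneg (hδpos k).le (abs_nonneg (g i))
        linarith
      · intro hx
        have : ∀ᶠ k : ℕ in atTop, ∀ i, x i < w i - 2 * (1 / ((k : ℝ) + 1)) * |g i| := by
          rw [eventually_all]
          intro i
          have : Tendsto (fun k : ℕ => w i - 2 * (1 / ((k : ℝ) + 1)) * |g i|) atTop (𝓝 (w i)) := by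
            simpa using (hδ0.mul_const (|g i|)).const_sub (w i)
          exact this.eventually_const_lt (hx i)
        exact this.exists
    have hfull : (ρ : Measure (Fin q → ℝ)) (Set.Iic w) ≤ (ρ : Measure (Fin q → ℝ)) (⋃ k, s k) := by
      have hsub : Set.Iic w ⊆ (⋃ k, s k) ∪ ⋃ i, {x | x i = w i} := by
        intro x hx
        rw [hUn]
        by_cases hx' : ∀ i, x i < w i
        · exact Or.inl hx'
        · right
          push Not at hx'
          obtain ⟨i, hi⟩ := hx'
          exact Set.mem_iUnion.2 ⟨i, le_antisymm (hx i) hi⟩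
      refine (measure_mono hsub).trans ((measure_union_le _ _).trans ?_)
      rw [measure_iUnion_null hw, add_zero]
    have hlim := tendsto_measure_iUnion_atTop (μ := (ρ : Measure (Fin q → ℝ))) hmono
    obtain ⟨k, hk⟩ := (hlim.eventually_const_lt (hr.trans_le hfull)).exists
    simp only [Function.comp] at hk
    set δ : ℝ := 1 / ((k : ℝ) + 1) with hδ
    have hδp : 0 < δ := hδpos k
    let t := Set.Ioo (ξ + δ) (ξ + 2 * δ)
    set m := (ν : Measure ((Fin q → ℝ) × ℝ)) (Set.univ ×ˢ t) with hm
    have hm0 : m ≠ 0 := hpos _ _ (by linarith)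
    have hmt : m ≠ ⊤ := measure_ne_top _ _
    have hPt : Tendsto (fun n => (P n : Measure ((Fin q → ℝ) × ℝ)) (Set.univ ×ˢ t)) atTop (𝓝 m) := by
      apply ProbabilityMeasure.tendsto_measure_of_null_frontier_of_tendsto' hP
      rw [frontier_univ_prod_eq, frontier_Ioo (by linarith)]
      exact hpair _ _
    let O : Set (Fin q → ℝ) := {x | ∀ i, x i < w i}
    have hO : IsOpen O := by
      have : O = ⋂ i, {x | x i < w i} := by ext; simp [O]
      rw [this]
      exact isOpen_iInter_of_finite fun i => isOpen_lt (continuous_apply i) continuous_const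
    have hnum := ProbabilityMeasure.le_liminf_measure_open_of_tendsto hP
      (hO.prod (isOpen_Ioo : IsOpen t))
    have hlow : (ρ : Measure (Fin q → ℝ)) (s k) * m ≤
        (ν : Measure ((Fin q → ℝ) × ℝ)) (O ×ˢ t) := by
      rw [hm, ← hind _ _ (hsopen k).measurableSet measurableSet_Ioo]
      refine measure_mono ?_
      rintro p ⟨hp1, hp2⟩
      refine ⟨fun i => ?_, hp2⟩
      have h3 := hp1 i
      simp only [Pi.add_apply, Pi.smul_apply, smul_eq_mul] at h3
      obtain ⟨h4, h5⟩ := hp2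
      have h6 : (p.2 - ξ) * g i ≤ 2 * δ * |g i| :=
        calc (p.2 - ξ) * g i ≤ (p.2 - ξ) * |g i| :=
              mul_le_mul_of_nonneg_left (le_abs_self _) (by linarith)
          _ ≤ 2 * δ * |g i| := mul_le_mul_of_nonneg_right (by linarith) (abs_nonneg _)
      linarith
    have hlt : r * m < (ν : Measure ((Fin q → ℝ) × ℝ)) (O ×ˢ t) :=
      lt_of_lt_of_le ((ENNReal.mul_lt_mul_iff_left hm0 hmt).2 hk) hlow
    obtain ⟨c, hc1, hc2⟩ := exists_between hlt
    have e1 := eventually_lt_of_lt_liminf (hc2.trans_le hnum)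
    have e2 := (ENNReal.Tendsto.const_mul (a := r) hPt (Or.inl hm0)).eventually_lt_const hc1
    have e3 := hu.eventually_lt_const (show ξ < ξ + δ by linarith)
    filter_upwards [e1, e2, e3] with n e1 e2 e3
    have h3 := h2 n w t measurableSet_Ioo (fun v hv => (e3.trans hv.1).le)
    have h4 : (P n : Measure ((Fin q → ℝ) × ℝ)) (O ×ˢ t) ≤
        (P n : Measure ((Fin q → ℝ) × ℝ)) (Set.Iic w ×ˢ t) :=
      measure_mono (Set.prod_mono (fun x hx i => (hx i).le) le_rfl)
    exact lt_of_mul_lt_mul_right' ((e2.trans e1).trans_le (h4.trans h3))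
  · intro r hr
    let s : ℕ → Set (Fin q → ℝ) := fun k => Set.Iic (fun i => w i + 2 * (1 / ((k : ℝ) + 1)) * |g i|)
    have hanti : Antitone s := by
      intro k l hkl x hx i
      refine (hx i).trans ?_
      have := mul_le_mul_of_nonneg_right (hδanti k l hkl) (abs_nonneg (g i))
      simp only
      linarith
    have hIn : (⋂ k, s k) = Set.Iic w := by
      ext x
      simp only [Set.mem_iInter]
      constructor
      · intro hx i
        have : Tendsto (fun k : ℕ => w i + 2 * (1 / ((k : ℝ) + 1)) * |g i|) atTop (𝓝 (w i)) := by
          simpa using (hδ0.mul_const (|g i|)).const_add (w i)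
        exact ge_of_tendsto' this fun k => hx k i
      · intro hx k i
        refine (hx i).trans ?_
        have := mul_nonneg (hδpos k).le (abs_nonneg (g i))
        simp only
        linarith
    have hlim := tendsto_measure_iInter_atTop (μ := (ρ : Measure (Fin q → ℝ))) (s := s)
      (fun k => measurableSet_Iic.nullMeasurableSet) hanti ⟨0, measure_ne_top _ _⟩
    rw [hIn] at hlim
    obtain ⟨k, hk⟩ := (hlim.eventually_lt_const hr).exists
    simp only [Function.comp] at hk
    set δ : ℝ := 1 / ((k : ℝ) + 1) with hδ
    have hδp : 0 < δ := hδpos k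
    let t := Set.Icc (ξ - 2 * δ) (ξ - δ)
    set m := (ν : Measure ((Fin q → ℝ) × ℝ)) (Set.univ ×ˢ t) with hm
    have hm0 : m ≠ 0 := by
      have h3 := hpos (ξ - 2 * δ) (ξ - δ) (by linarith)
      exact fun h => h3 (measure_mono_null (Set.prod_mono le_rfl Set.Ioo_subset_Icc_self) h)
    have hmt : m ≠ ⊤ := measure_ne_top _ _
    have hPt : Tendsto (fun n => (P n : Measure ((Fin q → ℝ) × ℝ)) (Set.univ ×ˢ t)) atTop (𝓝 m) := by
      apply ProbabilityMeasure.tendsto_measure_of_null_frontier_of_tendsto' hP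
      rw [frontier_univ_prod_eq, frontier_Icc (by linarith)]
      exact hpair _ _
    have hnum := ProbabilityMeasure.limsup_measure_closed_le_of_tendsto hP
      ((isClosed_Iic : IsClosed (Set.Iic w)).prod (isClosed_Icc : IsClosed t))
    have hlow : (ν : Measure ((Fin q → ℝ) × ℝ)) (Set.Iic w ×ˢ t) ≤
        (ρ : Measure (Fin q → ℝ)) (s k) * m := by
      rw [hm, ← hind _ _ measurableSet_Iic measurableSet_Icc]
      refine measure_mono ?_
      rintro p ⟨hp1, hp2⟩
      refine ⟨fun i => ?_, hp2⟩
      have h3 := hp1 i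
      simp only [Pi.add_apply, Pi.smul_apply, smul_eq_mul]
      obtain ⟨h4, h5⟩ := hp2
      have h6 : (ξ - p.2) * g i ≤ 2 * δ * |g i| :=
        calc (ξ - p.2) * g i ≤ (ξ - p.2) * |g i| :=
              mul_le_mul_of_nonneg_left (le_abs_self _) (by linarith)
          _ ≤ 2 * δ * |g i| := mul_le_mul_of_nonneg_right (by linarith) (abs_nonneg _)
      linarith
    have hlt : (ν : Measure ((Fin q → ℝ) × ℝ)) (Set.Iic w ×ˢ t) < r * m :=
      lt_of_le_of_lt hlow ((ENNReal.mul_lt_mul_iff_left hm0 hmt).2 hk)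
    obtain ⟨c, hc1, hc2⟩ := exists_between hlt
    have e1 := eventually_lt_of_limsup_lt (hnum.trans_lt hc1)
    have e2 := (ENNReal.Tendsto.const_mul (a := r) hPt (Or.inl hm0)).eventually_const_lt hc2
    have e3 := hu.eventually_const_lt (show ξ - δ < ξ by linarith)
    filter_upwards [e1, e2, e3] with n e1 e2 e3
    have h3 := h1 n w t measurableSet_Icc (fun v hv => (hv.2.trans e3.le))
    exact lt_of_mul_lt_mul_right' ((h3.trans_lt e1).trans e2)

lemma gaussian_facts {q : ℕ} (ν : Measure ((Fin q → ℝ) × ℝ)) (hν : IsProbabilityMeasure ν)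
    (hGauss : IsGaussianMeasure ν)
    (hVar : 0 < covFn ν (fun p => p.2) (fun p => p.2)) (ξ : ℝ) (γ : Fin q → ℝ)
    (hγ : ∀ i, γ i = covFn ν (fun p => p.1 i) (fun p => p.2) /
        covFn ν (fun p => p.2) (fun p => p.2)) :
    IndepFun (fun p : (Fin q → ℝ) × ℝ => p.1 + (ξ - p.2) • γ) (fun p => p.2) ν ∧
    (∀ c : ℝ, ν (Set.univ ×ˢ {c}) = 0) ∧
    (∀ a b : ℝ, a < b → ν (Set.univ ×ˢ Set.Ioo a b) ≠ 0) := by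
  have hG : IsGaussian ν := isGaussian_of_map_eq_gaussianReal hGauss
  have hY2 : MemLp (fun p : (Fin q → ℝ) × ℝ => p.2) 2 ν :=
    IsGaussian.memLp_dual ν (ContinuousLinearMap.snd ℝ (Fin q → ℝ) ℝ) 2 (by simp)
  have hX2 : ∀ i, MemLp (fun p : (Fin q → ℝ) × ℝ => p.1 i) 2 ν := fun i =>
    IsGaussian.memLp_dual ν ((ContinuousLinearMap.proj i).comp
      (ContinuousLinearMap.fst ℝ (Fin q → ℝ) ℝ)) 2 (by simp)
  have hcY : covFn ν (fun p => p.2) (fun p => p.2) =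
      cov[(fun p : (Fin q → ℝ) × ℝ => p.2), (fun p => p.2); ν] := by
    rw [covariance_eq_sub hY2 hY2]; rfl
  have hcX : ∀ i, covFn ν (fun p => p.1 i) (fun p => p.2) =
      cov[(fun p : (Fin q → ℝ) × ℝ => p.1 i), (fun p => p.2); ν] := by
    intro i
    rw [covariance_eq_sub (hX2 i) hY2]; rfl
  have hmapY : ∀ t, MeasurableSet t → ν (Set.univ ×ˢ t) = ν.map (fun p => p.2) t := by
    intro t ht
    rw [Measure.map_apply measurable_snd ht, Set.univ_prod]
  obtain ⟨m, v, hmv⟩ := hGauss (ContinuousLinearMap.snd ℝ (Fin q → ℝ) ℝ)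
  have hmv' : ν.map (fun p => p.2) = gaussianReal m v := hmv
  have hv : v ≠ 0 := by
    have h1 : Var[(fun p : (Fin q → ℝ) × ℝ => p.2); ν] = v := by
      rw [← variance_id_gaussianReal (μ := m) (v := v), ← hmv',
        variance_map aemeasurable_id measurable_snd.aemeasurable]
      rfl
    rw [hcY, covariance_self measurable_snd.aemeasurable, h1] at hVar
    exact_mod_cast hVar.ne'
  refine ⟨?_, ?_, ?_⟩
  · have hW : IndepFun (fun (p : (Fin q → ℝ) × ℝ) i => p.1 i - p.2 * γ i)
        (fun p (_ : Unit) => p.2) ν := by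
      apply HasGaussianLaw.indepFun_of_covariance_eval
      · let L : ((Fin q → ℝ) × ℝ) →L[ℝ] ((Fin q → ℝ) × (Unit → ℝ)) :=
          (ContinuousLinearMap.fst ℝ _ _ -
            (ContinuousLinearMap.snd ℝ (Fin q → ℝ) ℝ).smulRight γ).prod
          (ContinuousLinearMap.pi fun _ => ContinuousLinearMap.snd ℝ (Fin q → ℝ) ℝ)
        exact ⟨(inferInstance : IsGaussian (ν.map L))⟩
      · intro i _
        have h1 : (fun p : (Fin q → ℝ) × ℝ => p.1 i - p.2 * γ i) =
            (fun p => p.1 i) - fun p => p.2 * γ i := rfl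
        rw [h1, covariance_sub_left (hX2 i) (hY2.mul_const _) hY2, covariance_mul_const_left,
          hγ i, hcX, hcY]
        rw [hcY] at hVar
        field_simp
        ring
    have hev : Measurable (fun z : Unit → ℝ => z ()) := measurable_pi_apply ()
    have := hW.comp (φ := fun z : Fin q → ℝ => z + ξ • γ) (ψ := fun z : Unit → ℝ => z ())
      (by fun_prop) hev
    convert this using 1
    · ext p i
      simp
      ring
    · rfl
  · intro c
    rw [hmapY _ (measurableSet_singleton c), hmv']
    exact gaussianReal_absolutelyContinuous m hv (by simp)
  · intro a b hab h
    rw [hmapY _ measurableSet_Ioo, hmv'] at h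
    have := gaussianReal_absolutelyContinuous' m hv h
    simp at this
    linarith

lemma increasing_case
    (q : ℕ)
    (T : (Fin q → ℝ) ≃ₗ[ℝ] (Fin q → ℝ))
    (μ : ℕ → Measure ((Fin q → ℝ) × ℝ)) (hμ : ∀ n, IsProbabilityMeasure (μ n))
    (κ : ℕ → Kernel ℝ (Fin q → ℝ)) (hκ : ∀ n, IsCondLaw (μ n) (κ n))
    (hmono : ∀ n, StochIncrFam (fun z => (κ n z).map (fun x => T x)))
    (a c : ℕ → ℝ) (b : ℕ → Fin q → ℝ) (d : ℕ → ℝ)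
    (ha : ∀ n, 0 < a n) (hc : ∀ n, 0 < c n)
    (ν : Measure ((Fin q → ℝ) × ℝ)) (hν : IsProbabilityMeasure ν)
    (hconv : TendstoInDistribution
      (fun n => (μ n).map (fun p => ((a n)⁻¹ • (p.1 - b n), (c n)⁻¹ * (p.2 - d n)))) ν)
    (y : ℕ → ℝ) (ξ : ℝ)
    (hy : Tendsto (fun n => (c n)⁻¹ * (y n - d n)) atTop (𝓝 ξ))
    (γ : Fin q → ℝ)
    (hind : IndepFun (fun p : (Fin q → ℝ) × ℝ => p.1 + (ξ - p.2) • γ) (fun p => p.2) ν)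
    (hatom : ∀ c : ℝ, ν (Set.univ ×ˢ {c}) = 0)
    (hpos : ∀ a b : ℝ, a < b → ν (Set.univ ×ˢ Set.Ioo a b) ≠ 0) :
    TendstoInDistribution
      (fun n => (κ n (y n)).map (fun x => (a n)⁻¹ • (x - b n)))
      (ν.map (fun p => p.1 + (ξ - p.2) • γ)) := by
  have hTc : Continuous (fun x => T x) := LinearMap.continuous_of_finiteDimensional T.toLinearMap
  have hTsc : Continuous (fun x => T.symm x) :=
    LinearMap.continuous_of_finiteDimensional T.symm.toLinearMap
  have hTm : Measurable (fun x => T x) := hTc.measurable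
  have hmark : ∀ n, IsMarkovKernel (κ n) := fun n => (hκ n).1
  -- the normalized and transformed measures
  have hNm : ∀ n, Measurable (fun p : (Fin q → ℝ) × ℝ =>
      ((a n)⁻¹ • (p.1 - b n), (c n)⁻¹ * (p.2 - d n))) := fun n => by fun_prop
  have hΦm : ∀ n, Measurable (fun x : Fin q → ℝ => (a n)⁻¹ • (x - b n)) := fun n => by fun_prop
  have hWm : Measurable (fun p : (Fin q → ℝ) × ℝ => p.1 + (ξ - p.2) • γ) := by fun_prop
  have hT2c : Continuous (fun p : (Fin q → ℝ) × ℝ => (T p.1, p.2)) :=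
    (hTc.comp continuous_fst).prodMk continuous_snd
  have hT2m : Measurable (fun p : (Fin q → ℝ) × ℝ => (T p.1, p.2)) := hT2c.measurable
  let P0 : ℕ → ProbabilityMeasure ((Fin q → ℝ) × ℝ) := fun n =>
    ⟨(μ n).map (fun p => ((a n)⁻¹ • (p.1 - b n), (c n)⁻¹ * (p.2 - d n))),
      Measure.isProbabilityMeasure_map (hNm n).aemeasurable⟩
  let ν0 : ProbabilityMeasure ((Fin q → ℝ) × ℝ) := ⟨ν, hν⟩
  have hP0 : Tendsto P0 atTop (𝓝 ν0) :=
    ProbabilityMeasure.tendsto_iff_forall_integral_tendsto.2 hconv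
  let P : ℕ → ProbabilityMeasure ((Fin q → ℝ) × ℝ) := fun n => (P0 n).map hT2m.aemeasurable
  let ν1 : ProbabilityMeasure ((Fin q → ℝ) × ℝ) := ν0.map hT2m.aemeasurable
  have hP : Tendsto P atTop (𝓝 ν1) :=
    ProbabilityMeasure.tendsto_map_of_tendsto_of_continuous P0 ν0 hP0 hT2c
  let Q0 : ℕ → ProbabilityMeasure (Fin q → ℝ) := fun n =>
    ⟨(κ n (y n)).map (fun x => (a n)⁻¹ • (x - b n)),
      Measure.isProbabilityMeasure_map (hΦm n).aemeasurable⟩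
  let ρ0 : ProbabilityMeasure (Fin q → ℝ) := ⟨ν.map (fun p => p.1 + (ξ - p.2) • γ),
      Measure.isProbabilityMeasure_map hWm.aemeasurable⟩
  let Q : ℕ → ProbabilityMeasure (Fin q → ℝ) := fun n => (Q0 n).map hTm.aemeasurable
  let ρ : ProbabilityMeasure (Fin q → ℝ) := ρ0.map hTm.aemeasurable
  have hν1 : ∀ A, MeasurableSet A →
      (ν1 : Measure ((Fin q → ℝ) × ℝ)) A = ν {p | (T p.1, p.2) ∈ A} :=
    fun A hA => Measure.map_apply hT2m hA
  have hν1t : ∀ t : Set ℝ, MeasurableSet t →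
      (ν1 : Measure ((Fin q → ℝ) × ℝ)) (Set.univ ×ˢ t) = ν (Set.univ ×ˢ t) := by
    intro t ht
    rw [hν1 _ (MeasurableSet.univ.prod ht)]
    refine congrArg ν ?_
    ext p
    simp
  have hρA : ∀ A, MeasurableSet A →
      (ρ : Measure (Fin q → ℝ)) A = ν {p | T (p.1 + (ξ - p.2) • γ) ∈ A} := by
    intro A hA
    have h1 : (ρ : Measure (Fin q → ℝ)) A =
      (ν.map (fun p => p.1 + (ξ - p.2) • γ)) ((fun x => T x) ⁻¹' A) := Measure.map_apply hTm hA
    rw [h1, Measure.map_apply hWm (hTm hA)]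
    rfl
  -- description of the measures of the relevant sets
  let A : ℕ → (Fin q → ℝ) → Set (Fin q → ℝ) := fun n w => {x | T ((a n)⁻¹ • (x - b n)) ≤ w}
  have hA : ∀ n w, A n w = (fun x => T x) ⁻¹' {z | z ≤ a n • w + T (b n)} := by
    intro n w
    ext x
    simp only [A, Set.mem_ofPred_eq, Set.mem_preimage, map_smul, map_sub, Pi.le_def]
    refine forall_congr' fun i => ?_
    simp only [Pi.smul_apply, Pi.sub_apply, Pi.add_apply, smul_eq_mul]
    rw [inv_mul_le_iff₀ (ha n), sub_le_iff_le_add]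
  have hAm : ∀ n w, MeasurableSet (A n w) := fun n w => by
    rw [hA]; exact hTm measurableSet_Iic
  have hanti : ∀ n w z₁ z₂, z₁ ≤ z₂ → κ n z₂ (A n w) ≤ κ n z₁ (A n w) := by
    intro n w z₁ z₂ hz
    have := hmono n z₁ z₂ hz (a n • w + T (b n))
    simp only at this
    have hm : MeasurableSet {z | z ≤ a n • w + T (b n)} := measurableSet_Iic
    rw [Measure.map_apply hTm hm, Measure.map_apply hTm hm, ← hA] at this
    exact this
  have hQ : ∀ n w, (Q n : Measure (Fin q → ℝ)) (Set.Iic w) = κ n (y n) (A n w) := by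
    intro n w
    have h1 : (Q n : Measure (Fin q → ℝ)) (Set.Iic w) =
      ((κ n (y n)).map (fun x => (a n)⁻¹ • (x - b n))) ((fun x => T x) ⁻¹' Set.Iic w) :=
        Measure.map_apply hTm measurableSet_Iic
    rw [h1, Measure.map_apply (hΦm n) (hTm measurableSet_Iic)]
    rfl
  let τ : ℕ → Set ℝ → Set ℝ := fun n t => (fun z => (c n)⁻¹ * (z - d n)) ⁻¹' t
  have hτm : ∀ n t, MeasurableSet t → MeasurableSet (τ n t) := fun n t ht =>
    (by fun_prop : Measurable (fun z => (c n)⁻¹ * (z - d n))) ht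
  have hPs : ∀ n (s : Set (Fin q → ℝ)) t, MeasurableSet s → MeasurableSet t →
      (P n : Measure ((Fin q → ℝ) × ℝ)) (s ×ˢ t) =
        μ n ({x | T ((a n)⁻¹ • (x - b n)) ∈ s} ×ˢ τ n t) := by
    intro n s t hs ht
    have h1 : (P n : Measure ((Fin q → ℝ) × ℝ)) (s ×ˢ t) =
      ((μ n).map (fun p => ((a n)⁻¹ • (p.1 - b n), (c n)⁻¹ * (p.2 - d n))))
        ((fun p : (Fin q → ℝ) × ℝ => (T p.1, p.2)) ⁻¹' (s ×ˢ t)) :=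
        Measure.map_apply hT2m (hs.prod ht)
    rw [h1, Measure.map_apply (hNm n) (hT2m (hs.prod ht))]
    rfl
  have hPu : ∀ n t, MeasurableSet t → (P n : Measure ((Fin q → ℝ) × ℝ)) (Set.univ ×ˢ t) =
      ((μ n).map Prod.snd) (τ n t) := by
    intro n t ht
    rw [hPs n _ t MeasurableSet.univ ht, Measure.map_apply measurable_snd (hτm n t ht)]
    congr 1
    ext p
    simp
  have hPI : ∀ n w t, MeasurableSet t → (P n : Measure ((Fin q → ℝ) × ℝ)) (Set.Iic w ×ˢ t) =
      ∫⁻ z in τ n t, κ n z (A n w) ∂((μ n).map Prod.snd) := by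
    intro n w t ht
    rw [hPs n _ t measurableSet_Iic ht]
    exact (hκ n).2 _ _ (hAm n w) (hτm n t ht)
  have key : Tendsto Q atTop (𝓝 ρ) := by
    apply tendsto_of_orthants
    intro w hw
    refine (ENNReal.tendsto_toReal (measure_ne_top _ _)).comp
      (orthant_core P ν1 hP Q ρ (T γ) ξ _ hy ?_ ?_ ?_ ?_ ?_ w hw)
    · intro B t hB ht
      have hm : MeasurableSet {p : (Fin q → ℝ) × ℝ | p.1 + (ξ - p.2) • T γ ∈ B ∧ p.2 ∈ t} :=
        ((by fun_prop : Measurable (fun p : (Fin q → ℝ) × ℝ => p.1 + (ξ - p.2) • T γ)) hB).inter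
          (measurable_snd ht)
      rw [hν1 _ hm, hρA B hB, hν1t t ht]
      have h3 := hind.measure_inter_preimage_eq_mul ((fun x => T x) ⁻¹' B) t (hTm hB) ht
      rw [Set.univ_prod]
      refine Eq.trans ?_ h3
      congr 1
      ext p
      simp
    · intro e
      rw [hν1t _ (measurableSet_singleton e)]
      exact hatom e
    · intro e f hef
      rw [hν1t _ measurableSet_Ioo]
      exact hpos e f hef
    · intro n w t ht hle
      rw [hQ, hPu n t ht, hPI n w t ht, ← setLIntegral_const]
      refine setLIntegral_mono' (hτm n t ht) fun z hz => hanti n w _ _ ?_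
      have := hle _ hz
      have h4 := le_of_mul_le_mul_left this (inv_pos.2 (hc n))
      linarith
    · intro n w t ht hle
      rw [hQ, hPu n t ht, hPI n w t ht, ← setLIntegral_const]
      refine setLIntegral_mono' (hτm n t ht) fun z hz => hanti n w _ _ ?_
      have := hle _ hz
      have h4 := le_of_mul_le_mul_left this (inv_pos.2 (hc n))
      linarith
  have hback := ProbabilityMeasure.tendsto_map_of_tendsto_of_continuous Q ρ key hTsc
  have hinv : ∀ M : ProbabilityMeasure (Fin q → ℝ),
      (M.map hTm.aemeasurable).map hTsc.measurable.aemeasurable = M := by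
    intro M
    apply Subtype.ext
    change Measure.map _ (Measure.map _ (M : Measure (Fin q → ℝ))) = _
    rw [Measure.map_map hTsc.measurable hTm]
    have : (fun x => T.symm x) ∘ (fun x => T x) = id := by ext; simp
    rw [this, Measure.map_id]
    rfl
  have hback' : Tendsto Q0 atTop (𝓝 ρ0) := by
    simpa only [Q, ρ, hinv] using hback
  exact ProbabilityMeasure.tendsto_iff_forall_integral_tendsto.1 hback'

/-- Corollary 2.5: the Gaussian conditional CLT when `T Xₙ` is stochastically monotone
with respect to `Yₙ` for some fixed invertible linear operator `T`. -/
theorem nerman_gaussian_conditional_clt_linear_transform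
    (q : ℕ) (hq : 0 < q)
    (T : (Fin q → ℝ) ≃ₗ[ℝ] (Fin q → ℝ))
    (μ : ℕ → Measure ((Fin q → ℝ) × ℝ)) (hμ : ∀ n, IsProbabilityMeasure (μ n))
    (κ : ℕ → Kernel ℝ (Fin q → ℝ)) (hκ : ∀ n, IsCondLaw (μ n) (κ n))
    (hmono : ∀ n, StochIncrFam (fun z => (κ n z).map (fun x => T x)) ∨
        StochDecrFam (fun z => (κ n z).map (fun x => T x)))
    (a c : ℕ → ℝ) (b : ℕ → Fin q → ℝ) (d : ℕ → ℝ)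
    (ha : ∀ n, 0 < a n) (hc : ∀ n, 0 < c n)
    (ν : Measure ((Fin q → ℝ) × ℝ)) (hν : IsProbabilityMeasure ν)
    (hGauss : IsGaussianMeasure ν)
    (hVar : 0 < covFn ν (fun p => p.2) (fun p => p.2))
    (hconv : TendstoInDistribution
      (fun n => (μ n).map (fun p => ((a n)⁻¹ • (p.1 - b n), (c n)⁻¹ * (p.2 - d n)))) ν)
    (y : ℕ → ℝ) (ξ : ℝ)
    (hy : Tendsto (fun n => (c n)⁻¹ * (y n - d n)) atTop (𝓝 ξ))
    (γ : Fin q → ℝ)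
    (hγ : ∀ i, γ i = covFn ν (fun p => p.1 i) (fun p => p.2) /
        covFn ν (fun p => p.2) (fun p => p.2)) :
    TendstoInDistribution
      (fun n => (κ n (y n)).map (fun x => (a n)⁻¹ • (x - b n)))
      (ν.map (fun p => p.1 + (ξ - p.2) • γ)) := by
  obtain ⟨hind, hatom, hpos⟩ := gaussian_facts ν hν hGauss hVar ξ γ hγ
  have hTm : Measurable (fun x => T x) :=
    (LinearMap.continuous_of_finiteDimensional T.toLinearMap).measurable
  -- the decreasing case is the increasing case for the negated operator
  let T' : (Fin q → ℝ) ≃ₗ[ℝ] (Fin q → ℝ) := T.trans (LinearEquiv.neg ℝ)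
  have hTm' : Measurable (fun x => T' x) :=
    (LinearMap.continuous_of_finiteDimensional T'.toLinearMap).measurable
  have hdecr : ∀ n, StochDecrFam (fun z => (κ n z).map (fun x => T x)) →
      StochIncrFam (fun z => (κ n z).map (fun x => T' x)) := by
    intro n h z₁ z₂ hz x
    have h1 := h z₁ z₂ hz (-x)
    simp only at h1 ⊢
    have hm1 : MeasurableSet {w | -x ≤ w} := measurableSet_Ici
    have hm2 : MeasurableSet {w | w ≤ x} := measurableSet_Iic
    rw [Measure.map_apply hTm hm1, Measure.map_apply hTm hm1] at h1
    rw [Measure.map_apply hTm' hm2, Measure.map_apply hTm' hm2]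
    have : (fun x => T' x) ⁻¹' {w | w ≤ x} = (fun x => T x) ⁻¹' {w | -x ≤ w} := by
      ext v
      simp [T', neg_le]
    rw [this]
    exact h1
  intro f
  refine tendsto_of_subseq_tendsto fun ns hns => ?_
  by_cases hfr : ∃ᶠ k in atTop, StochIncrFam (fun z => (κ (ns k) z).map (fun x => T x))
  · obtain ⟨ms, hms, hincr⟩ := extraction_of_frequently_atTop hfr
    refine ⟨ms, ?_⟩
    have hlim : Tendsto (fun k => ns (ms k)) atTop atTop := hns.comp hms.tendsto_atTop
    exact increasing_case q T (fun k => μ (ns (ms k))) (fun k => hμ _) (fun k => κ (ns (ms k)))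
      (fun k => hκ _) hincr (fun k => a (ns (ms k))) (fun k => c (ns (ms k)))
      (fun k => b (ns (ms k))) (fun k => d (ns (ms k))) (fun k => ha _) (fun k => hc _) ν hν
      (fun f => (hconv f).comp hlim) (fun k => y (ns (ms k))) ξ (hy.comp hlim) γ hind hatom hpos f
  · rw [not_frequently] at hfr
    obtain ⟨ms, hms, hincr⟩ := extraction_of_frequently_atTop hfr.frequently
    refine ⟨ms, ?_⟩
    have hlim : Tendsto (fun k => ns (ms k)) atTop atTop := hns.comp hms.tendsto_atTop
    exact increasing_case q T' (fun k => μ (ns (ms k))) (fun k => hμ _) (fun k => κ (ns (ms k)))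
      (fun k => hκ _) (fun k => hdecr _ ((hmono _).resolve_left (hincr k)))
      (fun k => a (ns (ms k))) (fun k => c (ns (ms k)))
      (fun k => b (ns (ms k))) (fun k => d (ns (ms k))) (fun k => ha _) (fun k => hc _) ν hν
      (fun f => (hconv f).comp hlim) (fun k => y (ns (ms k))) ξ (hy.comp hlim) γ hind hatom hpos f
end
end

section
/- For each n, throw m = m(n) balls independently of each other into n boxes, each ball landing in each box with probability 1/n, and let Z_{mn} be the number of empty boxes. If m(n)/n → λ for some λ > 0 as n → ∞, then n^{-1/2}(Z_{mn} − n e^{−m/n}) converges in distribution to the normal distribution N(0, e^{−λ} − e^{−2λ} − λ e^{−2λ}). -/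
open MeasureTheory ProbabilityTheory Filter Topology

noncomputable section

/-- The uniform probability measure on a finite type: `m` balls thrown independently and
uniformly into `n` boxes are modeled by the uniform measure on `Fin m → Fin n`. -/
def uniformFin (n m : ℕ) : Measure (Fin m → Fin n) :=
  (Fintype.card (Fin m → Fin n) : ENNReal)⁻¹ • Measure.count

/-- The number of empty boxes in the allocation `ω` of balls to the `n` boxes. -/
def emptyBoxes (n m : ℕ) (ω : Fin m → Fin n) : ℕ :=
  (Finset.univ.filter fun b : Fin n => ∀ i, ω i ≠ b).card

lemma eb_comb (n m : ℕ) (s : ℂ) :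
    ∑ ω : Fin m → Fin n, s ^ (emptyBoxes n m ω) =
      ∑ A : Finset (Fin n), (s - 1) ^ A.card * ((n - A.card : ℕ) : ℂ) ^ m := by
  classical
  have h1 : ∀ ω : Fin m → Fin n, s ^ (emptyBoxes n m ω) =
      ∑ A : Finset (Fin n), if (∀ i, ω i ∉ A) then (s - 1) ^ A.card else 0 := by
    intro ω
    have h := Finset.sum_pow_mul_eq_add_pow (s - 1) 1
      (Finset.univ.filter fun b : Fin n => ∀ i, ω i ≠ b)
    simp only [one_pow, mul_one, sub_add_cancel] at h
    unfold emptyBoxes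
    rw [← h, ← Finset.sum_filter]
    refine Finset.sum_congr ?_ fun _ _ => rfl
    ext A
    simp only [Finset.mem_powerset, Finset.mem_filter, Finset.mem_univ, true_and]
    constructor
    · intro hA i hi
      have := hA hi
      simp only [Finset.mem_filter, Finset.mem_univ, true_and] at this
      exact this i rfl
    · intro hA b hb
      simp only [Finset.mem_filter, Finset.mem_univ, true_and]
      intro i hi
      exact hA i (hi ▸ hb)
  simp_rw [h1]
  rw [Finset.sum_comm]
  refine Finset.sum_congr rfl fun A _ => ?_
  rw [← Finset.sum_filter, Finset.sum_const]
  have : (Finset.univ.filter fun ω : Fin m → Fin n => ∀ i, ω i ∉ A) =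
      Fintype.piFinset (fun _ => Aᶜ) := by
    ext ω
    simp
  rw [this, Fintype.card_piFinset]
  simp only [Finset.prod_const, Finset.card_compl, Fintype.card_fin, Finset.card_univ, nsmul_eq_mul]
  push_cast
  ring

open Complex in
lemma eb_cauchy (j m : ℕ) (r : ℝ) (hr : 0 < r) :
    ∫ θ in (-Real.pi)..Real.pi, exp (j * (r * exp (I * θ))) * exp (-(I * m * θ)) =
      2 * Real.pi * r ^ m / m.factorial * (j : ℂ) ^ m := by
  have hd : Differentiable ℂ (fun z : ℂ => exp (j * z)) := by fun_prop
  have h := (hd.diffContOnCl (s := Metric.ball 0 r)).circleIntegral_one_div_sub_center_pow_smul hr m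
  have h2 : iteratedDeriv m (fun z : ℂ => exp (j * z)) 0 = (j : ℂ) ^ m := by
    rw [iteratedDeriv_cexp_const_mul]
    simp
  rw [h2] at h
  have hrc : (r : ℂ) ≠ 0 := by exact_mod_cast hr.ne'
  have h3 : (∮ z in C(0, r), (1 / (z - 0) ^ (m + 1)) • exp (j * z)) =
      (I / r ^ m) * ∫ θ in (0)..(2 * Real.pi),
        exp (j * (r * exp (I * θ))) * exp (-(I * m * θ)) := by
    rw [circleIntegral, ← intervalIntegral.integral_const_mul]
    refine intervalIntegral.integral_congr fun θ _ => ?_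
    simp only [deriv_circleMap, circleMap, zero_add, sub_zero, smul_eq_mul]
    have e1 : exp (-(I * m * θ)) = (exp (I * θ) ^ m)⁻¹ := by
      rw [← exp_nat_mul, ← exp_neg]; congr 1; ring
    rw [e1, mul_comm (θ : ℂ) I]
    have := exp_ne_zero (I * θ)
    field_simp
    ring
  have h4 : ∫ θ in (0)..(2 * Real.pi),
        exp (j * (r * exp (I * θ))) * exp (-(I * m * θ)) =
      ∫ θ in (-Real.pi)..Real.pi, exp (j * (r * exp (I * θ))) * exp (-(I * m * θ)) := by
    have hp : Function.Periodic (fun θ : ℝ =>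
        exp (j * (r * exp (I * θ))) * exp (-(I * m * θ))) (2 * Real.pi) := by
      intro θ
      simp only
      have e1 : exp (I * ((θ + 2 * Real.pi : ℝ) : ℂ)) = exp (I * θ) := by
        rw [← exp_periodic (I * θ)]; congr 1; push_cast; ring
      have e2 : ∀ θ : ℝ, exp (-(I * m * θ)) = (exp (I * θ) ^ m)⁻¹ := by
        intro θ
        rw [← exp_nat_mul, ← exp_neg]; congr 1; ring
      rw [e2, e2, e1]
    have := hp.intervalIntegral_add_eq 0 (-Real.pi)
    rw [zero_add] at this
    rw [this]
    congr 1
    ring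
  rw [h3, h4] at h
  set J := ∫ θ in (-Real.pi)..Real.pi, exp (j * (r * exp (I * θ))) * exp (-(I * m * θ))
  have : (m.factorial : ℂ) ≠ 0 := by exact_mod_cast m.factorial_ne_zero
  simp only [smul_eq_mul] at h
  have hI := I_ne_zero
  field_simp at h ⊢
  linear_combination h

open Complex in
lemma eb_gen (n m : ℕ) (r : ℝ) (hr : 0 < r) (s : ℂ) :
    ∫ θ in (-Real.pi)..Real.pi, (exp (r * exp (I * θ)) + s - 1) ^ n * exp (-(I * m * θ)) =
      2 * Real.pi * r ^ m / m.factorial * ∑ ω : Fin m → Fin n, s ^ (emptyBoxes n m ω) := by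
  rw [eb_comb, Finset.mul_sum]
  have : ∀ θ : ℝ, (exp (r * exp (I * θ)) + s - 1) ^ n * exp (-(I * m * θ)) =
      ∑ A : Finset (Fin n), (s - 1) ^ A.card *
        (exp ((n - A.card : ℕ) * (r * exp (I * θ))) * exp (-(I * m * θ))) := by
    intro θ
    have h := Fintype.sum_pow_mul_eq_add_pow (Fin n) (s - 1) (exp (r * exp (I * θ)))
    rw [Fintype.card_fin] at h
    rw [show exp (r * exp (I * θ)) + s - 1 = s - 1 + exp (r * exp (I * θ)) by ring, ← h,
      Finset.sum_mul]
    refine Finset.sum_congr rfl fun A _ => ?_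
    rw [exp_nat_mul]
    ring
  simp_rw [this]
  rw [intervalIntegral.integral_finsetSum]
  · refine Finset.sum_congr rfl fun A _ => ?_
    rw [intervalIntegral.integral_const_mul, eb_cauchy _ _ _ hr]
    ring
  · intro A _
    apply Continuous.intervalIntegrable
    fun_prop

open Complex in
lemma eb_L2 {δ : ℕ → ℝ} {c : ℕ → ℂ} {C : ℂ} (hδ : Tendsto δ atTop (𝓝 0))
    (hδ0 : ∀ᶠ n in atTop, δ n ≠ 0) (hc : Tendsto c atTop (𝓝 C)) :
    Tendsto (fun n => (exp (δ n * c n) - 1 - δ n * c n) / (δ n : ℂ) ^ 2) atTop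
      (𝓝 (C ^ 2 / 2)) := by
  have hδc : Tendsto (fun n => (δ n : ℂ)) atTop (𝓝 0) := by
    exact_mod_cast (continuous_ofReal.tendsto 0).comp hδ
  have hw : Tendsto (fun n => (δ n : ℂ) * c n) atTop (𝓝 0) := by
    simpa using hδc.mul hc
  have hw1 : ∀ᶠ n in atTop, ‖(δ n : ℂ) * c n‖ ≤ 1 := by
    have := hw.norm
    rw [norm_zero] at this
    exact (this.eventually (gt_mem_nhds one_pos)).mono fun n h => le_of_lt h
  have hz : Tendsto (fun n => (exp (δ n * c n) - 1 - δ n * c n - (δ n * c n) ^ 2 / 2)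
      / (δ n : ℂ) ^ 2) atTop (𝓝 0) := by
    rw [tendsto_zero_iff_norm_tendsto_zero]
    have hb : Tendsto (fun n => ‖(δ n : ℂ)‖ * ‖c n‖ ^ 3) atTop (𝓝 0) := by
      simpa using hδc.norm.mul (hc.norm.pow 3)
    refine squeeze_zero' (Eventually.of_forall fun n => norm_nonneg _) ?_ hb
    filter_upwards [hw1, hδ0] with n h1 h0
    have hb := exp_bound h1 (n := 3) (by norm_num)
    have h0' : (δ n : ℂ) ≠ 0 := by exact_mod_cast h0
    have h0n : 0 < ‖(δ n : ℂ)‖ := norm_pos_iff.2 h0'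
    rw [norm_div, norm_pow, div_le_iff₀ (by positivity)]
    have e : ∑ k ∈ Finset.range 3, ((δ n : ℂ) * c n) ^ k / (k.factorial : ℂ) =
        1 + δ n * c n + (δ n * c n) ^ 2 / 2 := by
      simp [Finset.sum_range_succ, Nat.factorial]
    rw [e] at hb
    calc _ = ‖exp (δ n * c n) - (1 + δ n * c n + (δ n * c n) ^ 2 / 2)‖ := by congr 1; ring
      _ ≤ _ := hb
      _ ≤ ‖(δ n : ℂ) * c n‖ ^ 3 * 1 := by
        gcongr
        norm_num [Nat.factorial]
      _ = _ := by rw [norm_mul]; ring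
  have hq : Tendsto (fun n => c n ^ 2 / 2) atTop (𝓝 (C ^ 2 / 2)) := (hc.pow 2).div_const 2
  have := hz.add hq
  rw [zero_add] at this
  refine this.congr' ?_
  filter_upwards [hδ0] with n h0
  have h0' : (δ n : ℂ) ≠ 0 := by exact_mod_cast h0
  field_simp
  ring

open Complex in
lemma eb_L1 {δ : ℕ → ℝ} {c : ℕ → ℂ} {C : ℂ} (hδ : Tendsto δ atTop (𝓝 0))
    (hδ0 : ∀ᶠ n in atTop, δ n ≠ 0) (hc : Tendsto c atTop (𝓝 C)) :
    Tendsto (fun n => (exp (δ n * c n) - 1) / (δ n : ℂ)) atTop (𝓝 C) := by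
  have hδc : Tendsto (fun n => (δ n : ℂ)) atTop (𝓝 0) := by
    exact_mod_cast (continuous_ofReal.tendsto 0).comp hδ
  have := (hδc.mul (eb_L2 hδ hδ0 hc)).add hc
  rw [zero_mul, zero_add] at this
  refine this.congr' ?_
  filter_upwards [hδ0] with n h0
  have h0' : (δ n : ℂ) ≠ 0 := by exact_mod_cast h0
  field_simp
  ring

open Complex in
/-- The normalized base of the n-th power. -/
def ebH (r θ τ : ℝ) : ℂ :=
  exp (-r) * (exp (r * exp (I * θ)) + exp (I * τ) - 1) * exp (-(I * r * θ) - I * τ * exp (-r))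

open Complex in
lemma eb_limit {δ r : ℕ → ℝ} {lam : ℝ} (hδ : Tendsto δ atTop (𝓝 0))
    (hδ0 : ∀ᶠ n in atTop, δ n ≠ 0) (hr : Tendsto r atTop (𝓝 lam)) (x t : ℝ) :
    Tendsto (fun n => (ebH (r n) (δ n * x) (δ n * t) - 1) / (δ n : ℂ) ^ 2) atTop
      (𝓝 (-(lam * x ^ 2 / 2) - exp (-lam) * t ^ 2 / 2 + exp (-lam) ^ 2 * t ^ 2 / 2
        + lam * exp (-lam) * x * t)) := by
  have hδc : Tendsto (fun n => (δ n : ℂ)) atTop (𝓝 0) := by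
    exact_mod_cast (continuous_ofReal.tendsto 0).comp hδ
  have hrc : Tendsto (fun n => (r n : ℂ)) atTop (𝓝 lam) :=
    (continuous_ofReal.tendsto lam).comp hr
  have ha : Tendsto (fun n => exp (-(r n : ℂ))) atTop (𝓝 (exp (-lam))) :=
    (continuous_exp.tendsto _).comp hrc.neg
  have hP := eb_L2 hδ hδ0 (c := fun _ => I * x) tendsto_const_nhds
  set P := fun n => (exp (δ n * (I * x)) - 1 - δ n * (I * x)) / (δ n : ℂ) ^ 2 with hPdef
  have hα : Tendsto (fun n => r n * (δ n * P n) - I * t * exp (-(r n : ℂ))) atTop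
      (𝓝 (lam * (0 * ((I * x) ^ 2 / 2)) - I * t * exp (-lam))) :=
    (hrc.mul (hδc.mul hP)).sub (ha.const_mul _)
  have hβ : Tendsto (fun n => -(I * r n * x) - I * t * exp (-(r n : ℂ))) atTop
      (𝓝 (-(I * lam * x) - I * t * exp (-lam))) :=
    (((hrc.const_mul I).mul_const _).neg).sub (ha.const_mul _)
  have hT2 := eb_L2 hδ hδ0 (c := fun _ => I * t) tendsto_const_nhds
  have hT1 := eb_L1 hδ hδ0 (c := fun _ => I * t) tendsto_const_nhds
  have hα2 := eb_L2 hδ hδ0 hα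
  have hβ1 := eb_L1 hδ hδ0 hβ
  have hall := (((hrc.mul hP).add hα2).add (ha.mul hT2)).add (ha.mul (hT1.mul hβ1))
  have hI : I ^ 2 = -1 := I_sq
  have elim : ∀ a : ℂ, (lam : ℂ) * ((I * x) ^ 2 / 2) + (lam * (0 * ((I * x) ^ 2 / 2)) - I * t * a) ^ 2 / 2
     + a * ((I * t) ^ 2 / 2) + a * ((I * t) * (-(I * lam * x) - I * t * a)) =
     (-(lam * x ^ 2 / 2) - a * t ^ 2 / 2 + a ^ 2 * t ^ 2 / 2
        + lam * a * x * t) := by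
    intro a
    linear_combination (lam * x ^ 2 / 2 + t ^ 2 * a ^ 2 / 2 + a * t ^ 2 / 2 - a * t * lam * x
      - a ^ 2 * t ^ 2 : ℂ) * hI
  rw [elim] at hall
  refine hall.congr' ?_
  filter_upwards [hδ0] with n h0
  have h0' : (δ n : ℂ) ≠ 0 := by exact_mod_cast h0
  have hPn : exp (δ n * (I * x)) = 1 + δ n * (I * x) + (δ n : ℂ) ^ 2 * P n := by
    simp only [hPdef]; field_simp; ring
  have hH : ebH (r n) (δ n * x) (δ n * t) =
      exp (δ n * (r n * (δ n * P n) - I * t * exp (-(r n : ℂ)))) +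
      (exp (δ n * (I * t)) - 1) * exp (-(r n : ℂ)) *
        exp (δ n * (-(I * r n * x) - I * t * exp (-(r n : ℂ)))) := by
    have e1 : δ n * (r n * (δ n * P n) - I * t * exp (-(r n : ℂ))) =
      -(r n : ℂ) + r n * exp (I * ((δ n * x : ℝ) : ℂ)) +
        (-(I * r n * ((δ n * x : ℝ) : ℂ)) - I * ((δ n * t : ℝ) : ℂ) * exp (-(r n : ℂ))) := by
      rw [show I * ((δ n * x : ℝ) : ℂ) = δ n * (I * x) by push_cast; ring, hPn]
      push_cast
      ring
    have e2 : δ n * (-(I * r n * x) - I * t * exp (-(r n : ℂ))) =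
        (-(I * r n * ((δ n * x : ℝ) : ℂ)) - I * ((δ n * t : ℝ) : ℂ) * exp (-(r n : ℂ))) := by
      push_cast; ring
    have e3 : δ n * (I * t) = I * ((δ n * t : ℝ) : ℂ) := by push_cast; ring
    rw [e1, e2, e3, exp_add, exp_add, ebH]
    ring
  rw [hH]
  clear_value P
  field_simp
  ring

open Complex in
lemma eb_bound (r θ τ : ℝ) (hr : 0 < r) (hθ : |θ| ≤ Real.pi) :
    ‖ebH r θ τ‖ ≤ Real.exp (-(Real.exp (-r) * r ^ 2 / (2 + r) * (2 / Real.pi ^ 2) * θ ^ 2)) := by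
  have h1 : ‖ebH r θ τ‖ = Real.exp (-r) * ‖exp (r * exp (I * θ)) + exp (I * τ) - 1‖ := by
    rw [ebH, norm_mul, norm_mul, norm_exp, norm_exp]
    have e1 : (-(r : ℂ)).re = -r := by simp
    have e2 : (-(I * r * θ) - I * τ * exp (-r)).re = 0 := by
      rw [show (-(I * r * θ) - I * τ * exp (-r)) = ((-(r * θ) - τ * Real.exp (-r) : ℝ) : ℂ) * I by
        push_cast; ring]
      rw [re_ofReal_mul]; simp
    rw [e1, e2, Real.exp_zero, mul_one]
  set z : ℂ := r * exp (I * θ) with hz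
  have hzn : ‖z‖ = r := by
    rw [hz, norm_mul, mul_comm I, norm_exp_ofReal_mul_I, mul_one, norm_real, Real.norm_of_nonneg hr.le]
  have h2 : ‖exp z - (1 + z + z ^ 2 / 2)‖ ≤ Real.exp r - (1 + r + r ^ 2 / 2) := by
    have := norm_exp_sub_sum_le_exp_norm_sub_sum z 3
    rw [hzn] at this
    simpa [Finset.sum_range_succ, Nat.factorial] using this
  have h3 : ‖z + z ^ 2 / 2‖ ≤ r + r ^ 2 / 2 - r ^ 2 * (1 - Real.cos θ) / (2 + r) := by
    have hre : z.re = r * Real.cos θ := by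
      rw [hz, re_ofReal_mul, mul_comm I, exp_ofReal_mul_I_re]
    have him : z.im = r * Real.sin θ := by
      rw [hz, im_ofReal_mul, mul_comm I, exp_ofReal_mul_I_im]
    have hsq : ‖z + z ^ 2 / 2‖ ^ 2 = (r + r ^ 2 / 2) ^ 2 - r ^ 3 * (1 - Real.cos θ) := by
      have : z + z ^ 2 / 2 = z * (1 + z / 2) := by ring
      rw [this, norm_mul, mul_pow, hzn, ← normSq_eq_norm_sq, normSq_apply]
      have e1 : (1 + z / 2).re = 1 + r * Real.cos θ / 2 := by
        simp [hre]
      have e2 : (1 + z / 2).im = r * Real.sin θ / 2 := by simp [him]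
      rw [e1, e2]
      linear_combination (r ^ 4 / 4) * Real.sin_sq_add_cos_sq θ
    have hc := Real.cos_le_one θ
    have hc' := Real.neg_one_le_cos θ
    refine (pow_le_pow_iff_left₀ (norm_nonneg _) ?_ two_ne_zero).1 ?_
    rotate_left
    · rw [hsq]
      have : r ^ 2 * (1 - Real.cos θ) / (2 + r) * (2 * (r + r ^ 2 / 2)) = r ^ 3 * (1 - Real.cos θ) := by
        field_simp
      nlinarith [sq_nonneg (r ^ 2 * (1 - Real.cos θ) / (2 + r))]
    · have : r ^ 2 * (1 - Real.cos θ) / (2 + r) ≤ r + r ^ 2 / 2 := by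
        rw [div_le_iff₀ (by positivity)]
        have h5 : r ^ 2 * (1 - Real.cos θ) ≤ r ^ 2 * 2 := by gcongr; linarith
        have h6 : 0 < r ^ 3 := by positivity
        nlinarith
      linarith
  have h4 : ‖exp z + exp (I * τ) - 1‖ ≤ Real.exp r - r ^ 2 * (1 - Real.cos θ) / (2 + r) := by
    have : exp z + exp (I * τ) - 1 = (exp z - (1 + z + z ^ 2 / 2)) + (z + z ^ 2 / 2) + exp (I * τ) := by
      ring
    rw [this]
    refine (norm_add₃_le).trans ?_
    have h5 : ‖exp (I * τ)‖ = 1 := by rw [mul_comm I, norm_exp_ofReal_mul_I]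
    linarith
  have hcos : 2 / Real.pi ^ 2 * θ ^ 2 ≤ 1 - Real.cos θ := by
    have := Real.cos_le_one_sub_mul_cos_sq hθ
    linarith
  rw [h1]
  have hee : Real.exp (-r) * Real.exp r = 1 := by rw [← Real.exp_add]; simp
  calc _ ≤ Real.exp (-r) * (Real.exp r - r ^ 2 * (1 - Real.cos θ) / (2 + r)) := by gcongr
    _ = 1 - Real.exp (-r) * r ^ 2 / (2 + r) * (1 - Real.cos θ) := by
      rw [mul_sub, hee]; ring
    _ ≤ 1 - Real.exp (-r) * r ^ 2 / (2 + r) * (2 / Real.pi ^ 2 * θ ^ 2) := by gcongr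
    _ ≤ _ := by
      have := Real.add_one_le_exp (-(Real.exp (-r) * r ^ 2 / (2 + r) * (2 / Real.pi ^ 2) * θ ^ 2))
      linarith

instance eb_prob (n m : ℕ) : IsProbabilityMeasure (uniformFin (n + 1) m) := by
  constructor
  simp only [uniformFin, Measure.smul_apply, smul_eq_mul]
  rw [← Set.toFinite Set.univ |>.coe_toFinset, Measure.count_apply_finset]
  simp only [Set.Finite.toFinset_univ, Finset.card_univ]
  exact ENNReal.inv_mul_cancel (by simp) (by simp)

lemma eb_meas {n m : ℕ} {β : Type*} [MeasurableSpace β] (f : (Fin m → Fin n) → β) :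
    Measurable f := measurable_of_finite f

/-- The truncated rescaled integrand. -/
def ebF (m n : ℕ) (t x : ℝ) : ℂ :=
  Set.indicator (Set.Ioc (-(Real.pi * Real.sqrt n)) (Real.pi * Real.sqrt n))
    (fun x => ebH ((m : ℝ) / n) ((Real.sqrt n)⁻¹ * x) ((Real.sqrt n)⁻¹ * t) ^ n) x

lemma ebH_continuous (r τ : ℝ) : Continuous (fun θ => ebH r θ τ) := by
  unfold ebH
  fun_prop

open Complex in
lemma eb_charFun (n m : ℕ) (t : ℝ) :
    charFun ((uniformFin n m).map
        (fun ω => (Real.sqrt n)⁻¹ *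
          ((emptyBoxes n m ω : ℝ) - n * Real.exp (-(m : ℝ) / n)))) t =
      ((n : ℂ) ^ m)⁻¹ * (exp (-(I * ((Real.sqrt n)⁻¹ * t : ℝ) * exp (-((m / n : ℝ) : ℂ)))) ^ n *
        ∑ ω : Fin m → Fin n, exp (I * ((Real.sqrt n)⁻¹ * t : ℝ)) ^ (emptyBoxes n m ω)) := by
  rw [charFun_apply_real, integral_map (eb_meas _).aemeasurable (by fun_prop)]
  rw [uniformFin, integral_smul_measure, integral_count, Finset.mul_sum]
  have e0 : ((Fintype.card (Fin m → Fin n) : ENNReal)⁻¹).toReal = ((n : ℝ) ^ m)⁻¹ := by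
    simp
  rw [e0, real_smul]
  push_cast
  congr 1
  refine Finset.sum_congr rfl fun ω _ => ?_
  rw [← exp_nat_mul, ← exp_nat_mul, ← exp_add]
  congr 1
  rw [neg_div]
  ring

open Complex in
lemma eb_ratio (n m : ℕ) (hn : 0 < n) (hm : 0 < m) : ∃ K : ℂ, K ≠ 0 ∧ ∀ t : ℝ,
    ∫ x, ebF m n t x = K * charFun ((uniformFin n m).map
        (fun ω => (Real.sqrt n)⁻¹ *
          ((emptyBoxes n m ω : ℝ) - n * Real.exp (-(m : ℝ) / n)))) t := by
  have hnR : (0 : ℝ) < n := by exact_mod_cast hn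
  have hmR : (0 : ℝ) < m := by exact_mod_cast hm
  have hr : (0 : ℝ) < m / n := by positivity
  have hs : 0 < Real.sqrt n := Real.sqrt_pos.2 hnR
  have hnC : (n : ℂ) ≠ 0 := by exact_mod_cast hn.ne'
  have hsC : ((Real.sqrt n : ℝ) : ℂ) ≠ 0 := by exact_mod_cast hs.ne'
  have hrC : ((m / n : ℝ) : ℂ) ≠ 0 := by exact_mod_cast hr.ne'
  have hpC : (Real.pi : ℂ) ≠ 0 := by exact_mod_cast Real.pi_ne_zero
  have hfC : (m.factorial : ℂ) ≠ 0 := by exact_mod_cast m.factorial_ne_zero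
  set r : ℝ := m / n with hrdef
  refine ⟨(Real.sqrt n : ℝ) * (exp (-(r : ℂ)) ^ n * (2 * Real.pi * (r : ℂ) ^ m / m.factorial * (n : ℂ) ^ m)),
    ?_, ?_⟩
  · have := exp_ne_zero (-(r : ℂ))
    have h2 : (2 : ℂ) ≠ 0 := two_ne_zero
    exact mul_ne_zero hsC (mul_ne_zero (pow_ne_zero _ this) (mul_ne_zero (div_ne_zero
      (mul_ne_zero (mul_ne_zero h2 hpC) (pow_ne_zero _ hrC)) hfC) (pow_ne_zero _ hnC)))
  intro t
  rw [eb_charFun]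
  simp only [ebF]
  rw [integral_indicator measurableSet_Ioc, ← intervalIntegral.integral_of_le
    (by have := Real.pi_pos; nlinarith [mul_pos this hs])]
  have hsub := intervalIntegral.integral_comp_mul_left
    (fun θ => ebH r θ ((Real.sqrt n)⁻¹ * t) ^ n) (inv_ne_zero hs.ne')
    (a := -(Real.pi * Real.sqrt n)) (b := Real.pi * Real.sqrt n)
  rw [hsub]
  rw [show (Real.sqrt n)⁻¹ * -(Real.pi * Real.sqrt n) = -Real.pi by field_simp,
    show (Real.sqrt n)⁻¹ * (Real.pi * Real.sqrt n) = Real.pi by field_simp, inv_inv, real_smul]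
  set τ := (Real.sqrt n)⁻¹ * t
  have hH : ∀ θ : ℝ, ebH r θ τ ^ n = (exp (-(r : ℂ)) ^ n * exp (-(I * τ * exp (-(r : ℂ)))) ^ n) *
      ((exp (r * exp (I * θ)) + exp (I * τ) - 1) ^ n * exp (-(I * m * θ))) := by
    intro θ
    have : exp (-(I * m * θ)) = exp (-(I * r * θ)) ^ n := by
      rw [← exp_nat_mul, hrdef]
      congr 1
      push_cast
      field_simp
    rw [ebH, this, sub_eq_add_neg (-(I * r * θ)), exp_add]
    simp only [mul_pow]
    ring
  simp_rw [hH]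
  rw [intervalIntegral.integral_const_mul, eb_gen n m r hr, ← hrdef]
  field_simp

open Complex in
lemma eb_dct (m : ℕ → ℕ) (lam : ℝ) (hlam : 0 < lam)
    (hm : Tendsto (fun n => (m n : ℝ) / n) atTop (𝓝 lam)) (t : ℝ) :
    Tendsto (fun n => ∫ x, ebF (m n) n t x) atTop
      (𝓝 (∫ x : ℝ, exp (-(lam * x ^ 2 / 2) - exp (-lam) * t ^ 2 / 2 + exp (-lam) ^ 2 * t ^ 2 / 2
        + lam * exp (-lam) * x * t))) := by
  set c : ℝ := Real.exp (-(2 * lam)) * (lam / 2) ^ 2 / (2 + 2 * lam) * (2 / Real.pi ^ 2) with hc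
  have hcpos : 0 < c := by have := Real.pi_pos; positivity
  have hsq : Tendsto (fun n : ℕ => Real.sqrt n) atTop atTop :=
    Real.tendsto_sqrt_atTop.comp tendsto_natCast_atTop_atTop
  refine tendsto_integral_filter_of_dominated_convergence (fun x => Real.exp (-c * x ^ 2)) ?_ ?_
    (integrable_exp_neg_mul_sq hcpos) ?_
  · refine Eventually.of_forall fun n => ?_
    unfold ebF
    refine (Continuous.aestronglyMeasurable ?_).indicator measurableSet_Ioc
    exact ((ebH_continuous _ _).comp (by fun_prop)).pow n
  · filter_upwards [hm.eventually (lt_mem_nhds (show lam / 2 < lam by linarith)),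
      hm.eventually (gt_mem_nhds (show lam < 2 * lam by linarith)), eventually_gt_atTop 0]
      with n h1 h2 hn
    refine Eventually.of_forall fun x => ?_
    have hnR : (0 : ℝ) < n := by exact_mod_cast hn
    have hs : 0 < Real.sqrt n := Real.sqrt_pos.2 hnR
    unfold ebF
    by_cases hx : x ∈ Set.Ioc (-(Real.pi * Real.sqrt n)) (Real.pi * Real.sqrt n)
    · rw [Set.indicator_of_mem hx, norm_pow]
      have hθ : |(Real.sqrt n)⁻¹ * x| ≤ Real.pi := by
        rw [abs_mul, abs_of_pos (inv_pos.2 hs), inv_mul_le_iff₀ hs, mul_comm]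
        exact abs_le.2 ⟨hx.1.le, hx.2⟩
      have hb := eb_bound ((m n : ℝ) / n) _ ((Real.sqrt n)⁻¹ * t) (by linarith) hθ
      refine (pow_le_pow_left₀ (norm_nonneg _) hb n).trans ?_
      rw [← Real.exp_nat_mul]
      apply Real.exp_le_exp.2
      set r := (m n : ℝ) / n
      have hcr : c ≤ Real.exp (-r) * r ^ 2 / (2 + r) * (2 / Real.pi ^ 2) := by
        rw [hc]
        gcongr
      have : (n : ℝ) * ((Real.sqrt n)⁻¹ * x) ^ 2 = x ^ 2 := by
        rw [mul_pow, inv_pow, Real.sq_sqrt hnR.le]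
        field_simp
      calc _ = -(Real.exp (-r) * r ^ 2 / (2 + r) * (2 / Real.pi ^ 2) *
            ((n : ℝ) * ((Real.sqrt n)⁻¹ * x) ^ 2)) := by ring
        _ ≤ _ := by
          rw [this]
          nlinarith [sq_nonneg x]
    · rw [Set.indicator_of_notMem hx, norm_zero]
      positivity
  · refine Eventually.of_forall fun x => ?_
    have hδ : Tendsto (fun n : ℕ => (Real.sqrt n)⁻¹) atTop (𝓝 0) := tendsto_inv_atTop_zero.comp hsq
    have hδ0 : ∀ᶠ n : ℕ in atTop, (Real.sqrt n)⁻¹ ≠ 0 := by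
      filter_upwards [eventually_gt_atTop 0] with n hn
      have hnR : (0 : ℝ) < n := by exact_mod_cast hn
      exact inv_ne_zero (Real.sqrt_pos.2 hnR).ne'
    have hl := eb_limit hδ hδ0 hm x t
    have hl2 := tendsto_one_add_pow_exp_of_tendsto (g := fun n : ℕ =>
      ebH ((m n : ℝ) / n) ((Real.sqrt n)⁻¹ * x) ((Real.sqrt n)⁻¹ * t) - 1) (hl.congr fun n => by
        have : (((Real.sqrt n)⁻¹ : ℝ) : ℂ) ^ 2 = (n : ℂ)⁻¹ := by
          rw [← ofReal_pow, inv_pow, Real.sq_sqrt (by positivity)]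
          simp
        rw [this, div_inv_eq_mul, mul_comm])
    refine hl2.congr' ?_
    filter_upwards [hsq.eventually_gt_atTop (|x| / Real.pi)] with n hn
    rw [div_lt_iff₀ Real.pi_pos, mul_comm] at hn
    have := abs_lt.1 hn
    rw [ebF, Set.indicator_of_mem (show x ∈ Set.Ioc _ _ from ⟨this.1, this.2.le⟩)]
    simp

open Complex in
lemma eb_gauss (lam t : ℝ) (hlam : 0 < lam) :
    ∫ x : ℝ, exp (-(lam * x ^ 2 / 2) - exp (-lam) * t ^ 2 / 2 + exp (-lam) ^ 2 * t ^ 2 / 2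
        + lam * exp (-lam) * x * t) =
    exp (-((Real.exp (-lam) - Real.exp (-2 * lam) - lam * Real.exp (-2 * lam) : ℝ) * t ^ 2 / 2)) *
      (Real.sqrt (Real.pi / (lam / 2)) : ℝ) := by
  rw [← integral_gaussian, ← integral_complex_ofReal,
    ← integral_sub_right_eq_self (fun x : ℝ => ((Real.exp (-(lam / 2) * x ^ 2) : ℝ) : ℂ))
      (Real.exp (-lam) * t), ← integral_const_mul]
  congr 1
  ext x
  have : Real.exp (-2 * lam) = Real.exp (-lam) ^ 2 := by
    rw [← Real.exp_nat_mul]; congr 1; push_cast; ring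
  rw [this, ofReal_exp, ← exp_add]
  congr 1
  push_cast
  ring

open Complex in
lemma eb_char_tendsto (m : ℕ → ℕ) (lam : ℝ) (hlam : 0 < lam)
    (hm : Tendsto (fun n => (m n : ℝ) / n) atTop (𝓝 lam)) (t : ℝ) :
    Tendsto (fun n => charFun ((uniformFin n (m n)).map
        (fun ω => (Real.sqrt n)⁻¹ *
          ((emptyBoxes n (m n) ω : ℝ) - n * Real.exp (-(m n : ℝ) / n)))) t) atTop
      (𝓝 (charFun (gaussianReal 0
        (Real.toNNReal
          (Real.exp (-lam) - Real.exp (-2 * lam) - lam * Real.exp (-2 * lam)))) t)) := by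
  have hv : 0 ≤ Real.exp (-lam) - Real.exp (-2 * lam) - lam * Real.exp (-2 * lam) := by
    have : Real.exp (-lam) = Real.exp (-2 * lam) * Real.exp lam := by
      rw [← Real.exp_add]; congr 1; ring
    rw [this]
    nlinarith [Real.add_one_le_exp lam, Real.exp_pos (-2 * lam)]
  rw [charFun_gaussianReal, Real.coe_toNNReal _ hv]
  have h1 := eb_dct m lam hlam hm t
  have h0 := eb_dct m lam hlam hm 0
  rw [eb_gauss lam _ hlam] at h1 h0
  have hG : ((Real.sqrt (Real.pi / (lam / 2)) : ℝ) : ℂ) ≠ 0 := by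
    have := Real.pi_pos
    have : 0 < Real.sqrt (Real.pi / (lam / 2)) := Real.sqrt_pos.2 (by positivity)
    exact_mod_cast this.ne'
  have h := h1.div h0 (mul_ne_zero (exp_ne_zero _) hG)
  have e : ∀ v : ℝ, exp (-(v * (t : ℂ) ^ 2 / 2)) *
      (Real.sqrt (Real.pi / (lam / 2)) : ℝ) / (exp (-(v * ((0 : ℝ) : ℂ) ^ 2 / 2)) *
      (Real.sqrt (Real.pi / (lam / 2)) : ℝ)) = exp (t * (0 : ℝ) * I - v * t ^ 2 / 2) := by
    intro v
    rw [mul_div_mul_right _ _ hG]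
    simp
  rw [e] at h
  refine h.congr' ?_
  filter_upwards [hm.eventually (lt_mem_nhds hlam), eventually_gt_atTop 0] with n hr hn
  have hm0 : 0 < m n := by
    rcases Nat.eq_zero_or_pos (m n) with h | h
    · simp [h] at hr
    · exact h
  obtain ⟨K, hK, hKt⟩ := eb_ratio n (m n) hn hm0
  simp only [Pi.div_apply]
  rw [hKt t, hKt 0]
  obtain ⟨k, rfl⟩ := Nat.exists_eq_succ_of_ne_zero hn.ne'
  have : IsProbabilityMeasure ((uniformFin (k + 1) (m (k + 1))).map
        (fun ω => (Real.sqrt (k + 1 : ℕ))⁻¹ *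
          ((emptyBoxes (k + 1) (m (k + 1)) ω : ℝ) - (k + 1 : ℕ) * Real.exp (-(m (k + 1) : ℝ) / (k + 1 : ℕ))))) :=
    Measure.isProbabilityMeasure_map (eb_meas _).aemeasurable
  simp only [Nat.succ_eq_add_one, charFun_zero, probReal_univ, ofReal_one, mul_one]
  rw [mul_div_cancel_left₀ _ hK]

/-- Asymptotic normality of the number of empty boxes (Weiss; Example 3.1). -/
theorem emptyBoxes_clt (m : ℕ → ℕ) (lam : ℝ) (hlam : 0 < lam)
    (hm : Tendsto (fun n => (m n : ℝ) / n) atTop (𝓝 lam)) :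
    TendstoInDistribution
      (fun n => (uniformFin n (m n)).map
        (fun ω => (Real.sqrt n)⁻¹ *
          ((emptyBoxes n (m n) ω : ℝ) - n * Real.exp (-(m n : ℝ) / n))))
      (gaussianReal 0
        (Real.toNNReal
          (Real.exp (-lam) - Real.exp (-2 * lam) - lam * Real.exp (-2 * lam)))) := by
  intro f
  rw [← tendsto_add_atTop_iff_nat 1]
  have hP : ∀ k : ℕ, IsProbabilityMeasure ((uniformFin (k + 1) (m (k + 1))).map
        (fun ω => (Real.sqrt (k + 1 : ℕ))⁻¹ *
          ((emptyBoxes (k + 1) (m (k + 1)) ω : ℝ) -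
            (k + 1 : ℕ) * Real.exp (-(m (k + 1) : ℝ) / (k + 1 : ℕ))))) := fun k =>
    Measure.isProbabilityMeasure_map (eb_meas _).aemeasurable
  let μs : ℕ → ProbabilityMeasure ℝ := fun k => ⟨_, hP k⟩
  let μ₀ : ProbabilityMeasure ℝ := ⟨gaussianReal 0
        (Real.toNNReal
          (Real.exp (-lam) - Real.exp (-2 * lam) - lam * Real.exp (-2 * lam))), inferInstance⟩
  have hT : Tendsto μs atTop (𝓝 μ₀) := by
    refine ProbabilityMeasure.tendsto_iff_tendsto_charFun.2 fun t => ?_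
    exact (tendsto_add_atTop_iff_nat 1).2 (eb_char_tendsto m lam hlam hm t)
  exact (ProbabilityMeasure.tendsto_iff_forall_integral_tendsto.1 hT) f
end
end
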